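/- arXiv:math/0304121 — 5 statements merged into one kernel-verified Lean document; each statement's English description precedes it below -/
import Mathlib

section
/- Let f = xyzt(x+y)(y+z)(z+t)(t+x) ∈ ℚ[x,y,z,t] (arrangement no. 2) and let Jf and I_eq be its Jacobian ideal and equisingular ideal. Then the degree-8 homogeneous component of I_eq equals the degree-8 homogeneous component of Jf; equivalently, dim_ℚ (I_eq/Jf)^(8) = 0, i.e., the octic arrangement no. 2 admits no nontrivial equisingular deformations and the associated double octic Calabi–Yau threefold is rigid. -/
/-!
Rigidity of the double octic of arrangement no. 2:
for `f = xyzt(x+y)(y+z)(z+t)(t+x)` the degree-8 homogeneous component of the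
equisingular ideal `I_eq` equals that of the Jacobian ideal `Jf`.
-/

noncomputable section

open Matrix MvPolynomial

namespace Octic2

/-- `R = ℚ[x,y,z,t]` -/
abbrev R : Type := MvPolynomial (Fin 4) ℚ

/-- The linear polynomial with coefficient vector `a`. -/
def lin (a : Fin 4 → ℚ) : R := ∑ j, C (a j) * X j

/-- Coefficient vectors of the eight planes `x, y, z, t, x+y, y+z, z+t, t+x`. -/
def c : Fin 8 → Fin 4 → ℚ :=
  ![![1,0,0,0], ![0,1,0,0], ![0,0,1,0], ![0,0,0,1],
    ![1,1,0,0], ![0,1,1,0], ![0,0,1,1], ![1,0,0,1]]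

/-- The octic `f = xyzt(x+y)(y+z)(z+t)(t+x)`. -/
def f : R := ∏ i, lin (c i)

/-- The Jacobian ideal of `f`. -/
def Jf : Ideal R :=
  Ideal.span {pderiv 0 f, pderiv 1 f, pderiv 2 f, pderiv 3 f}

/-- `m(P)`: the number of the eight planes through the point `v`. -/
def m (v : Fin 4 → ℚ) : ℕ := {i : Fin 8 | c i ⬝ᵥ v = 0}.ncard

/-- `m(ℓᵢ,ℓⱼ)`: the number of the eight factors lying in the pencil spanned by
`ℓᵢ` and `ℓⱼ` (the multiplicity of `f` along the line `ℓᵢ = ℓⱼ = 0`). -/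
def mLine (i j : Fin 8) : ℕ :=
  {k : Fin 8 | c k ∈ Submodule.span ℚ ({c i, c j} : Set (Fin 4 → ℚ))}.ncard

/-- `I_P`: the ideal of the point `v`, generated by all linear forms
vanishing at `v`. -/
def IP (v : Fin 4 → ℚ) : Ideal R :=
  Ideal.span (lin '' {a : Fin 4 → ℚ | a ⬝ᵥ v = 0})

/-- The equisingular ideal
`I_eq = ⋂ ((ℓ,ℓ′)^{m(ℓ,ℓ′)} + Jf) ∩ ⋂ (I_P^{m(P)} + Jf)`, the first
intersection over all pairs of linearly independent factors, the second over
all points of `ℙ³(ℚ)` lying on at least three of the eight planes. -/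
def Ieq : Ideal R :=
  (⨅ (i : Fin 8) (j : Fin 8) (_ : LinearIndependent ℚ ![c i, c j]),
      (Ideal.span {lin (c i), lin (c j)} ^ mLine i j + Jf)) ⊓
  (⨅ (v : Fin 4 → ℚ) (_ : v ≠ 0) (_ : 3 ≤ m v), (IP v ^ m v + Jf))

theorem f_eq (j : Fin 4) : f = X j * X (j + 1) * (X j + X (j + 1)) *
    (X (j + 2) * X (j + 3) * (X (j + 1) + X (j + 2)) * (X (j + 2) + X (j + 3)) *
      (X (j + 3) + X j)) := by
  have h : f = X 0 * X 1 * X 2 * X 3 * (X 0 + X 1) * (X 1 + X 2) * (X 2 + X 3) * (X 0 + X 3) := by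
    simp [f, Fin.prod_univ_eight, lin, c, Fin.sum_univ_four]
  fin_cases j <;> simp [h] <;> ring

theorem lin_c_castAdd (j : Fin 4) : lin (c (j.castAdd 4)) = X j := by
  fin_cases j <;> simp [lin, c, Fin.sum_univ_four]

theorem lin_c_natAdd (j : Fin 4) : lin (c (j.natAdd 4)) = X j + X (j + 1) := by
  fin_cases j <;> simp [lin, c, Fin.sum_univ_four, add_comm]

theorem exists_minor_ne : ∀ i j : Fin 8, i ≠ j → ∃ k l, c i k * c j l ≠ c i l * c j k := by
  decide +kernel

theorem linearIndependent_pair {i j : Fin 8} (h : i ≠ j) : LinearIndependent ℚ ![c i, c j] := by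
  obtain ⟨k, l, hkl⟩ := exists_minor_ne i j h
  rw [LinearIndependent.pair_iff]
  intro s t hst
  have hk := congrFun hst k
  have hl := congrFun hst l
  simp only [Pi.add_apply, Pi.smul_apply, smul_eq_mul, Pi.zero_apply] at hk hl
  have h' := sub_ne_zero.mpr hkl
  constructor
  · refine (mul_eq_zero.mp ?_).resolve_right h'
    linear_combination c j l * hk - c j k * hl
  · refine (mul_eq_zero.mp ?_).resolve_right h'
    linear_combination c i k * hl - c i l * hk

/-- A substitution that is the identity modulo an ideal. -/
theorem sub_aeval_mem {I : Ideal R} {s : Fin 4 → R} (h : ∀ i, X i - s i ∈ I) (u : R) :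
    u - aeval s u ∈ I := by
  rw [← Ideal.Quotient.eq]
  have : Ideal.Quotient.mkₐ ℚ I = (Ideal.Quotient.mkₐ ℚ I).comp (aeval s) := by
    ext i
    simpa [Ideal.Quotient.eq] using h i
  exact DFunLike.congr_fun this u

/-- `s` parametrizes the hyperplane `p = 0`. -/
structure Restricts (p : R) (s : Fin 4 → R) : Prop where
  ne_zero : p ≠ 0
  map : aeval s p = 0
  dvd_sub : ∀ i, p ∣ X i - s i

namespace Restricts

variable {p : R} {s : Fin 4 → R}

theorem dvd_iff (h : Restricts p s) {u : R} : p ∣ u ↔ aeval s u = 0 := by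
  constructor
  · rintro ⟨v, rfl⟩
    rw [map_mul, h.map, zero_mul]
  · intro hu
    have := sub_aeval_mem (I := Ideal.span {p})
      (fun i => Ideal.mem_span_singleton.mpr (h.dvd_sub i)) u
    rwa [hu, sub_zero, Ideal.mem_span_singleton] at this

theorem prime (h : Restricts p s) : Prime p := by
  refine ⟨h.ne_zero, fun hu => ?_, fun a b hab => ?_⟩
  · have := hu.map (aeval s : R →ₐ[ℚ] R)
    rw [h.map] at this
    exact not_isUnit_zero this
  · rw [h.dvd_iff] at hab ⊢
    rw [h.dvd_iff]
    simpa using hab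

theorem pow_dvd_of_mem (h : Restricts p s) {q g : R} {n : ℕ} (hg : g ∈ Ideal.span {p, q} ^ n) :
    aeval s q ^ n ∣ aeval s g := by
  have := Ideal.mem_map_of_mem (aeval s : R →ₐ[ℚ] R) hg
  rw [Ideal.map_pow, Ideal.map_span, Set.image_pair, h.map, Ideal.span_insert_zero,
    Ideal.span_singleton_pow, Ideal.mem_span_singleton] at this
  exact this

end Restricts

theorem restricts_X (j : Fin 4) : Restricts (X j) (Function.update X j 0) where
  ne_zero := X_ne_zero j
  map := by simp
  dvd_sub i := by
    by_cases h : i = j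
    · subst h; simp
    · simp [h]

theorem restricts_X_add {j k : Fin 4} (hjk : j ≠ k) :
    Restricts (X j + X k) (Function.update X j (-X k)) where
  ne_zero h := by
    have := congrArg (eval (Pi.single j 1)) h
    simp [hjk.symm] at this
  map := by simp [hjk.symm]
  dvd_sub i := by
    by_cases h : i = j
    · subst h; simp
    · simp [h]

theorem isHomogeneous_aeval_update {j : Fin 4} {p u : R} {n : ℕ} (hp : p.IsHomogeneous 1)
    (hu : u.IsHomogeneous n) : (aeval (Function.update X j p) u : R).IsHomogeneous n := by
  have := hu.aeval (S := ℚ) (Function.update X j p) (n := 1) fun i => ?_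
  · simpa using this
  · by_cases h : i = j
    · subst h; simpa using hp
    · simpa [h] using isHomogeneous_X ℚ i

theorem exists_isHomogeneous_of_dvd {F u : R} {a b : ℕ} (hF : F.IsHomogeneous a)
    (hu : u.IsHomogeneous (a + b)) (h : F ∣ u) : ∃ L : R, L.IsHomogeneous b ∧ u = F * L := by
  obtain ⟨L, rfl⟩ := h
  let _ : GradedAlgebra (homogeneousSubmodule (Fin 4) ℚ) := gradedAlgebra
  refine ⟨DirectSum.decompose (homogeneousSubmodule (Fin 4) ℚ) L b,
    (DirectSum.decompose (homogeneousSubmodule (Fin 4) ℚ) L b).2, ?_⟩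
  have := DirectSum.coe_decompose_mul_add_of_left_mem (homogeneousSubmodule (Fin 4) ℚ)
    (i := a) (j := b) (a := F) (b := L) hF
  have h2 := DirectSum.decompose_of_mem_same (homogeneousSubmodule (Fin 4) ℚ) hu
  rw [← h2]
  exact this

theorem pderiv_f_mem (k : Fin 4) : pderiv k f ∈ Jf := by
  apply Ideal.subset_span
  fin_cases k <;> simp

theorem Jf_le {I : Ideal R} (h : ∀ k, pderiv k f ∈ I) : Jf ≤ I := by
  rw [Jf, Ideal.span_le]
  rintro _ (rfl | rfl | rfl | rfl)
  exacts [h 0, h 1, h 2, h 3]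

theorem Jf_le_Ieq : Jf ≤ Ieq :=
  le_inf (le_iInf fun _ => le_iInf fun _ => le_iInf fun _ => le_sup_right)
    (le_iInf fun _ => le_iInf fun _ => le_iInf fun _ => le_sup_right)

theorem mem_line_of_mem {g : R} (hg : g ∈ Ieq) {i j : Fin 8} (hij : i ≠ j) {n : ℕ}
    (hn : n ≤ mLine i j) : g ∈ Ideal.span {lin (c i), lin (c j)} ^ n ⊔ Jf := by
  simp only [Ieq, Ideal.mem_inf, Ideal.mem_iInf] at hg
  have hle : Ideal.span {lin (c i), lin (c j)} ^ mLine i j ⊔ Jf ≤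
      Ideal.span {lin (c i), lin (c j)} ^ n ⊔ Jf :=
    sup_le_sup_right (Ideal.pow_le_pow_right hn) _
  exact hle (hg.1 i j (linearIndependent_pair hij))

theorem Jf_le_span_pair {i j : Fin 8} (hij : i ≠ j) : Jf ≤ Ideal.span {lin (c i), lin (c j)} := by
  refine Jf_le fun k => ?_
  rw [f, ← Finset.mul_prod_erase _ _ (Finset.mem_univ i),
    ← Finset.mul_prod_erase _ _ (Finset.mem_erase.mpr ⟨hij.symm, Finset.mem_univ j⟩)]
  set h := ∏ x ∈ (Finset.univ.erase i).erase j, lin (c x)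
  rw [Ideal.mem_span_pair]
  refine ⟨lin (c j) * pderiv k h + h * pderiv k (lin (c j)), h * pderiv k (lin (c i)), ?_⟩
  simp only [pderiv_mul]
  ring

theorem mem_span_pair_of_mem {g : R} (hg : g ∈ Ieq) {i j : Fin 8} (hij : i ≠ j) :
    g ∈ Ideal.span {lin (c i), lin (c j)} := by
  have h1 : 1 ≤ mLine i j := by
    exact (Set.ncard_pos (Set.toFinite _)).mpr ⟨i, Submodule.subset_span (by simp)⟩
  have := mem_line_of_mem hg hij h1
  rwa [pow_one, sup_eq_left.mpr (Jf_le_span_pair hij)] at this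

theorem three_le_mLine (j : Fin 4) : 3 ≤ mLine (j.castAdd 4) ((j + 1).castAdd 4) := by
  have hc : c (j.natAdd 4) = c (j.castAdd 4) + c ((j + 1).castAdd 4) := by
    fin_cases j <;> simp [c]
  have : (({j.castAdd 4, (j + 1).castAdd 4, j.natAdd 4} : Finset (Fin 8)) : Set (Fin 8)).ncard =
      3 := by
    rw [Set.ncard_coe_finset]
    clear hc
    revert j
    decide
  refine this.symm.trans_le (Set.ncard_le_ncard ?_ (Set.toFinite _))
  have h1 : c (j.castAdd 4) ∈ Submodule.span ℚ {c (j.castAdd 4), c ((j + 1).castAdd 4)} :=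
    Submodule.subset_span (by simp)
  have h2 : c ((j + 1).castAdd 4) ∈ Submodule.span ℚ {c (j.castAdd 4), c ((j + 1).castAdd 4)} :=
    Submodule.subset_span (by simp)
  intro k hk
  simp only [Finset.coe_insert, Finset.coe_singleton, Set.mem_insert_iff,
    Set.mem_singleton_iff] at hk
  rcases hk with rfl | rfl | rfl
  · exact h1
  · exact h2
  · simpa only [Set.mem_ofPred_eq, hc] using add_mem h1 h2

theorem mem_triple_of_mem {g : R} (hg : g ∈ Ieq) (j : Fin 4) :
    g ∈ Ideal.span {X j, X (j + 1)} ^ 3 ⊔ Jf := by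
  have := mem_line_of_mem hg (i := j.castAdd 4) (j := (j + 1).castAdd 4)
    (by revert j; decide) (three_le_mLine j)
  simpa only [lin_c_castAdd] using this

theorem exists_of_mem_span_pair_mul {p q x : R} {I : Ideal R} (h : x ∈ Ideal.span {p, q} * I) :
    ∃ u ∈ I, ∃ v ∈ I, x = p * u + q * v := by
  rw [Ideal.span_insert, Ideal.sup_mul, Submodule.mem_sup] at h
  obtain ⟨_, hy, _, hz, rfl⟩ := h
  obtain ⟨u, hu, rfl⟩ := Ideal.mem_span_singleton_mul.mp hy
  obtain ⟨v, hv, rfl⟩ := Ideal.mem_span_singleton_mul.mp hz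
  exact ⟨u, hu, v, hv, rfl⟩

theorem exists_of_mem_span_pair_pow_three {p q x : R} (h : x ∈ Ideal.span {p, q} ^ 3) :
    ∃ A B C D, x = A * p ^ 3 + B * p ^ 2 * q + C * p * q ^ 2 + D * q ^ 3 := by
  rw [pow_succ', pow_two] at h
  obtain ⟨u, hu, v, hv, rfl⟩ := exists_of_mem_span_pair_mul h
  obtain ⟨u₁, hu₁, u₂, hu₂, rfl⟩ := exists_of_mem_span_pair_mul hu
  obtain ⟨v₁, hv₁, v₂, hv₂, rfl⟩ := exists_of_mem_span_pair_mul hv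
  obtain ⟨a, a', rfl⟩ := Ideal.mem_span_pair.mp hu₁
  obtain ⟨b, b', rfl⟩ := Ideal.mem_span_pair.mp hu₂
  obtain ⟨d, d', rfl⟩ := Ideal.mem_span_pair.mp hv₁
  obtain ⟨e, e', rfl⟩ := Ideal.mem_span_pair.mp hv₂
  exact ⟨a, a' + b + d, b' + d' + e, e', by ring⟩

/-- The equisingularity condition along a triple line `p = q = p + q = 0`, for a polynomial
vanishing on two of the planes. -/
theorem mem_span_pair_of_mul_mem {p q h w : R} (hp : Prime p) (hq : Prime q) (hpq : ¬ p ∣ q)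
    (hqp : ¬ q ∣ p) (hh : ∀ u, u * h ∈ Ideal.span {p, q} → u ∈ Ideal.span {p, q})
    (hw : p * q * w ∈ Ideal.span {p, q} ^ 3 ⊔
      Ideal.span {(2 * p * q + q ^ 2) * h, (p ^ 2 + 2 * p * q) * h}) :
    w ∈ Ideal.span {p, q} := by
  obtain ⟨x, hx, y, hy, hxy⟩ := Submodule.mem_sup.mp hw
  obtain ⟨A, B, C, D, rfl⟩ := exists_of_mem_span_pair_pow_three hx
  obtain ⟨c, d, rfl⟩ := Ideal.mem_span_pair.mp hy
  have hDc : p ∣ D * q + c * h := by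
    refine (hp.dvd_or_dvd (a := q ^ 2) ?_).resolve_left fun h => hpq (hp.dvd_of_dvd_pow h)
    exact ⟨q * w - A * p ^ 2 - B * p * q - C * q ^ 2 - c * 2 * q * h - d * (p + 2 * q) * h,
      by linear_combination hxy⟩
  have hAd : q ∣ A * p + d * h := by
    refine (hq.dvd_or_dvd (a := p ^ 2) ?_).resolve_left fun h => hqp (hq.dvd_of_dvd_pow h)
    exact ⟨p * w - D * q ^ 2 - B * p ^ 2 - C * p * q - d * 2 * p * h - c * (q + 2 * p) * h,
      by linear_combination hxy⟩
  obtain ⟨c₁, c₂, rfl⟩ : ∃ c₁ c₂, c₁ * p + c₂ * q = c := by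
    obtain ⟨e, he⟩ := hDc
    exact Ideal.mem_span_pair.mp
      (hh c (Ideal.mem_span_pair.mpr ⟨e, -D, by linear_combination -he⟩))
  obtain ⟨d₁, d₂, rfl⟩ : ∃ d₁ d₂, d₁ * p + d₂ * q = d := by
    obtain ⟨e, he⟩ := hAd
    exact Ideal.mem_span_pair.mp
      (hh d (Ideal.mem_span_pair.mpr ⟨-A, e, by linear_combination -he⟩))
  obtain ⟨D', hD'⟩ : p ∣ D + c₂ * h := by
    refine (hp.dvd_or_dvd (a := q) ?_).resolve_left hpq
    obtain ⟨e, he⟩ := hDc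
    exact ⟨e - c₁ * h, by linear_combination he⟩
  obtain ⟨A', hA'⟩ : q ∣ A + d₁ * h := by
    refine (hq.dvd_or_dvd (a := p) ?_).resolve_left hqp
    obtain ⟨e, he⟩ := hAd
    exact ⟨e - d₂ * h, by linear_combination he⟩
  refine Ideal.mem_span_pair.mpr ⟨A' * p + B + h * (2 * c₁ + d₂ + 2 * d₁),
    D' * q + C + h * (c₁ + 2 * c₂ + 2 * d₂), ?_⟩
  refine mul_left_cancel₀ (mul_ne_zero hp.ne_zero hq.ne_zero) ?_
  linear_combination hxy - p ^ 3 * hA' - q ^ 3 * hD'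

theorem not_dvd_of_eval {p q : R} (v : Fin 4 → ℚ) (hp : eval v p = 0) (hq : eval v q ≠ 0) :
    ¬ p ∣ q := by
  rintro ⟨r, rfl⟩
  simp [hp] at hq

theorem Restricts.isRelPrime {p q : R} {s : Fin 4 → R} (h : Restricts p s) (v : Fin 4 → ℚ)
    (hp : eval v p = 0) (hq : eval v q ≠ 0) : IsRelPrime p q :=
  h.prime.irreducible.isRelPrime_iff_not_dvd.mpr (not_dvd_of_eval v hp hq)

theorem Restricts.aeval_aeval {p : R} {s : Fin 4 → R} (h : Restricts p s) (u : R) :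
    aeval s (aeval s u : R) = (aeval s u : R) := by
  have := sub_aeval_mem (I := Ideal.span {p})
    (fun i => Ideal.mem_span_singleton.mpr (h.dvd_sub i)) u
  rw [Ideal.mem_span_singleton, h.dvd_iff, map_sub, sub_eq_zero] at this
  exact this.symm

/-- The cofactor of the triple line `X j = X (j + 1) = 0` in `f`. -/
def cofactor (j : Fin 4) : R :=
  X (j + 2) * X (j + 3) * (X (j + 1) + X (j + 2)) * (X (j + 2) + X (j + 3)) * (X (j + 3) + X j)

theorem Jf_le_triple (j : Fin 4) : Jf ≤ Ideal.span {X j, X (j + 1)} ^ 3 ⊔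
    Ideal.span {(2 * X j * X (j + 1) + X (j + 1) ^ 2) * cofactor j,
      (X j ^ 2 + 2 * X j * X (j + 1)) * cofactor j} := by
  refine Jf_le fun k => ?_
  rw [Submodule.mem_sup]
  have h0 : X j ∈ (Ideal.span {X j, X (j + 1)} : Ideal R) := Ideal.subset_span (by simp)
  have h1 : X (j + 1) ∈ (Ideal.span {X j, X (j + 1)} : Ideal R) := Ideal.subset_span (by simp)
  refine ⟨X j * X (j + 1) * (X j + X (j + 1)) * pderiv k (cofactor j), ?_, _,
    Ideal.mem_span_pair.mpr ⟨pderiv k (X j), pderiv k (X (j + 1)), rfl⟩, ?_⟩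
  · rw [pow_succ, pow_two]
    exact Ideal.mul_mem_right _ _
      (Ideal.mul_mem_mul (Ideal.mul_mem_mul h0 h1) (Ideal.add_mem _ h0 h1))
  · have : f = X j * X (j + 1) * (X j + X (j + 1)) * cofactor j := f_eq j
    rw [this]
    simp only [pderiv_mul, map_add]
    ring

theorem mem_sq_of_mem {g : R} (hg : g ∈ Ieq) (j : Fin 4) :
    g ∈ (Ideal.span {X j, X (j + 1)} ^ 2 : Ideal R) := by
  have h0 : X j ∈ (Ideal.span {X j, X (j + 1)} : Ideal R) := Ideal.subset_span (by simp)
  have h1 : X (j + 1) ∈ (Ideal.span {X j, X (j + 1)} : Ideal R) := Ideal.subset_span (by simp)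
  have h3 : (Ideal.span {X j, X (j + 1)} ^ 3 : Ideal R) ≤ Ideal.span {X j, X (j + 1)} ^ 2 :=
    Ideal.pow_le_pow_right (by norm_num)
  refine sup_le h3 ((Jf_le_triple j).trans (sup_le h3 ?_)) (mem_triple_of_mem hg j)
  rw [Ideal.span_le]
  rintro _ (rfl | rfl) <;> refine Ideal.mul_mem_right _ _ (Ideal.add_mem _ ?_ ?_)
  · rw [mul_assoc, pow_two]; exact Ideal.mul_mem_left _ _ (Ideal.mul_mem_mul h0 h1)
  · exact Ideal.pow_mem_pow h1 2
  · exact Ideal.pow_mem_pow h0 2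
  · rw [mul_assoc, pow_two]; exact Ideal.mul_mem_left _ _ (Ideal.mul_mem_mul h0 h1)

theorem mem_span_X_pair_iff {j k : Fin 4} {u : R} : u ∈ Ideal.span {X j, X k} ↔
    aeval (Function.update (Function.update X j 0) k 0 : Fin 4 → R) u = 0 := by
  constructor
  · intro h
    obtain ⟨a, b, rfl⟩ := Ideal.mem_span_pair.mp h
    have hj : Function.update (Function.update X j 0 : Fin 4 → R) k 0 j = 0 := by
      by_cases hjk : j = k
      · subst hjk; simp
      · simp [hjk]
    rw [map_add, map_mul, map_mul, aeval_X, aeval_X, hj, Function.update_self]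
    ring
  · intro h
    have := sub_aeval_mem (I := Ideal.span {X j, X k})
      (s := Function.update (Function.update X j 0) k 0) (fun i => ?_) u
    · rwa [h, sub_zero] at this
    · by_cases hk : i = k
      · subst hk; simpa using Ideal.subset_span (by simp)
      · by_cases hj : i = j
        · subst hj; simpa [hk] using Ideal.subset_span (by simp)
        · simp [hk, hj]

theorem mem_span_X_pair_of_mul {j k : Fin 4} {u h : R} (v : Fin 4 → ℚ) (hj : v j = 0)
    (hk : v k = 0) (hv : eval v h ≠ 0) (hu : u * h ∈ Ideal.span {X j, X k}) :
    u ∈ Ideal.span {X j, X k} := by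
  rw [mem_span_X_pair_iff, map_mul] at hu
  refine mem_span_X_pair_iff.mpr ((mul_eq_zero.mp hu).resolve_right fun h0 => hv ?_)
  obtain ⟨a, b, rfl⟩ := Ideal.mem_span_pair.mp (mem_span_X_pair_iff.mpr h0)
  simp [hj, hk]

theorem add_one_ne (j : Fin 4) : j ≠ j + 1 := by revert j; decide
theorem add_two_ne (j : Fin 4) : j ≠ j + 2 := by revert j; decide
theorem add_three_ne (j : Fin 4) : j ≠ j + 3 := by revert j; decide

theorem mem_span_of_mul_mem_Ieq {w : R} (j : Fin 4) (hw : X j * X (j + 1) * w ∈ Ieq) :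
    w ∈ Ideal.span {X j, X (j + 1)} := by
  refine mem_span_pair_of_mul_mem (restricts_X j).prime (restricts_X (j + 1)).prime
    (by simp [X_dvd_X]) (by simp [X_dvd_X]) (h := cofactor j)
    (fun u => mem_span_X_pair_of_mul (fun i => ![0, 0, 1, 1] (i - j)) ?_ ?_ ?_)
    (sup_le le_sup_left (Jf_le_triple j) (mem_triple_of_mem hw j))
  · simp
  · simp
  · simp [cofactor]
theorem Restricts.dvd_of_mem {p q g : R} {s : Fin 4 → R} (h : Restricts p s)
    (hg : g ∈ Ideal.span {p, q}) : (aeval s q : R) ∣ aeval s g := by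
  simpa only [pow_one] using h.pow_dvd_of_mem (n := 1) (by simpa only [pow_one] using hg)

theorem mem_coord_coord {g : R} (hg : g ∈ Ieq) (j : Fin 4) :
    g ∈ Ideal.span {X j, X (j + 2)} := by
  simpa only [lin_c_castAdd] using mem_span_pair_of_mem hg (i := j.castAdd 4)
    (j := (j + 2).castAdd 4) (by revert j; decide)

theorem mem_coord_sum {g : R} (hg : g ∈ Ieq) (j k : Fin 4) :
    g ∈ Ideal.span {X j, X k + X (k + 1)} := by
  simpa only [lin_c_castAdd, lin_c_natAdd] using mem_span_pair_of_mem hg (i := j.castAdd 4)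
    (j := k.natAdd 4) (by revert j k; decide)

theorem mem_sum_sum {g : R} (hg : g ∈ Ieq) {j k : Fin 4} (hjk : j ≠ k) :
    g ∈ Ideal.span {X j + X (j + 1), X k + X (k + 1)} := by
  simpa only [lin_c_natAdd] using mem_span_pair_of_mem hg (i := j.natAdd 4)
    (j := k.natAdd 4) (by revert j k; decide)

theorem dvd_of_dvd_coprime_factors {u : R} (j : Fin 4) (h1 : X (j + 1) ^ 2 ∣ u)
    (h3 : X (j + 3) ^ 2 ∣ u) (h2 : X (j + 2) ∣ u) (h12 : X (j + 1) + X (j + 2) ∣ u)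
    (h23 : X (j + 2) + X (j + 3) ∣ u) :
    X (j + 1) ^ 2 * (X (j + 3) ^ 2 * (X (j + 2) *
      ((X (j + 1) + X (j + 2)) * (X (j + 2) + X (j + 3))))) ∣ u := by
  have n12 : j + 1 ≠ j + 2 := by simp
  have n23 : j + 2 ≠ j + 3 := by simp
  have r (k : Fin 4) := restricts_X k
  have r12 := restricts_X_add n12
  have r23 := restricts_X_add n23
  have ev (w : Fin 4 → ℚ) (k : Fin 4) : (fun i => w (i - j)) (j + k) = w k := by simp
  refine IsRelPrime.mul_dvd (IsRelPrime.pow_left (.mul_right (.pow_right ?_) (.mul_right ?_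
    (.mul_right ?_ ?_)))) h1 (IsRelPrime.mul_dvd (IsRelPrime.pow_left (.mul_right ?_
    (.mul_right ?_ ?_))) h3 (IsRelPrime.mul_dvd (.mul_right ?_ ?_) h2
    (IsRelPrime.mul_dvd ?_ h12 h23)))
  · refine (r _).isRelPrime (fun i => ![0, 0, 0, 1] (i - j)) ?_ ?_ <;> simp
  · refine (r _).isRelPrime (fun i => ![0, 0, 1, 0] (i - j)) ?_ ?_ <;> simp
  · refine (r _).isRelPrime (fun i => ![0, 0, 1, 0] (i - j)) ?_ ?_ <;> simp
  · refine (r _).isRelPrime (fun i => ![0, 0, 1, 0] (i - j)) ?_ ?_ <;> simp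
  · refine (r _).isRelPrime (fun i => ![0, 0, 1, 0] (i - j)) ?_ ?_ <;> simp
  · refine (r _).isRelPrime (fun i => ![0, 0, 1, 0] (i - j)) ?_ ?_ <;> simp
  · refine (r _).isRelPrime (fun i => ![0, 0, 1, 0] (i - j)) ?_ ?_ <;> simp
  · refine (r _).isRelPrime (fun i => ![0, 1, 0, 0] (i - j)) ?_ ?_ <;> simp
  · refine (r _).isRelPrime (fun i => ![0, 0, 0, 1] (i - j)) ?_ ?_ <;> simp
  · refine r12.isRelPrime (fun i => ![0, 0, 0, 1] (i - j)) ?_ ?_ <;> simp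

theorem add_one_add_one (j : Fin 4) : j + 1 + 1 = j + 2 := by revert j; decide
theorem add_two_add_one (j : Fin 4) : j + 2 + 1 = j + 3 := by revert j; decide
theorem add_three_add_one (j : Fin 4) : j + 3 + 1 = j := by revert j; decide

theorem exists_dvd_sub_mul_pderiv {g : R} (hg : g ∈ Ieq) (h8 : g.IsHomogeneous 8) (j : Fin 4) :
    ∃ L : R, L.IsHomogeneous 1 ∧ X j ∣ g - L * pderiv j f := by
  have r := restricts_X j
  have n1 := (add_one_ne j).symm
  have n2 := (add_two_ne j).symm
  have n3 := (add_three_ne j).symm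
  set φ : R →ₐ[ℚ] R := aeval (Function.update X j 0) with hφ
  have φ0 : φ (X j) = 0 := r.map
  have φX {k : Fin 4} (hk : k ≠ j) : φ (X k) = X k := by
    rw [hφ, aeval_X, Function.update_of_ne hk]
  have h1 : X (j + 1) ^ 2 ∣ φ g := by
    simpa only [← hφ, φX n1] using r.pow_dvd_of_mem (mem_sq_of_mem hg j)
  have h3 : X (j + 3) ^ 2 ∣ φ g := by
    have := mem_sq_of_mem hg (j + 3)
    rw [add_three_add_one, Set.pair_comm] at this
    simpa only [← hφ, φX n3] using r.pow_dvd_of_mem this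
  have h2 : X (j + 2) ∣ φ g := by
    simpa only [← hφ, φX n2] using r.dvd_of_mem (mem_coord_coord hg j)
  have h12 : X (j + 1) + X (j + 2) ∣ φ g := by
    have := r.dvd_of_mem (mem_coord_sum hg j (j + 1))
    rw [add_one_add_one] at this
    simpa only [← hφ, map_add, φX n1, φX n2] using this
  have h23 : X (j + 2) + X (j + 3) ∣ φ g := by
    have := r.dvd_of_mem (mem_coord_sum hg j (j + 2))
    rw [add_two_add_one] at this
    simpa only [← hφ, map_add, φX n2, φX n3] using this
  obtain ⟨L, hL, hgL⟩ := exists_isHomogeneous_of_dvd (a := 7) (b := 1)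
    (((isHomogeneous_X ℚ _).pow 2).mul (((isHomogeneous_X ℚ _).pow 2).mul
      ((isHomogeneous_X ℚ _).mul (((isHomogeneous_X ℚ _).add (isHomogeneous_X ℚ _)).mul
        ((isHomogeneous_X ℚ _).add (isHomogeneous_X ℚ _))))))
    (isHomogeneous_aeval_update (isHomogeneous_zero _ _ 1) h8)
    (dvd_of_dvd_coprime_factors j h1 h3 h2 h12 h23)
  refine ⟨φ L, isHomogeneous_aeval_update (isHomogeneous_zero _ _ 1) hL, r.dvd_iff.mpr ?_⟩
  have hf : φ (pderiv j f) = X (j + 1) ^ 2 * (X (j + 3) ^ 2 * (X (j + 2) *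
      ((X (j + 1) + X (j + 2)) * (X (j + 2) + X (j + 3))))) := by
    rw [f_eq j, mul_assoc, mul_assoc (X j)]
    simp only [pderiv_mul, pderiv_X_self, map_add, map_mul, φ0, φX n1, φX n2, φX n3, map_one]
    ring
  have hgg : φ (φ g) = φ g := r.aeval_aeval g
  have hff : φ (φ (pderiv j f)) = φ (pderiv j f) := r.aeval_aeval _
  have hLL : φ (φ L) = φ L := r.aeval_aeval L
  change φ g = _ at hgL
  change φ _ = 0
  rw [← hf] at hgL
  rw [map_sub, map_mul, hLL, ← hgg, hgL, map_mul, hff]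
  ring

theorem X_dvd_pderiv {j k : Fin 4} (h : j ≠ k) : X j ∣ pderiv k f := by
  rw [f_eq j, mul_assoc, mul_assoc (X j), pderiv_mul, pderiv_X_of_ne h, zero_mul, zero_add]
  exact dvd_mul_right _ _

theorem Restricts.aeval_pderiv_mul {p F : R} {s : Fin 4 → R} (h : Restricts p s) (k : Fin 4) :
    aeval s (pderiv k (p * F)) = (aeval s (pderiv k p) * aeval s F : R) := by
  rw [pderiv_mul, map_add, map_mul, map_mul, h.map, zero_mul, add_zero]

/-- The product of the seven planes other than `X j + X (j + 1)`. -/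
def others (j : Fin 4) : R := X j * X (j + 1) * cofactor j

theorem f_eq_mul_others (j : Fin 4) : f = (X j + X (j + 1)) * others j := by
  rw [f_eq j, others, cofactor]
  ring

theorem exists_aeval_eq {g : R} (hg : g ∈ Ieq) (h8 : g.IsHomogeneous 8) (hX : ∀ j, X j ∣ g)
    (j : Fin 4) : ∃ α : ℚ, aeval (Function.update X j (-X (j + 1))) g =
      C α * X (j + 1) * (aeval (Function.update X j (-X (j + 1))) (others j) : R) := by
  have r := restricts_X_add (add_one_ne j)
  have n1 := (add_one_ne j).symm
  have n2 := (add_two_ne j).symm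
  have n3 := (add_three_ne j).symm
  set φ : R →ₐ[ℚ] R := aeval (Function.update X j (-X (j + 1))) with hφ
  have φ0 : φ (X j) = -X (j + 1) := by rw [hφ, aeval_X, Function.update_self]
  have φX {k : Fin 4} (hk : k ≠ j) : φ (X k) = X k := by
    rw [hφ, aeval_X, Function.update_of_ne hk]
  have h1 : X (j + 1) ^ 3 ∣ φ g := by
    have h01 : IsRelPrime (X j : R) (X (j + 1)) := (restricts_X j).isRelPrime
      (fun i => ![0, 1, 0, 0] (i - j)) (by simp) (by simp)
    obtain ⟨w, rfl⟩ := h01.mul_dvd (hX j) (hX (j + 1))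
    obtain ⟨a, b, rfl⟩ := Ideal.mem_span_pair.mp (mem_span_of_mul_mem_Ieq j hg)
    refine ⟨φ a - φ b, ?_⟩
    simp only [map_add, map_mul, φ0, φX n1]
    ring
  have h2 : X (j + 2) ∣ φ g := by
    simpa only [φX n2] using map_dvd φ (hX (j + 2))
  have h3 : X (j + 3) ∣ φ g := by
    simpa only [φX n3] using map_dvd φ (hX (j + 3))
  have h12 : X (j + 1) + X (j + 2) ∣ φ g := by
    have := r.dvd_of_mem (mem_sum_sum hg n1.symm)
    rw [add_one_add_one] at this
    simpa only [← hφ, map_add, φX n1, φX n2] using this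
  have h23 : X (j + 2) + X (j + 3) ∣ φ g := by
    have := r.dvd_of_mem (mem_sum_sum hg n2.symm)
    rw [add_two_add_one] at this
    simpa only [← hφ, map_add, φX n2, φX n3] using this
  have h30 : X (j + 3) - X (j + 1) ∣ φ g := by
    have := r.dvd_of_mem (mem_sum_sum hg n3.symm)
    rw [add_three_add_one] at this
    simpa only [← hφ, map_add, φX n3, φ0, ← sub_eq_add_neg] using this
  have hD : X (j + 1) ^ 3 * (X (j + 2) * (X (j + 3) * ((X (j + 1) + X (j + 2)) *
      ((X (j + 2) + X (j + 3)) * (X (j + 3) - X (j + 1)))))) ∣ φ g := by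
    have r (k : Fin 4) := restricts_X k
    have r12 := restricts_X_add (j := j + 1) (k := j + 2) (by simp)
    have r23 := restricts_X_add (j := j + 2) (k := j + 3) (by simp)
    refine IsRelPrime.mul_dvd (IsRelPrime.pow_left (.mul_right ?_ (.mul_right ?_
      (.mul_right ?_ (.mul_right ?_ ?_))))) h1 (IsRelPrime.mul_dvd (.mul_right ?_ (.mul_right ?_
      (.mul_right ?_ ?_))) h2 (IsRelPrime.mul_dvd (.mul_right ?_ (.mul_right ?_ ?_)) h3
      (IsRelPrime.mul_dvd (.mul_right ?_ ?_) h12 (IsRelPrime.mul_dvd ?_ h23 h30))))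
    · refine (r _).isRelPrime (fun i => ![0, 0, 1, 2] (i - j)) ?_ ?_ <;> simp
    · refine (r _).isRelPrime (fun i => ![0, 0, 1, 2] (i - j)) ?_ ?_ <;> simp
    · refine (r _).isRelPrime (fun i => ![0, 0, 1, 2] (i - j)) ?_ ?_ <;> simp
    · refine (r _).isRelPrime (fun i => ![0, 0, 1, 0] (i - j)) ?_ ?_ <;> simp
    · refine (r _).isRelPrime (fun i => ![0, 0, 1, 2] (i - j)) ?_ ?_ <;> simp
    · refine (r _).isRelPrime (fun i => ![0, 1, 0, 2] (i - j)) ?_ ?_ <;> simp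
    · refine (r _).isRelPrime (fun i => ![0, 1, 0, 2] (i - j)) ?_ ?_ <;> simp
    · refine (r _).isRelPrime (fun i => ![0, 1, 0, 2] (i - j)) ?_ ?_ <;> simp
    · refine (r _).isRelPrime (fun i => ![0, 1, 0, 0] (i - j)) ?_ ?_ <;> simp
    · refine (r _).isRelPrime (fun i => ![0, 1, 0, 0] (i - j)) ?_ ?_ <;> simp
    · refine (r _).isRelPrime (fun i => ![0, 0, 1, 0] (i - j)) ?_ ?_ <;> simp
    · refine (r _).isRelPrime (fun i => ![0, 1, 0, 0] (i - j)) ?_ ?_ <;> simp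
    · refine r12.isRelPrime (fun i => ![0, 1, -1, 0] (i - j)) ?_ ?_ <;> simp
    · refine r12.isRelPrime (fun i => ![0, 1, -1, 0] (i - j)) ?_ ?_ <;> simp
    · refine r23.isRelPrime (fun i => ![0, 0, 1, -1] (i - j)) ?_ ?_ <;> simp
  obtain ⟨L, hL, hgL⟩ := exists_isHomogeneous_of_dvd (a := 8) (b := 0)
    (((isHomogeneous_X ℚ _).pow 3).mul ((isHomogeneous_X ℚ _).mul ((isHomogeneous_X ℚ _).mul
      (((isHomogeneous_X ℚ _).add (isHomogeneous_X ℚ _)).mul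
        (((isHomogeneous_X ℚ _).add (isHomogeneous_X ℚ _)).mul
          ((isHomogeneous_X ℚ _).sub (isHomogeneous_X ℚ _)))))))
    (isHomogeneous_aeval_update (isHomogeneous_X ℚ _).neg h8) hD
  rw [← totalDegree_zero_iff_isHomogeneous, totalDegree_eq_zero_iff_eq_C] at hL
  refine ⟨-coeff 0 L, ?_⟩
  change φ g = _ at hgL
  rw [hgL, hL, others, cofactor]
  simp only [map_add, map_mul, φ0, φX n1, φX n2, φX n3, coeff_C, if_pos, map_neg]
  ring

theorem aeval_X_mul_pderiv {j k : Fin 4} (hj : j ≠ k) (hj1 : j + 1 ≠ k) :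
    aeval (Function.update X j (-X (j + 1))) (X k * pderiv k f) = (0 : R) := by
  rw [f_eq_mul_others j, map_mul, (restricts_X_add (add_one_ne j)).aeval_pderiv_mul, map_add,
    pderiv_X_of_ne hj, pderiv_X_of_ne hj1]
  simp

theorem aeval_X_mul_pderiv_self (j : Fin 4) :
    aeval (Function.update X j (-X (j + 1))) (X j * pderiv j f) =
      (-X (j + 1) * aeval (Function.update X j (-X (j + 1))) (others j) : R) := by
  rw [f_eq_mul_others j, map_mul, (restricts_X_add (add_one_ne j)).aeval_pderiv_mul, map_add,
    pderiv_X_self, pderiv_X_of_ne (add_one_ne j).symm, aeval_X, Function.update_self, add_zero,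
    map_one, one_mul]

theorem aeval_X_mul_pderiv_succ (j : Fin 4) :
    aeval (Function.update X j (-X (j + 1))) (X (j + 1) * pderiv (j + 1) f) =
      (X (j + 1) * aeval (Function.update X j (-X (j + 1))) (others j) : R) := by
  rw [f_eq_mul_others j, map_mul, (restricts_X_add (add_one_ne j)).aeval_pderiv_mul, map_add,
    pderiv_X_self, pderiv_X_of_ne (add_one_ne j), aeval_X,
    Function.update_of_ne (add_one_ne j).symm, zero_add, map_one, one_mul]

theorem isHomogeneous_f : f.IsHomogeneous 8 := by
  have hX (i : Fin 4) := isHomogeneous_X ℚ i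
  rw [f_eq 0]
  exact (((hX _).mul (hX _)).mul ((hX _).add (hX _))).mul (((((hX _).mul (hX _)).mul
    ((hX _).add (hX _))).mul ((hX _).add (hX _))).mul ((hX _).add (hX _)))

theorem isHomogeneous_pderiv_f (k : Fin 4) : (pderiv k f).IsHomogeneous 7 :=
  isHomogeneous_f.pderiv

theorem f_mem_Jf : f ∈ Jf := by
  have h := isHomogeneous_f.sum_X_mul_pderiv
  have : f = C (1 / 8) * ∑ i, X i * pderiv i f := by
    rw [h, nsmul_eq_mul, ← mul_assoc, ← map_natCast (C : ℚ →+* R), ← C_mul]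
    norm_num
  rw [this]
  exact Ideal.mul_mem_left _ _ (Ideal.sum_mem _ fun i _ => Ideal.mul_mem_left _ _ (pderiv_f_mem i))

/-- The fourfold point of the arrangement off the coordinate planes. -/
def fourfoldPoint : Fin 4 → ℚ := ![1, -1, 1, -1]

theorem four_le_m_fourfoldPoint : 4 ≤ m fourfoldPoint := by
  have : (({4, 5, 6, 7} : Finset (Fin 8)) : Set (Fin 8)).ncard = 4 := by
    rw [Set.ncard_coe_finset]
    rfl
  refine this.symm.trans_le (Set.ncard_le_ncard ?_ (Set.toFinite _))
  intro k hk
  simp only [Finset.coe_insert, Finset.coe_singleton, Set.mem_insert_iff,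
    Set.mem_singleton_iff] at hk
  rcases hk with rfl | rfl | rfl | rfl <;>
    simp [c, fourfoldPoint, dotProduct, Fin.sum_univ_four]

theorem mem_fourfold_of_mem {g : R} (hg : g ∈ Ieq) : g ∈ IP fourfoldPoint ^ 4 ⊔ Jf := by
  simp only [Ieq, Ideal.mem_inf, Ideal.mem_iInf] at hg
  have hle : IP fourfoldPoint ^ m fourfoldPoint ⊔ Jf ≤ IP fourfoldPoint ^ 4 ⊔ Jf :=
    sup_le_sup_right (Ideal.pow_le_pow_right four_le_m_fourfoldPoint) _
  refine hle (hg.2 fourfoldPoint (fun h => ?_) (by linarith [four_le_m_fourfoldPoint]))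
  have := congrFun h 0
  simp [fourfoldPoint] at this

theorem X_add_mem_IP (j : Fin 4) : (X j + X (j + 1) : R) ∈ IP fourfoldPoint := by
  refine Ideal.subset_span ⟨c (j.natAdd 4), ?_, lin_c_natAdd j⟩
  fin_cases j <;> simp [c, fourfoldPoint, dotProduct, Fin.sum_univ_four]

theorem Jf_le_fourfold : Jf ≤ IP fourfoldPoint ^ 4 ⊔ Ideal.span
    {(2 * (X 0 + X 1) * (X 1 + X 2) * (X 2 + X 3) - (X 1 + X 2) ^ 2 * (X 2 + X 3)
        + (X 1 + X 2) * (X 2 + X 3) ^ 2) * (X 0 * X 1 * X 2 * X 3),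
      ((X 0 + X 1) ^ 2 * (X 2 + X 3) - 2 * (X 0 + X 1) * (X 1 + X 2) * (X 2 + X 3)
        + (X 0 + X 1) * (X 2 + X 3) ^ 2) * (X 0 * X 1 * X 2 * X 3),
      ((X 0 + X 1) ^ 2 * (X 1 + X 2) - (X 0 + X 1) * (X 1 + X 2) ^ 2
        + 2 * (X 0 + X 1) * (X 1 + X 2) * (X 2 + X 3)) * (X 0 * X 1 * X 2 * X 3)} := by
  refine Jf_le fun k => ?_
  rw [Submodule.mem_sup]
  refine ⟨(X 0 + X 1) * (X 1 + X 2) * (X 2 + X 3) * (X 3 + X 0) *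
    pderiv k (X 0 * X 1 * X 2 * X 3), ?_, _, Ideal.mem_span_insert.mpr
      ⟨pderiv k (X 0 + X 1), _, Ideal.mem_span_pair.mpr
        ⟨pderiv k (X 1 + X 2), pderiv k (X 2 + X 3), rfl⟩, rfl⟩, ?_⟩
  · have h (j : Fin 4) := X_add_mem_IP j
    have h4 := Ideal.mul_mem_mul (Ideal.mul_mem_mul (Ideal.mul_mem_mul (h 0) (h 1)) (h 2)) (h 3)
    rw [← pow_two, ← pow_succ, ← pow_succ] at h4
    exact Ideal.mul_mem_right _ _ h4
  · rw [f_eq 0]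
    simp only [pderiv_mul, map_add, Fin.isValue, zero_add]
    ring

/-- Restriction of a polynomial to the line through `fourfoldPoint` on which the linear forms
`X 0 + X 1`, `X 1 + X 2`, `X 2 + X 3` are `a`, `b`, `d` times the parameter. -/
def toLine (a b d : ℚ) : R →ₐ[ℚ] Polynomial ℚ :=
  aeval fun i => Polynomial.C (fourfoldPoint i) +
    Polynomial.C ((![a, 0, b, d - b] : Fin 4 → ℚ) i) * Polynomial.X

theorem toLine_X (a b d : ℚ) (i : Fin 4) : toLine a b d (X i) = Polynomial.C (fourfoldPoint i) +
    Polynomial.C ((![a, 0, b, d - b] : Fin 4 → ℚ) i) * Polynomial.X := by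
  rw [toLine, aeval_X]

theorem X_pow_four_dvd_toLine {a b d : ℚ} {g : R} (hg : g ∈ IP fourfoldPoint ^ 4) :
    Polynomial.X ^ 4 ∣ toLine a b d g := by
  have hle : IP fourfoldPoint ≤
      (Ideal.span {(Polynomial.X : Polynomial ℚ)}).comap (toLine a b d) := by
    rw [IP, Ideal.span_le]
    rintro _ ⟨l, hl, rfl⟩
    simp only [SetLike.mem_coe, Ideal.mem_comap, Ideal.mem_span_singleton, Polynomial.X_dvd_iff,
      Polynomial.coeff_zero_eq_eval_zero]
    have hl' : l ⬝ᵥ fourfoldPoint = 0 := hl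
    rw [lin, map_sum, Polynomial.eval_finsetSum]
    refine Eq.trans (Finset.sum_congr rfl fun i _ => ?_) hl'
    rw [map_mul, toLine_X, ← algebraMap_eq, AlgHom.commutes]
    simp
  have := (Ideal.pow_right_mono hle 4).trans (Ideal.le_comap_pow _ 4) hg
  rwa [Ideal.mem_comap, Ideal.span_singleton_pow, Ideal.mem_span_singleton] at this

theorem eq_zero_of_mem_Ieq {β : ℚ} (h : C β * X 0 * (X 0 * X 1 * X 2 * X 3) *
    ((X 0 + X 1) * (X 1 + X 2) * (X 2 + X 3)) ∈ Ieq) : β = 0 := by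
  obtain ⟨y, hy, z, hz, hyz⟩ := Submodule.mem_sup.mp
    (sup_le le_sup_left Jf_le_fourfold (mem_fourfold_of_mem h))
  obtain ⟨u, z', hz', rfl⟩ := Ideal.mem_span_insert.mp hz
  obtain ⟨v, w, rfl⟩ := Ideal.mem_span_pair.mp hz'
  have key (a b d : ℚ) : β * (a * b * d) =
      eval fourfoldPoint u * (2 * a * b * d - b ^ 2 * d + b * d ^ 2) +
      eval fourfoldPoint v * (a ^ 2 * d - 2 * a * b * d + a * d ^ 2) +
      eval fourfoldPoint w * (a ^ 2 * b - a * b ^ 2 + 2 * a * b * d) := by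
    obtain ⟨q, hq⟩ := X_pow_four_dvd_toLine (a := a) (b := b) (d := d) hy
    have e (p : R) : (toLine a b d p).eval 0 = eval fourfoldPoint p := by
      have : ((Polynomial.aeval (0 : ℚ)).comp (toLine a b d)) = aeval fourfoldPoint := by
        ext i
        simp [toLine_X]
      have := DFunLike.congr_fun this p
      simpa [Polynomial.coe_aeval_eq_eval, coe_aeval_eq_eval] using this
    have h01 : toLine a b d (X 0 + X 1) = Polynomial.C a * Polynomial.X := by
      rw [map_add, toLine_X, toLine_X]; simp [fourfoldPoint]
    have h12 : toLine a b d (X 1 + X 2) = Polynomial.C b * Polynomial.X := by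
      rw [map_add, toLine_X, toLine_X]; simp [fourfoldPoint]
    have h23 : toLine a b d (X 2 + X 3) = Polynomial.C d * Polynomial.X := by
      rw [map_add, toLine_X, toLine_X]; simp [fourfoldPoint]; ring
    have hC : toLine a b d (C β) = Polynomial.C β := (toLine a b d).commutes β
    have h2 : toLine a b d 2 = 2 := map_ofNat _ 2
    have h3 := congrArg (toLine a b d) hyz
    rw [map_add, hq] at h3
    simp only [map_add (toLine a b d) (_ * _), map_add (toLine a b d) (_ - _), map_sub, map_mul,
      map_pow, h01, h12, h23, hC, h2] at h3
    set U := toLine a b d (X 0) * toLine a b d (X 1) * toLine a b d (X 2) * toLine a b d (X 3)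
      with hU
    have h4 : Polynomial.C β * toLine a b d (X 0) * U *
          (Polynomial.C a * Polynomial.C b * Polynomial.C d) =
        Polynomial.X * q +
        (toLine a b d u * (2 * Polynomial.C a * Polynomial.C b * Polynomial.C d
            - Polynomial.C b ^ 2 * Polynomial.C d + Polynomial.C b * Polynomial.C d ^ 2) +
          toLine a b d v * (Polynomial.C a ^ 2 * Polynomial.C d
            - 2 * Polynomial.C a * Polynomial.C b * Polynomial.C d
            + Polynomial.C a * Polynomial.C d ^ 2) +
          toLine a b d w * (Polynomial.C a ^ 2 * Polynomial.C b
            - Polynomial.C a * Polynomial.C b ^ 2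
            + 2 * Polynomial.C a * Polynomial.C b * Polynomial.C d)) * U := by
      refine mul_left_cancel₀ (pow_ne_zero 3 Polynomial.X_ne_zero) ?_
      linear_combination -h3
    have h5 := congrArg (Polynomial.eval 0) h4
    simp only [hU, Polynomial.eval_add, Polynomial.eval_sub, Polynomial.eval_mul,
      Polynomial.eval_pow, Polynomial.eval_C, Polynomial.eval_X, Polynomial.eval_ofNat, e,
      eval_X, fourfoldPoint] at h5 ⊢
    simp at h5
    linear_combination h5
  have k1 := key 0 1 (-1)
  have k2 := key 1 0 1
  have k3 := key 1 (-1) 0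
  have k4 := key 1 1 1
  linarith

/-- A degree-8 element of the equisingular ideal that vanishes on all planes but the last one
lies in the Jacobian ideal. -/
theorem mem_Jf_of_dvd {g : R} (hg : g ∈ Ieq) (h8 : g.IsHomogeneous 8) (hX : ∀ j, X j ∣ g)
    (h01 : X 0 + X 1 ∣ g) (h12 : X 1 + X 2 ∣ g) (h23 : X 2 + X 3 ∣ g) : g ∈ Jf := by
  have hP : X 0 * (X 1 * (X 2 * (X 3 * ((X 0 + X 1) * ((X 1 + X 2) * (X 2 + X 3)))))) ∣ g := by
    have r (k : Fin 4) := restricts_X k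
    have r01 := restricts_X_add (j := 0) (k := 1) (by simp)
    have r12 := restricts_X_add (j := 1) (k := 2) (by simp)
    refine IsRelPrime.mul_dvd (.mul_right ?_ (.mul_right ?_ (.mul_right ?_ (.mul_right ?_
      (.mul_right ?_ ?_))))) (hX 0) (IsRelPrime.mul_dvd (.mul_right ?_ (.mul_right ?_
      (.mul_right ?_ (.mul_right ?_ ?_)))) (hX 1) (IsRelPrime.mul_dvd (.mul_right ?_
      (.mul_right ?_ (.mul_right ?_ ?_))) (hX 2) (IsRelPrime.mul_dvd (.mul_right ?_
      (.mul_right ?_ ?_)) (hX 3) (IsRelPrime.mul_dvd (.mul_right ?_ ?_) h01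
      (IsRelPrime.mul_dvd ?_ h12 h23)))))
    iterate 6 refine (r _).isRelPrime ![0, 1, 2, 3] ?_ ?_ <;> simp <;> norm_num
    iterate 5 refine (r _).isRelPrime ![1, 0, 2, 3] ?_ ?_ <;> simp <;> norm_num
    iterate 4 refine (r _).isRelPrime ![1, 2, 0, 3] ?_ ?_ <;> simp <;> norm_num
    iterate 3 refine (r _).isRelPrime ![1, 2, 3, 0] ?_ ?_ <;> simp <;> norm_num
    iterate 2
      refine r01.isRelPrime ![1, -1, 2, 3] ?_ ?_ <;> simp
      norm_num
    refine r12.isRelPrime ![1, -1, 1, 3] ?_ ?_ <;> simp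
    norm_num
  have hx (k : Fin 4) := isHomogeneous_X ℚ k
  obtain ⟨M, hM, rfl⟩ := exists_isHomogeneous_of_dvd (a := 7) (b := 1)
    ((hx _).mul ((hx _).mul ((hx _).mul ((hx _).mul (((hx _).add (hx _)).mul
      (((hx _).add (hx _)).mul ((hx _).add (hx _)))))))) h8 hP
  have r := restricts_X_add (j := 3) (k := 0) (by simp)
  have hM30 : M ∈ Ideal.span {X 3, X 0} := by
    refine mem_span_X_pair_of_mul ![0, 1, 1, 0] (by simp) (by simp)
      (h := X 1 * X 2 * ((X 0 + X 1) * (X 1 + X 2) * (X 2 + X 3))) (by simp)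
      (mem_span_of_mul_mem_Ieq 3 ?_)
    convert hg using 1
    rw [show (3 + 1 : Fin 4) = 0 from rfl]
    ring
  set φ : R →ₐ[ℚ] R := aeval (Function.update X 3 (-X 0)) with hφ
  have φ3 : φ (X 3) = -X 0 := by rw [hφ, aeval_X, Function.update_self]
  have φ0 : φ (X 0) = X 0 := by rw [hφ, aeval_X, Function.update_of_ne (by simp)]
  have h0 : X 0 ∣ φ M := by
    obtain ⟨a, b, rfl⟩ := Ideal.mem_span_pair.mp hM30
    exact ⟨φ b - φ a, by rw [map_add, map_mul, map_mul, φ3, φ0]; ring⟩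
  obtain ⟨B, hB, hMB⟩ := exists_isHomogeneous_of_dvd (a := 1) (b := 0) (hx 0)
    (isHomogeneous_aeval_update (hx 0).neg hM) h0
  rw [← totalDegree_zero_iff_isHomogeneous, totalDegree_eq_zero_iff_eq_C] at hB
  set β := coeff 0 B
  change φ M = _ at hMB
  obtain ⟨D, hD⟩ : X 3 + X 0 ∣ M - C β * X 0 := by
    refine r.dvd_iff.mpr ?_
    change φ _ = 0
    rw [map_sub, hMB, map_mul, φ0, hB, hφ, algHom_C, algebraMap_eq]
    ring
  have hfac : X 0 * (X 1 * (X 2 * (X 3 * ((X 0 + X 1) * ((X 1 + X 2) * (X 2 + X 3)))))) * M =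
      C β * X 0 * (X 0 * X 1 * X 2 * X 3) * ((X 0 + X 1) * (X 1 + X 2) * (X 2 + X 3)) + D * f := by
    rw [f_eq 0]
    simp only [zero_add]
    linear_combination
      X 0 * (X 1 * (X 2 * (X 3 * ((X 0 + X 1) * ((X 1 + X 2) * (X 2 + X 3)))))) * hD
  have hDf : D * f ∈ Jf := Ideal.mul_mem_left _ _ f_mem_Jf
  rw [hfac] at hg ⊢
  have hβ := eq_zero_of_mem_Ieq ((Ideal.add_mem_iff_left _ (Jf_le_Ieq hDf)).mp hg)
  simpa [hβ] using hDf

theorem mem_Jf_of_mem_Ieq_of_X_dvd {g : R} (hg : g ∈ Ieq) (h8 : g.IsHomogeneous 8)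
    (hX : ∀ j, X j ∣ g) : g ∈ Jf := by
  choose α hα using exists_aeval_eq hg h8 hX
  set v : R := C (α 0) * (X 1 * pderiv 1 f) + C (α 0 + α 1) * (X 2 * pderiv 2 f) +
    C (α 0 + α 1 + α 2) * (X 3 * pderiv 3 f) with hv
  have hvJ : v ∈ Jf := by
    have h (a : R) (k : Fin 4) : a * (X k * pderiv k f) ∈ Jf :=
      Ideal.mul_mem_left _ _ (Ideal.mul_mem_left _ _ (pderiv_f_mem k))
    exact Ideal.add_mem _ (Ideal.add_mem _ (h _ _) (h _ _)) (h _ _)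
  have hv8 : v.IsHomogeneous 8 := by
    have h (k : Fin 4) := (isHomogeneous_X ℚ k).mul (isHomogeneous_pderiv_f k)
    exact (((h _).C_mul _).add ((h _).C_mul _)).add ((h _).C_mul _)
  have hvX (j : Fin 4) : X j ∣ v := by
    have h (a : R) (k : Fin 4) : X j ∣ a * (X k * pderiv k f) := by
      by_cases hjk : j = k
      · subst hjk
        exact (dvd_mul_right _ _).mul_left _
      · exact ((X_dvd_pderiv hjk).mul_left _).mul_left _
    exact dvd_add (dvd_add (h _ _) (h _ _)) (h _ _)
  have e (s : Fin 4 → R) (a : ℚ) : aeval s (C a) = (C a : R) := algHom_C _ _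
  have h0 : X 0 + X 1 ∣ g - v := by
    rw [(restricts_X_add (by simp)).dvd_iff, map_sub, hv]
    have h1 := aeval_X_mul_pderiv_succ 0
    have h2 := aeval_X_mul_pderiv (j := 0) (k := 2) (by decide) (by decide)
    have h3 := aeval_X_mul_pderiv (j := 0) (k := 3) (by decide) (by decide)
    have h := hα 0
    rw [zero_add] at h h1 h2 h3
    rw [h, map_add, map_add, map_mul _ (C _), map_mul _ (C _), map_mul _ (C _), h1, h2, h3, e]
    ring
  have h1 : X 1 + X 2 ∣ g - v := by
    rw [(restricts_X_add (by simp)).dvd_iff, map_sub, hv]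
    have h1 := aeval_X_mul_pderiv_self 1
    have h2 := aeval_X_mul_pderiv_succ 1
    have h3 := aeval_X_mul_pderiv (j := 1) (k := 3) (by decide) (by decide)
    have h := hα 1
    rw [show (1 + 1 : Fin 4) = 2 from rfl] at h h1 h2 h3
    rw [h, map_add, map_add, map_mul _ (C _), map_mul _ (C _), map_mul _ (C _), h1, h2, h3]
    simp only [map_add, e]
    ring
  have h2 : X 2 + X 3 ∣ g - v := by
    rw [(restricts_X_add (by simp)).dvd_iff, map_sub, hv]
    have h1 := aeval_X_mul_pderiv (j := 2) (k := 1) (by decide) (by decide)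
    have h2 := aeval_X_mul_pderiv_self 2
    have h3 := aeval_X_mul_pderiv_succ 2
    have h := hα 2
    rw [show (2 + 1 : Fin 4) = 3 from rfl] at h h1 h2 h3
    rw [h, map_add, map_add, map_mul _ (C _), map_mul _ (C _), map_mul _ (C _), h1, h2, h3]
    simp only [map_add, e]
    ring
  have := mem_Jf_of_dvd (Ideal.sub_mem _ hg (Jf_le_Ieq hvJ)) (h8.sub hv8)
    (fun j => dvd_sub (hX j) (hvX j)) h0 h1 h2
  simpa using Ideal.add_mem _ this hvJ

theorem mem_Jf_of_mem_Ieq {g : R} (hg : g ∈ Ieq) (h8 : g.IsHomogeneous 8) : g ∈ Jf := by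
  choose L hL hgL using exists_dvd_sub_mul_pderiv hg h8
  have hvJ : ∑ k, L k * pderiv k f ∈ Jf :=
    Ideal.sum_mem _ fun k _ => Ideal.mul_mem_left _ _ (pderiv_f_mem k)
  have hv8 : (∑ k, L k * pderiv k f).IsHomogeneous 8 :=
    IsHomogeneous.sum _ _ _ fun k _ => (hL k).mul (isHomogeneous_pderiv_f k)
  suffices hX : ∀ j, X j ∣ g - ∑ k, L k * pderiv k f by
    simpa using Ideal.add_mem _ (mem_Jf_of_mem_Ieq_of_X_dvd
      (Ideal.sub_mem _ hg (Jf_le_Ieq hvJ)) (h8.sub hv8) hX) hvJ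
  intro j
  rw [← Finset.add_sum_erase _ _ (Finset.mem_univ j), ← sub_sub]
  exact dvd_sub (hgL j) (Finset.dvd_sum fun k hk =>
    (X_dvd_pderiv (Finset.ne_of_mem_erase hk).symm).mul_left _)

/-- The degree-8 homogeneous components of `I_eq` and of `Jf` coincide;
equivalently `dim_ℚ (I_eq/Jf)^(8) = 0`: arrangement no. 2 admits no nontrivial
equisingular deformations, the associated double octic Calabi–Yau threefold is
rigid. -/
theorem arrangement2_rigid :
    Submodule.restrictScalars ℚ Ieq ⊓ homogeneousSubmodule (Fin 4) ℚ 8 =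
    Submodule.restrictScalars ℚ Jf ⊓ homogeneousSubmodule (Fin 4) ℚ 8 :=
  le_antisymm (le_inf (fun _ hg => mem_Jf_of_mem_Ieq hg.1 hg.2) inf_le_right)
    (inf_le_inf_right _ Jf_le_Ieq)

end Octic2
end
end

section
/- Let f = xy(x−y)(x−z)(x−t)(y−z)(y−t)(x+2y−z−t) ∈ ℚ[x,y,z,t] (arrangement no. 6) and let Jf and I_eq be its Jacobian ideal and equisingular ideal. Then the degree-8 homogeneous component of I_eq equals the degree-8 homogeneous component of Jf; equivalently, dim_ℚ (I_eq/Jf)^(8) = 0, i.e., the octic arrangement no. 6 admits no nontrivial equisingular deformations and the associated double octic Calabi–Yau threefold is rigid. -/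
/-!
Rigidity of the double octic of arrangement no. 6:
for `f = xy(x−y)(x−z)(x−t)(y−z)(y−t)(x+2y−z−t)` the degree-8 homogeneous
component of the equisingular ideal `I_eq` equals that of the Jacobian ideal
`Jf`, i.e. `dim_ℚ (I_eq/Jf)^(8) = 0`.
-/

noncomputable section

open Matrix MvPolynomial

namespace Octic6

/-- `R = ℚ[x,y,z,t]` -/
abbrev R : Type := MvPolynomial (Fin 4) ℚ

/-- The linear polynomial with coefficient vector `a`. -/
def lin (a : Fin 4 → ℚ) : R := ∑ j, C (a j) * X j

/-- Coefficient vectors of the eight planes `x, y, x−y, x−z, x−t, y−z, y−t, x+2y−z−t`. -/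
def c : Fin 8 → Fin 4 → ℚ :=
  ![![1,0,0,0], ![0,1,0,0], ![1,-1,0,0], ![1,0,-1,0],
    ![1,0,0,-1], ![0,1,-1,0], ![0,1,0,-1], ![1,2,-1,-1]]

/-- The octic `f = xy(x−y)(x−z)(x−t)(y−z)(y−t)(x+2y−z−t)`. -/
def f : R := ∏ i, lin (c i)

/-- The Jacobian ideal of `f`. -/
def Jf : Ideal R :=
  Ideal.span {pderiv 0 f, pderiv 1 f, pderiv 2 f, pderiv 3 f}

/-- `m(P)`: the number of the eight planes through the point `v`. -/
def m (v : Fin 4 → ℚ) : ℕ := {i : Fin 8 | c i ⬝ᵥ v = 0}.ncard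

/-- `m(ℓᵢ,ℓⱼ)`: the number of the eight factors lying in the pencil spanned by
`ℓᵢ` and `ℓⱼ` (the multiplicity of `f` along the line `ℓᵢ = ℓⱼ = 0`). -/
def mLine (i j : Fin 8) : ℕ :=
  {k : Fin 8 | c k ∈ Submodule.span ℚ ({c i, c j} : Set (Fin 4 → ℚ))}.ncard

/-- `I_P`: the ideal of the point `v`, generated by all linear forms
vanishing at `v`. -/
def IP (v : Fin 4 → ℚ) : Ideal R :=
  Ideal.span (lin '' {a : Fin 4 → ℚ | a ⬝ᵥ v = 0})

/-- The equisingular ideal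
`I_eq = ⋂ ((ℓ,ℓ′)^{m(ℓ,ℓ′)} + Jf) ∩ ⋂ (I_P^{m(P)} + Jf)`, the first
intersection over all pairs of linearly independent factors, the second over
all points of `ℙ³(ℚ)` lying on at least three of the eight planes. -/
def Ieq : Ideal R :=
  (⨅ (i : Fin 8) (j : Fin 8) (_ : LinearIndependent ℚ ![c i, c j]),
      (Ideal.span {lin (c i), lin (c j)} ^ mLine i j + Jf)) ⊓
  (⨅ (v : Fin 4 → ℚ) (_ : v ≠ 0) (_ : 3 ≤ m v), (IP v ^ m v + Jf))

section UniqueFactorization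

variable {ι A : Type*} [CommRing A] [IsDomain A] [UniqueFactorizationMonoid A]

open Classical in
lemma emultiplicity_of_prime {p q : A} (hp : Prime p) (hq : Prime q) :
    emultiplicity p q = if Associated p q then 1 else 0 := by
  split_ifs with h
  · rw [← emultiplicity_eq_of_associated_right h]
    exact (FiniteMultiplicity.of_prime_left hp hp.ne_zero).emultiplicity_self
  · exact emultiplicity_eq_zero.2 fun hd => h ((hp.dvd_prime_iff_associated hq).1 hd)

open Classical in
/-- A product of primes divides `g` once each prime does so to the power given by the number of
its associates among the factors. -/
lemma prod_primes_dvd_of_pow_card_dvd {s : Finset ι} {p : ι → A} {g : A}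
    (hp : ∀ j ∈ s, Prime (p j))
    (h : ∀ j ∈ s, p j ^ (s.filter fun k => Associated (p j) (p k)).card ∣ g) :
    ∏ j ∈ s, p j ∣ g := by
  rw [UniqueFactorizationMonoid.dvd_iff_emultiplicity_le
    (Finset.prod_ne_zero_iff.2 fun j hj => (hp j hj).ne_zero)]
  intro q hq
  rw [Finset.emultiplicity_prod hq,
    Finset.sum_congr rfl fun k hk => emultiplicity_of_prime hq (hp k hk), Finset.sum_boole]
  by_cases hex : ∃ j ∈ s, Associated q (p j)
  · obtain ⟨j, hj, hqj⟩ := hex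
    rw [emultiplicity_eq_of_associated_left hqj.symm]
    refine le_emultiplicity_of_pow_dvd ?_
    have heq : (s.filter fun k => Associated q (p k)) = s.filter fun k => Associated (p j) (p k) :=
      Finset.filter_congr fun k _ => ⟨hqj.symm.trans, hqj.trans⟩
    exact heq ▸ h j hj
  · push Not at hex
    rw [Finset.filter_false_of_mem hex]
    simp

end UniqueFactorization

section LinearForms

lemma lin_add (a b : Fin 4 → ℚ) : lin (a + b) = lin a + lin b := by
  simp [lin, add_mul, Finset.sum_add_distrib]

lemma lin_smul (r : ℚ) (a : Fin 4 → ℚ) : lin (r • a) = C r * lin a := by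
  simp [lin, Finset.mul_sum, mul_assoc]

lemma lin_sub (a b : Fin 4 → ℚ) : lin (a - b) = lin a - lin b := by
  simp [lin, sub_mul, Finset.sum_sub_distrib]

lemma lin_sum {ι : Type*} (s : Finset ι) (a : ι → Fin 4 → ℚ) :
    lin (∑ i ∈ s, a i) = ∑ i ∈ s, lin (a i) := by
  simp only [lin, Finset.sum_apply, map_sum, Finset.sum_mul]
  exact Finset.sum_comm

lemma lin_isHomogeneous (a : Fin 4 → ℚ) : (lin a).IsHomogeneous 1 :=
  IsHomogeneous.sum _ _ _ fun j _ => isHomogeneous_C_mul_X (a j) j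

lemma eval_lin (a v : Fin 4 → ℚ) : eval v (lin a) = a ⬝ᵥ v := by
  simp [lin, dotProduct]

lemma pderiv_lin (k : Fin 4) (a : Fin 4 → ℚ) : pderiv k (lin a) = C (a k) := by
  simp [lin, pderiv_X, Pi.single_apply]

lemma lin_injective : Function.Injective lin := fun a b h => by
  ext k
  simpa [pderiv_lin] using congrArg (pderiv k) h

lemma exists_lin_eq {p : R} (hp : p.IsHomogeneous 1) : ∃ a, p = lin a := by
  have hp' : p ∈ homogeneousSubmodule (Fin 4) ℚ 1 := hp
  rw [homogeneousSubmodule_one_eq_span_X, Submodule.mem_span_range_iff_exists_fun] at hp'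
  obtain ⟨a, ha⟩ := hp'
  exact ⟨a, by simp [lin, ← ha, smul_eq_C_mul]⟩

lemma lin_ne_zero {a : Fin 4 → ℚ} (ha : a ≠ 0) : lin a ≠ 0 := fun h =>
  ha (lin_injective (h.trans (by simp [lin])))

lemma prime_lin {a : Fin 4 → ℚ} (ha : a ≠ 0) : Prime (lin a) := by
  refine (irreducible_of_totalDegree_eq_one
    ((lin_isHomogeneous a).totalDegree (lin_ne_zero ha)) fun x hx => ?_).prime
  refine isUnit_iff_ne_zero.2 fun h0 => lin_ne_zero ha ?_
  ext i
  simpa [h0] using hx i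

lemma eq_smul_of_associated_lin {a b : Fin 4 → ℚ} (h : Associated (lin a) (lin b)) :
    ∃ r : ℚ, b = r • a := by
  obtain ⟨u, hu⟩ := h
  obtain ⟨r, -, hr⟩ := isUnit_iff_eq_C_of_isReduced.1 u.isUnit
  refine ⟨r, lin_injective ?_⟩
  rw [lin_smul, ← hu, hr, mul_comm]

end LinearForms

section Arrangement

/-- The product of all the factors of `f` except the `i`-th. -/
def cofactor (i : Fin 8) : R := ∏ j ∈ Finset.univ.erase i, lin (c j)

/-- The index of a coordinate with coefficient one in the `i`-th factor. -/
def pivot : Fin 8 → Fin 4 := ![0, 1, 0, 0, 0, 1, 1, 0]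

lemma c_pivot (i : Fin 8) : c i (pivot i) = 1 := by
  fin_cases i <;> simp [c, pivot]

/-- A point of the `i`-th plane lying on no other plane. -/
def generic (i : Fin 8) : Fin 4 → ℚ :=
  ![2, 7, 31, 101] - (c i ⬝ᵥ ![2, 7, 31, 101]) • Pi.single (pivot i) 1

lemma c_dotProduct_generic_self (i : Fin 8) : c i ⬝ᵥ generic i = 0 := by
  rw [generic, dotProduct_sub, dotProduct_smul, dotProduct_single_one, c_pivot, smul_eq_mul,
    mul_one, sub_self]

lemma c_dotProduct_generic {i j : Fin 8} (h : j ≠ i) : c j ⬝ᵥ generic i ≠ 0 := by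
  fin_cases i <;> fin_cases j <;>
    first
    | exact absurd rfl h
    | (simp [generic, c, pivot, dotProduct, Fin.sum_univ_four]; try norm_num)

lemma not_eq_smul {i j : Fin 8} (h : j ≠ i) (r : ℚ) : c j ≠ r • c i := fun he =>
  c_dotProduct_generic h (by rw [he, smul_dotProduct, c_dotProduct_generic_self, smul_zero])

lemma c_ne_zero (i : Fin 8) : c i ≠ 0 := fun h => by
  simpa [h] using c_pivot i

lemma linearIndependent_pair {i j : Fin 8} (h : j ≠ i) : LinearIndependent ℚ ![c i, c j] :=
  (LinearIndependent.pair_iff' (c_ne_zero i)).2 fun r hr => not_eq_smul h r hr.symm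

lemma lin_mul_cofactor (i : Fin 8) : lin (c i) * cofactor i = f :=
  Finset.mul_prod_erase _ _ (Finset.mem_univ i)

lemma cofactor_isHomogeneous (i : Fin 8) : (cofactor i).IsHomogeneous 7 := by
  simpa [cofactor] using IsHomogeneous.prod (Finset.univ.erase i) (fun j => lin (c j)) (fun _ => 1)
    fun j _ => lin_isHomogeneous (c j)

lemma derivation_prod {ι : Type*} [DecidableEq ι] (D : Derivation ℚ R R) (s : Finset ι)
    (p : ι → R) : D (∏ i ∈ s, p i) = ∑ i ∈ s, D (p i) * ∏ j ∈ s.erase i, p j := by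
  induction s using Finset.induction_on with
  | empty => simp
  | insert a s ha ih =>
    rw [Finset.prod_insert ha, D.leibniz, ih, Finset.sum_insert ha, Finset.erase_insert ha,
      smul_eq_mul, smul_eq_mul, Finset.mul_sum, add_comm, mul_comm (∏ i ∈ s, p i)]
    congr 1
    refine Finset.sum_congr rfl fun i hi => ?_
    have hai : a ≠ i := fun h => ha (h ▸ hi)
    rw [Finset.erase_insert_of_ne hai, Finset.prod_insert (fun h => ha (Finset.mem_of_mem_erase h))]
    ring

lemma pderiv_f (k : Fin 4) : pderiv k f = ∑ i, C (c i k) * cofactor i := by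
  simp only [f, derivation_prod, pderiv_lin, cofactor]

lemma Jf_eq : Jf = Ideal.span (Set.range fun k => pderiv k f) := by
  rw [Jf]
  congr 1
  ext p
  simp [Fin.exists_fin_succ, eq_comm]

lemma mem_Jf_iff {g : R} : g ∈ Jf ↔ ∃ q : Fin 4 → R, ∑ k, q k * pderiv k f = g := by
  rw [Jf_eq, Ideal.mem_span_range_iff_exists_fun]

lemma map_cofactor_eq_zero {S : Type*} [CommRing S] (φ : R →+* S) {i j : Fin 8}
    (h : φ (lin (c i)) = 0) (hj : j ≠ i) : φ (cofactor j) = 0 := by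
  rw [cofactor, map_prod]
  exact Finset.prod_eq_zero (Finset.mem_erase.2 ⟨hj.symm, Finset.mem_univ i⟩) h

/-- A ring homomorphism killing the `i`-th factor sends every partial derivative of `f` to a
multiple of the image of the `i`-th cofactor. -/
lemma map_pderiv_f {S : Type*} [CommRing S] (φ : R →+* S) {i : Fin 8} (h : φ (lin (c i)) = 0)
    (k : Fin 4) : φ (pderiv k f) = φ (C (c i k)) * φ (cofactor i) := by
  rw [pderiv_f, map_sum, Finset.sum_eq_single i, map_mul]
  · intro j _ hj
    rw [map_mul, map_cofactor_eq_zero φ h hj, mul_zero]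
  · simp

end Arrangement

section Planes

/-- The projection of `R` onto a ring of functions on the `i`-th plane, substituting the
pivot variable. -/
def proj (i : Fin 8) : R →ₐ[ℚ] R :=
  aeval fun l => X l - C ((Pi.single (pivot i) 1 : Fin 4 → ℚ) l) * lin (c i)

lemma proj_lin (i : Fin 8) (a : Fin 4 → ℚ) :
    proj i (lin a) = lin (a - a (pivot i) • c i) := by
  have h : ∑ l, C (a l) * C ((Pi.single (pivot i) 1 : Fin 4 → ℚ) l) = (C (a (pivot i)) : R) := by
    simp_rw [← C_mul, ← map_sum, ← dotProduct.eq_1, dotProduct_single_one]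
  rw [lin_sub, lin_smul, ← h, Finset.sum_mul, lin, map_sum, ← Finset.sum_sub_distrib]
  refine Finset.sum_congr rfl fun l _ => ?_
  rw [map_mul, proj, algHom_C, aeval_X, algebraMap_eq]
  ring

lemma proj_lin_self (i : Fin 8) : proj i (lin (c i)) = 0 := by
  rw [proj_lin, c_pivot, one_smul, sub_self]
  simp [lin]

lemma lin_dvd_sub_proj (i : Fin 8) (p : R) : lin (c i) ∣ p - proj i p := by
  have h : Ideal.Quotient.mkₐ ℚ (Ideal.span {lin (c i)}) =
      (Ideal.Quotient.mkₐ ℚ (Ideal.span {lin (c i)})).comp (proj i) := by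
    refine algHom_ext fun l => ?_
    rw [AlgHom.comp_apply, proj, aeval_X, Ideal.Quotient.mkₐ_eq_mk, Ideal.Quotient.eq,
      Ideal.mem_span_singleton]
    simp
  rw [← Ideal.mem_span_singleton, ← Ideal.Quotient.eq]
  exact DFunLike.congr_fun h p

lemma proj_proj (i : Fin 8) (p : R) : proj i (proj i p) = proj i p := by
  obtain ⟨q, hq⟩ := lin_dvd_sub_proj i p
  have h := congrArg (proj i) hq
  rw [map_sub, map_mul, proj_lin_self, zero_mul, sub_eq_zero] at h
  exact h.symm

lemma lin_dvd_of_proj_eq_zero {i : Fin 8} {p : R} (h : proj i p = 0) : lin (c i) ∣ p := by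
  simpa [h] using lin_dvd_sub_proj i p

lemma proj_cofactor (i : Fin 8) :
    proj i (cofactor i) = ∏ j ∈ Finset.univ.erase i, lin (c j - c j (pivot i) • c i) := by
  simp only [cofactor, map_prod, proj_lin]

lemma proj_cofactor_dvd_of_mem_Jf (i : Fin 8) {q : R} (hq : q ∈ Jf) :
    proj i (cofactor i) ∣ proj i q := by
  obtain ⟨r, rfl⟩ := mem_Jf_iff.1 hq
  rw [map_sum]
  refine Finset.dvd_sum fun k _ => ?_
  have h := map_pderiv_f (proj i : R →+* R) (proj_lin_self i) k
  simp only [RingHom.coe_coe] at h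
  rw [map_mul, h]
  exact ((dvd_refl _).mul_left _).mul_left _

open Classical in
lemma card_associated_le_mLine (i j : Fin 8) :
    ((Finset.univ.erase i).filter fun k => Associated (lin (c j - c j (pivot i) • c i))
      (lin (c k - c k (pivot i) • c i))).card ≤ mLine i j := by
  rw [mLine, ← Set.ncard_coe_finset]
  refine Set.ncard_le_ncard (fun k hk => ?_) (Set.toFinite _)
  obtain ⟨r, hr⟩ := eq_smul_of_associated_lin (Finset.mem_filter.1 hk).2
  refine Submodule.mem_span_pair.2 ⟨c k (pivot i) - r * c j (pivot i), r, ?_⟩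
  rw [sub_eq_iff_eq_add] at hr
  rw [sub_smul, mul_smul]
  nth_rewrite 2 [hr]
  module

lemma proj_cofactor_dvd {g : R} (hg : g ∈ Ieq) (i : Fin 8) :
    proj i (cofactor i) ∣ proj i g := by
  classical
  have hd : ∀ j ∈ Finset.univ.erase i, c j - c j (pivot i) • c i ≠ 0 := fun j hj h =>
    not_eq_smul (Finset.ne_of_mem_erase hj) _ (sub_eq_zero.1 h)
  rw [proj_cofactor]
  refine prod_primes_dvd_of_pow_card_dvd (fun j hj => prime_lin (hd j hj)) fun j hj => ?_
  have hmem : g ∈ Ideal.span {lin (c i), lin (c j)} ^ mLine i j + Jf := by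
    have h := hg
    rw [Ieq, Ideal.mem_inf] at h
    simp only [Ideal.mem_iInf] at h
    exact h.1 i j (linearIndependent_pair (Finset.ne_of_mem_erase hj))
  obtain ⟨p, hp, q, hq, rfl⟩ := Submodule.mem_sup.1 hmem
  rw [map_add]
  refine dvd_add ?_ (Dvd.dvd.trans ?_ (proj_cofactor_dvd_of_mem_Jf i hq))
  · have h := Ideal.mem_map_of_mem (proj i) hp
    rw [Ideal.map_pow, Ideal.map_span, Set.image_pair, proj_lin_self, Ideal.span_insert_zero,
      proj_lin, Ideal.span_singleton_pow, Ideal.mem_span_singleton] at h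
    exact (pow_dvd_pow _ (card_associated_le_mLine i j)).trans h
  · rw [proj_cofactor, ← Finset.prod_const]
    exact (Finset.prod_dvd_prod_of_dvd _ _ fun k hk => (Finset.mem_filter.1 hk).2.dvd).trans
      (Finset.prod_dvd_prod_of_subset _ _ _ (Finset.filter_subset _ _))

lemma homogeneousComponent_mul_cofactor (p : R) (i : Fin 8) :
    homogeneousComponent 8 (p * cofactor i) = homogeneousComponent 1 p * cofactor i := by
  let : GradedAlgebra (homogeneousSubmodule (Fin 4) ℚ) := gradedAlgebra
  rw [← decomposition.decompose'_apply, ← decomposition.decompose'_apply]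
  exact DirectSum.coe_decompose_mul_add_of_right_mem (homogeneousSubmodule (Fin 4) ℚ)
    (i := 1) (a := p) (cofactor_isHomogeneous i)

lemma f_dvd_of_forall_lin_dvd {p : R} (h : ∀ i, lin (c i) ∣ p) : f ∣ p := by
  refine Fintype.prod_dvd_of_isRelPrime (fun i j hij => ?_) h
  refine ((prime_lin (c_ne_zero i)).irreducible.isRelPrime_iff_not_dvd).2 fun hd => ?_
  obtain ⟨r, hr⟩ := eq_smul_of_associated_lin
    (((prime_lin (c_ne_zero i)).dvd_prime_iff_associated (prime_lin (c_ne_zero j))).1 hd)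
  exact not_eq_smul hij.symm r hr

/-- Forms of degree eight in the equisingular ideal are tangent to the space of products of
eight linear forms. -/
lemma exists_eq_sum_lin_mul_cofactor {g : R} (hg : g ∈ Ieq) (h8 : g.IsHomogeneous 8) :
    ∃ b : Fin 8 → Fin 4 → ℚ, g = ∑ i, lin (b i) * cofactor i := by
  choose q hq using proj_cofactor_dvd hg
  obtain ⟨r, hr⟩ : f ∣ g - ∑ i, q i * cofactor i := by
    refine f_dvd_of_forall_lin_dvd fun i => lin_dvd_of_proj_eq_zero ?_
    have h := congrArg (proj i) (hq i)
    rw [proj_proj, map_mul, proj_proj] at h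
    rw [map_sub, map_sum, Finset.sum_eq_single i, map_mul, h, mul_comm, sub_self]
    · intro j _ hj
      have h0 := map_cofactor_eq_zero (proj i : R →+* R) (proj_lin_self i) hj
      simp only [RingHom.coe_coe] at h0
      rw [map_mul, h0, mul_zero]
    · simp
  have hsum : g = ∑ i, (q i + (Pi.single 0 (r * lin (c 0)) : Fin 8 → R) i) * cofactor i := by
    rw [sub_eq_iff_eq_add, ← lin_mul_cofactor 0] at hr
    simp only [add_mul, Finset.sum_add_distrib, Pi.single_apply, ite_mul, zero_mul,
      Finset.sum_ite_eq', Finset.mem_univ, if_true]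
    rw [hr]
    ring
  choose b hb using fun i => exists_lin_eq (homogeneousComponent_isHomogeneous 1
    (q i + (Pi.single 0 (r * lin (c 0)) : Fin 8 → R) i))
  refine ⟨b, ?_⟩
  conv_lhs => rw [← homogeneousComponent_eq_self h8, hsum, map_sum]
  simp only [homogeneousComponent_mul_cofactor, hb]

end Planes

section Points

/-- Restriction of polynomials to the line through `v` with direction `u`. -/
def restrictLine (v u : Fin 4 → ℚ) : R →ₐ[ℚ] Polynomial ℚ :=
  aeval fun l => Polynomial.C (v l) + Polynomial.X * Polynomial.C (u l)

lemma restrictLine_lin (v u a : Fin 4 → ℚ) :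
    restrictLine v u (lin a) =
      Polynomial.C (a ⬝ᵥ v) + Polynomial.X * Polynomial.C (a ⬝ᵥ u) := by
  simp only [lin, restrictLine, dotProduct, map_sum, map_mul, algHom_C, aeval_X, Finset.mul_sum,
    ← Finset.sum_add_distrib, Polynomial.algebraMap_eq]
  refine Finset.sum_congr rfl fun l _ => ?_
  ring

lemma eval_zero_restrictLine (v u : Fin 4 → ℚ) (p : R) :
    (restrictLine v u p).eval 0 = eval v p := by
  have h : (Polynomial.aeval (0 : ℚ)).comp (restrictLine v u) = aeval v := by
    refine algHom_ext fun l => ?_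
    simp [restrictLine]
  have hp := DFunLike.congr_fun h p
  rw [AlgHom.comp_apply, Polynomial.coe_aeval_eq_eval] at hp
  rw [hp, ← coe_aeval_eq_eval]
  rfl

lemma X_pow_dvd_restrictLine {v : Fin 4 → ℚ} (u : Fin 4 → ℚ) {n : ℕ} {p : R}
    (hp : p ∈ IP v ^ n) : Polynomial.X ^ n ∣ restrictLine v u p := by
  rw [← Ideal.mem_span_singleton, ← Ideal.span_singleton_pow]
  refine SetLike.le_def.1 (Ideal.pow_right_mono (?_ : (IP v).map (restrictLine v u) ≤ _) n)
    (Ideal.map_pow (restrictLine v u) (IP v) n ▸ Ideal.mem_map_of_mem _ hp)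
  rw [IP, Ideal.map_span, Ideal.span_le]
  rintro _ ⟨_, ⟨a, ha, rfl⟩, rfl⟩
  have ha' : a ⬝ᵥ v = 0 := ha
  rw [SetLike.mem_coe, Ideal.mem_span_singleton, restrictLine_lin, ha', map_zero, zero_add]
  exact dvd_mul_right _ _

lemma exists_restrictLine_cofactor {v : Fin 4 → ℚ} {S : Finset (Fin 8)}
    (hS : ∀ i, c i ⬝ᵥ v = 0 ↔ i ∈ S) {i : Fin 8} (hi : i ∈ S) :
    ∃ K : Polynomial ℚ, K.eval 0 ≠ 0 ∧
      restrictLine v (generic i) (cofactor i) = Polynomial.X ^ (S.card - 1) * K := by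
  refine ⟨∏ j ∈ Finset.univ.erase i, if j ∈ S then Polynomial.C (c j ⬝ᵥ generic i)
    else restrictLine v (generic i) (lin (c j)), ?_, ?_⟩
  · rw [Polynomial.eval_prod]
    refine Finset.prod_ne_zero_iff.2 fun j hj => ?_
    split_ifs with hjS
    · rw [Polynomial.eval_C]
      exact c_dotProduct_generic (Finset.ne_of_mem_erase hj)
    · rw [eval_zero_restrictLine, eval_lin]
      exact fun h => hjS ((hS j).1 h)
  · have hcard : ((Finset.univ.erase i).filter fun j => j ∈ S) = S.erase i := by
      ext j
      simp
    have hpow : (Polynomial.X : Polynomial ℚ) ^ (S.card - 1) =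
        ∏ j ∈ Finset.univ.erase i, if j ∈ S then Polynomial.X else 1 := by
      rw [← Finset.prod_filter, hcard, Finset.prod_const, Finset.card_erase_of_mem hi]
    rw [hpow, ← Finset.prod_mul_distrib, cofactor, map_prod]
    refine Finset.prod_congr rfl fun j _ => ?_
    split_ifs with hjS
    · rw [restrictLine_lin, (hS j).2 hjS, map_zero, zero_add]
    · rw [one_mul]

/-- The planes through a multiple point keep a common point to first order. -/
lemma exists_dotProduct_eq {b : Fin 8 → Fin 4 → ℚ} (hg : ∑ i, lin (b i) * cofactor i ∈ Ieq)
    {v : Fin 4 → ℚ} (hv : v ≠ 0) (S : Finset (Fin 8)) (hS : ∀ i, c i ⬝ᵥ v = 0 ↔ i ∈ S)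
    (hcard : 3 ≤ S.card) : ∃ w, ∀ i ∈ S, b i ⬝ᵥ v = c i ⬝ᵥ w := by
  have hm : m v = S.card := by
    rw [m, ← Set.ncard_coe_finset]
    congr 1
    ext i
    exact hS i
  have hmem : ∑ i, lin (b i) * cofactor i ∈ IP v ^ S.card + Jf := by
    rw [Ieq, Ideal.mem_inf] at hg
    simp only [Ideal.mem_iInf] at hg
    exact hm ▸ hg.2 v hv (hm ▸ hcard)
  obtain ⟨p, hp, r, hr, hpr⟩ := Submodule.mem_sup.1 hmem
  obtain ⟨q, rfl⟩ := mem_Jf_iff.1 hr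
  refine ⟨fun k => eval v (q k), fun i hi => ?_⟩
  obtain ⟨K, hK, hcof⟩ := exists_restrictLine_cofactor hS hi
  set φ := restrictLine v (generic i) with hφ
  have hφ0 : φ (lin (c i)) = 0 := by
    rw [hφ, restrictLine_lin, (hS i).2 hi, c_dotProduct_generic_self]
    simp
  have hleft : φ (∑ j, lin (b j) * cofactor j) = φ (lin (b i)) * φ (cofactor i) := by
    rw [map_sum, Finset.sum_eq_single i, map_mul]
    · intro j _ hj
      have h0 := map_cofactor_eq_zero (φ : R →+* Polynomial ℚ) hφ0 hj
      simp only [RingHom.coe_coe] at h0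
      rw [map_mul, h0, mul_zero]
    · simp
  have hright : φ (∑ k, q k * pderiv k f) =
      (∑ k, φ (q k) * Polynomial.C (c i k)) * φ (cofactor i) := by
    rw [map_sum, Finset.sum_mul]
    refine Finset.sum_congr rfl fun k _ => ?_
    have h := map_pderiv_f (φ : R →+* Polynomial ℚ) hφ0 k
    simp only [RingHom.coe_coe] at h
    rw [map_mul, h, algHom_C, Polynomial.algebraMap_eq]
    ring
  have hp' : φ p = Polynomial.X ^ (S.card - 1) *
      (K * (φ (lin (b i)) - ∑ k, φ (q k) * Polynomial.C (c i k))) := by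
    have h := congrArg φ hpr
    rw [map_add, hleft, hright, hcof, ← eq_sub_iff_add_eq] at h
    rw [h]
    ring
  have hdvd := X_pow_dvd_restrictLine (generic i) hp
  rw [← hφ, hp', show S.card = S.card - 1 + 1 by lia, pow_succ, Nat.add_sub_cancel,
    mul_dvd_mul_iff_left (pow_ne_zero _ Polynomial.X_ne_zero), Polynomial.X_dvd_iff,
    Polynomial.coeff_zero_eq_eval_zero, Polynomial.eval_mul, mul_eq_zero, or_iff_right hK,
    Polynomial.eval_sub, sub_eq_zero, hφ, eval_zero_restrictLine, eval_lin,
    Polynomial.eval_finsetSum] at hdvd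
  rw [hdvd, dotProduct]
  refine Finset.sum_congr rfl fun k _ => ?_
  rw [Polynomial.eval_mul, eval_zero_restrictLine, Polynomial.eval_C, mul_comm]

end Points

section Rigidity

/-- Infinitesimal motions of the arrangement preserving its multiple points come from linear
changes of coordinates and rescalings of the factors. -/
lemma exists_eq_smul_add_vecMul {b : Fin 8 → Fin 4 → ℚ}
    (h : ∀ (v : Fin 4 → ℚ) (S : Finset (Fin 8)), v ≠ 0 → (∀ i, c i ⬝ᵥ v = 0 ↔ i ∈ S) →
      3 ≤ S.card → ∃ w, ∀ i ∈ S, b i ⬝ᵥ v = c i ⬝ᵥ w) :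
    ∃ (r : Fin 8 → ℚ) (A : Matrix (Fin 4) (Fin 4) ℚ), ∀ i, b i = r i • c i + c i ᵥ* A := by
  obtain ⟨w₁, h₁⟩ := h ![0, 0, 0, 1] {0, 1, 2, 3, 5} (by simp)
    (by simp [Fin.forall_fin_succ, c, dotProduct, Fin.sum_univ_four]) (by decide)
  obtain ⟨w₂, h₂⟩ := h ![0, 0, 1, 0] {0, 1, 2, 4, 6} (by simp)
    (by simp [Fin.forall_fin_succ, c, dotProduct, Fin.sum_univ_four]) (by decide)
  obtain ⟨w₃, h₃⟩ := h ![1, 1, 1, 1] {2, 3, 4, 5, 6} (by simp)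
    (by simp [Fin.forall_fin_succ, c, dotProduct, Fin.sum_univ_four]; norm_num) (by decide)
  obtain ⟨w₄, h₄⟩ := h ![0, 1, 1, 1] {0, 5, 6, 7} (by simp)
    (by simp [Fin.forall_fin_succ, c, dotProduct, Fin.sum_univ_four]; norm_num) (by decide)
  obtain ⟨w₅, h₅⟩ := h ![1, 0, 1, 0] {1, 3, 6, 7} (by simp)
    (by simp [Fin.forall_fin_succ, c, dotProduct, Fin.sum_univ_four]) (by decide)
  obtain ⟨w₆, h₆⟩ := h ![1, 0, 0, 1] {1, 4, 5, 7} (by simp)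
    (by simp [Fin.forall_fin_succ, c, dotProduct, Fin.sum_univ_four]) (by decide)
  simp [c, dotProduct, Fin.sum_univ_four] at h₁ h₂ h₃ h₄ h₅ h₆
  obtain ⟨h₁₀, h₁₁, h₁₂, h₁₃, h₁₅⟩ := h₁
  obtain ⟨h₂₀, h₂₁, h₂₂, h₂₄, h₂₆⟩ := h₂
  obtain ⟨h₃₂, h₃₃, h₃₄, h₃₅, h₃₆⟩ := h₃
  obtain ⟨h₄₀, h₄₅, h₄₆, h₄₇⟩ := h₄
  obtain ⟨h₅₁, h₅₃, h₅₆, h₅₇⟩ := h₅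
  obtain ⟨h₆₁, h₆₄, h₆₅, h₆₇⟩ := h₆
  refine ⟨![0, b 1 0 + b 1 1 + b 2 0 + b 2 1 - b 0 0 - b 0 1, b 1 0 + b 2 0 - b 0 0,
      b 1 0 + b 3 0 - b 0 0 - b 5 0, b 1 0 + b 4 0 - b 0 0 - b 6 0,
      b 1 0 + b 2 0 + b 2 1 + b 5 1 - b 0 0 - b 3 1,
      b 1 0 + b 2 0 + b 2 1 + b 6 1 - b 0 0 - b 4 1, b 7 0 - b 0 0 - b 5 0 - b 6 0],
    !![b 0 0, b 0 1, b 0 2, b 0 3;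
      b 1 0, b 0 0 + b 0 1 - b 1 0 - b 2 0 - b 2 1, b 1 2, b 1 3;
      b 1 0 - b 5 0, b 0 1 - b 3 1, b 0 0 + b 0 2 - b 1 0 - b 3 0 - b 3 2 + b 5 0, b 0 3 - b 3 3;
      b 1 0 - b 6 0, b 0 1 - b 4 1, b 0 2 - b 4 2, b 0 0 + b 0 3 - b 1 0 - b 4 0 - b 4 3 + b 6 0],
    fun i => ?_⟩
  ext l
  fin_cases i <;> fin_cases l <;> simp [c] <;> linarith

lemma sum_lin_mul_cofactor_mem_Jf (r : Fin 8 → ℚ) (A : Matrix (Fin 4) (Fin 4) ℚ) :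
    ∑ i, lin (r i • c i + c i ᵥ* A) * cofactor i ∈ Jf := by
  have hd (k : Fin 4) : pderiv k f ∈ Jf :=
    mem_Jf_iff.2 ⟨Pi.single k 1, by simp [Pi.single_apply]⟩
  have hf : f ∈ Jf := by
    have h8 : C 8 * f = ∑ k, X k * pderiv k f := by
      simp only [pderiv_f, Finset.mul_sum]
      rw [Finset.sum_comm]
      have h (i : Fin 8) : ∑ k, X k * (C (c i k) * cofactor i) = f := by
        rw [← lin_mul_cofactor i, lin, Finset.sum_mul]
        exact Finset.sum_congr rfl fun k _ => by ring
      have hC : (C 8 : R) = 8 := map_ofNat C 8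
      simp [h, hC]
    have h : f = C 8⁻¹ * (C 8 * f) := by
      rw [← mul_assoc, ← C_mul]
      norm_num
    rw [h, h8]
    exact Ideal.mul_mem_left _ _ (Ideal.sum_mem _ fun k _ => Ideal.mul_mem_left _ _ (hd k))
  have hA : ∑ i, lin (c i ᵥ* A) * cofactor i = ∑ k, lin (A k) * pderiv k f := by
    simp only [pderiv_f, Finset.mul_sum]
    rw [Finset.sum_comm]
    refine Finset.sum_congr rfl fun i _ => ?_
    rw [vecMul_eq_sum, lin_sum, Finset.sum_mul]
    refine Finset.sum_congr rfl fun k _ => ?_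
    rw [lin_smul]
    ring
  simp only [lin_add, add_mul, Finset.sum_add_distrib, lin_smul, mul_assoc, lin_mul_cofactor]
  rw [hA]
  exact add_mem (Ideal.sum_mem _ fun i _ => Ideal.mul_mem_left _ _ hf)
    (Ideal.sum_mem _ fun k _ => Ideal.mul_mem_left _ _ (hd k))

lemma Jf_le_Ieq : Jf ≤ Ieq :=
  le_inf (le_iInf fun _ => le_iInf fun _ => le_iInf fun _ => le_sup_right)
    (le_iInf fun _ => le_iInf fun _ => le_iInf fun _ => le_sup_right)

end Rigidity

/-- The degree-8 homogeneous components of `I_eq` and of `Jf` coincide;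
equivalently `dim_ℚ (I_eq/Jf)^(8) = 0`: arrangement no. 6 admits no
nontrivial equisingular deformations, and the associated double octic
Calabi–Yau threefold is rigid. -/
theorem arrangement6_rigid :
    Submodule.restrictScalars ℚ Ieq ⊓ homogeneousSubmodule (Fin 4) ℚ 8 =
    Submodule.restrictScalars ℚ Jf ⊓ homogeneousSubmodule (Fin 4) ℚ 8 := by
  ext g
  refine ⟨fun ⟨hg, h8⟩ => ⟨?_, h8⟩, fun ⟨hg, h8⟩ => ⟨Jf_le_Ieq hg, h8⟩⟩
  have hg' : g ∈ Ieq := hg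
  obtain ⟨b, rfl⟩ := exists_eq_sum_lin_mul_cofactor hg' h8
  obtain ⟨r, A, hb⟩ := exists_eq_smul_add_vecMul fun v S hv => exists_dotProduct_eq hg' hv S
  simp only [hb]
  exact sum_lin_mul_cofactor_mem_Jf r A

end Octic6
end
end

section
/- Let f = xyzt(x+y)(x+z)(x+y+z+t)(y−z−t) ∈ ℚ[x,y,z,t] (arrangement no. 23) and let Jf and I_eq be its Jacobian ideal and equisingular ideal. Then the degree-8 homogeneous component of I_eq equals the degree-8 homogeneous component of Jf; equivalently, dim_ℚ (I_eq/Jf)^(8) = 0, i.e., the octic arrangement no. 23 admits no nontrivial equisingular deformations and the associated double octic Calabi–Yau threefold is rigid. -/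
/-!
Rigidity of the double octic of arrangement no. 23:
for `f = xyzt(x+y)(x+z)(x+y+z+t)(y−z−t)` the degree-8 homogeneous
component of the equisingular ideal `I_eq` equals that of the Jacobian ideal
`Jf`, i.e. `dim_ℚ (I_eq/Jf)^(8) = 0`.
-/

noncomputable section

open Matrix MvPolynomial

namespace Octic23

/-- `R = ℚ[x,y,z,t]` -/
abbrev R : Type := MvPolynomial (Fin 4) ℚ

/-- The linear polynomial with coefficient vector `a`. -/
def lin (a : Fin 4 → ℚ) : R := ∑ j, C (a j) * X j

/-- Coefficient vectors of the eight planes `x, y, z, t, x+y, x+z, x+y+z+t, y−z−t`. -/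
def c : Fin 8 → Fin 4 → ℚ :=
  ![![1,0,0,0], ![0,1,0,0], ![0,0,1,0], ![0,0,0,1],
    ![1,1,0,0], ![1,0,1,0], ![1,1,1,1], ![0,1,-1,-1]]

/-- The octic `f = xyzt(x+y)(x+z)(x+y+z+t)(y−z−t)`. -/
def f : R := ∏ i, lin (c i)

/-- The Jacobian ideal of `f`. -/
def Jf : Ideal R :=
  Ideal.span {pderiv 0 f, pderiv 1 f, pderiv 2 f, pderiv 3 f}

/-- `m(P)`: the number of the eight planes through the point `v`. -/
def m (v : Fin 4 → ℚ) : ℕ := {i : Fin 8 | c i ⬝ᵥ v = 0}.ncard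

/-- `m(ℓᵢ,ℓⱼ)`: the number of the eight factors lying in the pencil spanned by
`ℓᵢ` and `ℓⱼ` (the multiplicity of `f` along the line `ℓᵢ = ℓⱼ = 0`). -/
def mLine (i j : Fin 8) : ℕ :=
  {k : Fin 8 | c k ∈ Submodule.span ℚ ({c i, c j} : Set (Fin 4 → ℚ))}.ncard

/-- `I_P`: the ideal of the point `v`, generated by all linear forms
vanishing at `v`. -/
def IP (v : Fin 4 → ℚ) : Ideal R :=
  Ideal.span (lin '' {a : Fin 4 → ℚ | a ⬝ᵥ v = 0})

/-- The equisingular ideal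
`I_eq = ⋂ ((ℓ,ℓ′)^{m(ℓ,ℓ′)} + Jf) ∩ ⋂ (I_P^{m(P)} + Jf)`, the first
intersection over all pairs of linearly independent factors, the second over
all points of `ℙ³(ℚ)` lying on at least three of the eight planes. -/
def Ieq : Ideal R :=
  (⨅ (i : Fin 8) (j : Fin 8) (_ : LinearIndependent ℚ ![c i, c j]),
      (Ideal.span {lin (c i), lin (c j)} ^ mLine i j + Jf)) ⊓
  (⨅ (v : Fin 4 → ℚ) (_ : v ≠ 0) (_ : 3 ≤ m v), (IP v ^ m v + Jf))

/-! ### Linear forms -/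

theorem lin_add (a b : Fin 4 → ℚ) : lin (a + b) = lin a + lin b := by
  simp [lin, add_mul, Finset.sum_add_distrib]

theorem lin_smul (s : ℚ) (a : Fin 4 → ℚ) : lin (s • a) = C s * lin a := by
  simp [lin, Finset.mul_sum, mul_assoc]

theorem lin_neg (a : Fin 4 → ℚ) : lin (-a) = -lin a := by
  simp [lin]

theorem lin_sum {ι : Type*} (s : Finset ι) (a : ι → Fin 4 → ℚ) :
    lin (∑ k ∈ s, a k) = ∑ k ∈ s, lin (a k) := by
  simp only [lin, Finset.sum_apply, map_sum, Finset.sum_mul]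
  exact Finset.sum_comm

theorem lin_isHomogeneous (a : Fin 4 → ℚ) : (lin a).IsHomogeneous 1 :=
  IsHomogeneous.sum _ _ _ fun j _ => (isHomogeneous_X ℚ j).C_mul (a j)

@[simp] theorem coeff_lin (a : Fin 4 → ℚ) (j : Fin 4) :
    coeff (Finsupp.single j 1) (lin a) = a j := by
  simp [lin, coeff_sum, coeff_C_mul, coeff_X, Finsupp.single_left_inj]

@[simp] theorem pderiv_lin (a : Fin 4 → ℚ) (j : Fin 4) : pderiv j (lin a) = C (a j) := by
  simp [lin, pderiv_X, Pi.single_apply]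

theorem eval_lin (a v : Fin 4 → ℚ) : eval v (lin a) = a ⬝ᵥ v := by
  simp [lin, dotProduct]

theorem exists_eq_lin {p : R} (hp : p.IsHomogeneous 1) : ∃ a, p = lin a := by
  have h : p ∈ homogeneousSubmodule (Fin 4) ℚ 1 := hp
  rw [homogeneousSubmodule_one_eq_span_X, Submodule.mem_span_range_iff_exists_fun] at h
  obtain ⟨a, rfl⟩ := h
  exact ⟨a, by simp [lin, smul_eq_C_mul]⟩

theorem irreducible_lin {a : Fin 4 → ℚ} (ha : a ≠ 0) : Irreducible (lin a) := by
  obtain ⟨j, hj⟩ := Function.ne_iff.mp ha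
  have h0 : lin a ≠ 0 := fun h => hj (by simpa using congr(coeff (Finsupp.single j 1) $h))
  refine irreducible_of_totalDegree_eq_one ((lin_isHomogeneous a).totalDegree h0) fun x hx => ?_
  have := hx (Finsupp.single j 1)
  rw [coeff_lin] at this
  exact isUnit_of_dvd_unit this (isUnit_iff_ne_zero.mpr hj)

/-- Linear forms with a nonzero `2 × 2` minor are relatively prime. -/
theorem isRelPrime_lin {a b : Fin 4 → ℚ} (h : ∃ p q, a p * b q ≠ a q * b p) :
    IsRelPrime (lin a) (lin b) := by
  obtain ⟨p, q, h⟩ := h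
  have ha : a ≠ 0 := by rintro rfl; simp at h
  rw [(irreducible_lin ha).isRelPrime_iff_not_dvd]
  rintro ⟨u, hu⟩
  have key := congr(eval (a p • Pi.single q 1 - a q • Pi.single p 1) $hu)
  simp only [map_mul, eval_lin, dotProduct_sub, dotProduct_smul, dotProduct_single,
    smul_eq_mul, mul_one] at key
  apply h
  linear_combination key

theorem linearIndependent_pair_of_minor {a b : Fin 4 → ℚ} (h : ∃ p q, a p * b q ≠ a q * b p) :
    LinearIndependent ℚ ![a, b] := by
  obtain ⟨p, q, h⟩ := h
  rw [LinearIndependent.pair_iff]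
  intro s t hst
  have hp := congr_fun hst p
  have hq := congr_fun hst q
  simp only [Pi.add_apply, Pi.smul_apply, smul_eq_mul, Pi.zero_apply] at hp hq
  have h' : a p * b q - a q * b p ≠ 0 := sub_ne_zero.mpr h
  constructor
  · refine (mul_eq_zero.mp ?_).resolve_right h'
    linear_combination b q * hp - b p * hq
  · refine (mul_eq_zero.mp ?_).resolve_right h'
    linear_combination a p * hq - a q * hp

theorem c_minor : ∀ i j : Fin 8, i ≠ j → ∃ p q, c i p * c j q ≠ c i q * c j p := by
  decide +kernel

/-! ### The Jacobian ideal -/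

/-- The product of the linear factors of `f` other than the `k`-th one. -/
def cofactor (k : Fin 8) : R := ∏ i ∈ Finset.univ.erase k, lin (c i)

theorem lin_mul_cofactor (k : Fin 8) : lin (c k) * cofactor k = f :=
  Finset.mul_prod_erase _ _ (Finset.mem_univ k)

theorem cofactor_isHomogeneous (k : Fin 8) : (cofactor k).IsHomogeneous 7 := by
  have h := IsHomogeneous.prod (Finset.univ.erase k) (fun i => lin (c i)) (fun _ => 1)
    fun i _ => lin_isHomogeneous (c i)
  simpa [cofactor] using h

theorem derivation_prod {ι A M : Type*} [DecidableEq ι] [CommRing A] [AddCommGroup M]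
    [Algebra ℚ A] [Module A M] [Module ℚ M] (D : Derivation ℚ A M) (s : Finset ι) (u : ι → A) :
    D (∏ i ∈ s, u i) = ∑ k ∈ s, (∏ i ∈ s.erase k, u i) • D (u k) := by
  induction s using Finset.induction_on with
  | empty => simp
  | insert a s ha ih =>
    rw [Finset.prod_insert ha, D.leibniz, ih, Finset.sum_insert ha, Finset.erase_insert ha,
      Finset.smul_sum, add_comm]
    congr 1
    refine Finset.sum_congr rfl fun k hk => ?_
    have hak : a ≠ k := by rintro rfl; exact ha hk
    rw [Finset.erase_insert_of_ne hak, Finset.prod_insert (by simp [ha]), mul_smul]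

theorem pderiv_f (j : Fin 4) : pderiv j f = ∑ k, C (c k j) * cofactor k := by
  rw [f, derivation_prod]
  exact Finset.sum_congr rfl fun k _ => by rw [pderiv_lin, smul_eq_mul, mul_comm]; rfl

/-- The value on the `k`-th linear factor of the derivation with coefficients `h`. -/
def fieldOn (h : Fin 4 → R) (k : Fin 8) : R := ∑ j, C (c k j) * h j

theorem mem_Jf_iff {g : R} : g ∈ Jf ↔ ∃ h, g = ∑ k, fieldOn h k * cofactor k := by
  have hJ : Jf = Ideal.span (Set.range fun j => pderiv j f) := by
    rw [Jf]
    congr 1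
    ext u
    simp [Fin.exists_fin_succ, eq_comm]
  rw [hJ, Ideal.mem_span_range_iff_exists_fun]
  refine exists_congr fun h => ?_
  rw [eq_comm]
  have : ∑ j, h j * pderiv j f = ∑ k, fieldOn h k * cofactor k := by
    simp only [pderiv_f, fieldOn, Finset.mul_sum, Finset.sum_mul]
    rw [Finset.sum_comm]
    exact Finset.sum_congr rfl fun k _ => Finset.sum_congr rfl fun j _ => by ring
  rw [this]

theorem f_mem_Jf : f ∈ Jf := by
  refine mem_Jf_iff.mpr ⟨fun j => C (1 / 8) * X j, ?_⟩
  have h : ∀ k, fieldOn (fun j => C (1 / 8) * X j) k * cofactor k = C (1 / 8) * f := by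
    intro k
    rw [← lin_mul_cofactor k, fieldOn, lin, Finset.sum_mul, Finset.sum_mul, Finset.mul_sum]
    exact Finset.sum_congr rfl fun j _ => by ring
  rw [Finset.sum_congr rfl fun k _ => h k, Finset.sum_const, Finset.card_univ, Fintype.card_fin,
    nsmul_eq_mul, ← mul_assoc, ← map_natCast (C : ℚ →+* R), ← map_mul]
  norm_num

/-! ### Restriction to the planes -/

/-- Vectors dual to the eight forms: `c i ⬝ᵥ dualVec i = 1`. -/
def dualVec : Fin 8 → Fin 4 → ℚ :=
  ![![1,0,0,0], ![0,1,0,0], ![0,0,1,0], ![0,0,0,1],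
    ![1,0,0,0], ![1,0,0,0], ![0,0,0,1], ![0,0,0,-1]]

/-- The projection of the `j`-th form to a complement of the `i`-th one. -/
def restr (i j : Fin 8) : Fin 4 → ℚ := c j - (c j ⬝ᵥ dualVec i) • c i

/-- Restriction to the `i`-th plane, realized as a retraction of `R`. -/
def toPlane (i : Fin 8) : R →ₐ[ℚ] R :=
  aeval fun j => X j - C (dualVec i j) * lin (c i)

theorem toPlane_lin (i j : Fin 8) : toPlane i (lin (c j)) = lin (restr i j) := by
  rw [restr, sub_eq_add_neg, lin_add, lin_neg, lin_smul]
  have hX : ∀ l, toPlane i (X l) = X l - C (dualVec i l) * lin (c i) := fun l => aeval_X _ _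
  have hj : lin (c j) = ∑ l, C (c j l) * X l := rfl
  rw [← sub_eq_add_neg]
  simp only [hj, map_sum, map_mul, hX, dotProduct, algHom_C, algebraMap_eq, mul_sub,
    Finset.sum_sub_distrib, Finset.sum_mul, mul_assoc]

theorem restr_self : ∀ i, restr i i = 0 := by decide +kernel

theorem toPlane_self (i : Fin 8) : toPlane i (lin (c i)) = 0 := by
  rw [toPlane_lin, restr_self]
  simp [lin]

theorem toPlane_toPlane (i : Fin 8) (g : R) : toPlane i (toPlane i g) = toPlane i g := by
  suffices h : (toPlane i).comp (toPlane i) = toPlane i from congr($h g)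
  ext j : 1
  have hX : toPlane i (X j) = X j - C (dualVec i j) * lin (c i) := aeval_X _ _
  rw [AlgHom.comp_apply, hX, map_sub, map_mul, toPlane_self, mul_zero, sub_zero, hX]

theorem dvd_of_toPlane_eq_zero {i : Fin 8} {g : R} (h : toPlane i g = 0) : lin (c i) ∣ g := by
  rw [← Ideal.mem_span_singleton, ← Ideal.Quotient.eq_zero_iff_mem]
  have hq : (Ideal.Quotient.mkₐ ℚ (Ideal.span {lin (c i)})).comp (toPlane i) =
      Ideal.Quotient.mkₐ ℚ (Ideal.span {lin (c i)}) := by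
    ext j : 1
    have hX : toPlane i (X j) = X j - C (dualVec i j) * lin (c i) := aeval_X _ _
    rw [AlgHom.comp_apply, hX, Ideal.Quotient.mkₐ_eq_mk, Ideal.Quotient.mk_eq_mk_iff_sub_mem,
      sub_sub_cancel_left, neg_mem_iff, Ideal.mem_span_singleton]
    exact dvd_mul_left _ _
  have := congr($hq g)
  rw [AlgHom.comp_apply, h, map_zero] at this
  exact this.symm

theorem toPlane_cofactor_of_ne {i k : Fin 8} (h : i ≠ k) : toPlane i (cofactor k) = 0 := by
  rw [cofactor, map_prod]
  exact Finset.prod_eq_zero (Finset.mem_erase.mpr ⟨h, Finset.mem_univ i⟩) (toPlane_self i)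

theorem toPlane_sum_cofactor (i : Fin 8) (q : Fin 8 → R) :
    toPlane i (∑ k, q k * cofactor k) = toPlane i (q i) * toPlane i (cofactor i) := by
  rw [map_sum, Finset.sum_eq_single i, map_mul]
  · intro k _ hk
    rw [map_mul, toPlane_cofactor_of_ne hk.symm, mul_zero]
  · simp

/-- A chosen form having the same trace on the `i`-th plane as the `j`-th form. -/
def rep (i j : Fin 8) : Fin 8 :=
  if (i = 0 ∧ j = 4) then 1
  else if (i = 0 ∧ j = 5) then 2
  else if (i = 1 ∧ j = 4) ∨ (i = 4 ∧ j = 1) ∨ (i = 2 ∧ j = 5) ∨ (i = 5 ∧ j = 2) then 0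
  else j

theorem restr_rep : ∀ i j, restr i (rep i j) = restr i j ∨ restr i (rep i j) = -restr i j := by
  decide +kernel

theorem rep_ne : ∀ i j : Fin 8, j ≠ i → rep i j ≠ i := by decide +kernel

theorem restr_rep_minor : ∀ i j k : Fin 8, j ≠ i → k ≠ i → rep i j ≠ rep i k →
    ∃ p q, restr i (rep i j) p * restr i (rep i k) q ≠
      restr i (rep i j) q * restr i (rep i k) p := by
  decide +kernel

/-- The forms other than the `i`-th one whose chosen representative is the `k`-th form. -/
def repFiber (i k : Fin 8) : Finset (Fin 8) := {j ∈ Finset.univ.erase i | rep i j = k}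

theorem card_repFiber_lt_mLine (i k : Fin 8) : (repFiber i k).card < mLine i k := by
  have hi : i ∉ repFiber i k := by simp [repFiber]
  have hsub : ((insert i (repFiber i k) : Finset (Fin 8)) : Set (Fin 8)) ⊆
      {j | c j ∈ Submodule.span ℚ ({c i, c k} : Set (Fin 4 → ℚ))} := by
    intro j hj
    simp only [Finset.coe_insert, Set.mem_insert_iff, Finset.mem_coe, repFiber,
      Finset.mem_filter] at hj
    have hci : c i ∈ Submodule.span ℚ ({c i, c k} : Set (Fin 4 → ℚ)) :=
      Submodule.subset_span (by simp)
    have hck : c k ∈ Submodule.span ℚ ({c i, c k} : Set (Fin 4 → ℚ)) :=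
      Submodule.subset_span (by simp)
    obtain rfl | ⟨-, rfl⟩ := hj
    · exact hci
    · have hr : restr i (rep i j) ∈
          Submodule.span ℚ ({c i, c (rep i j)} : Set (Fin 4 → ℚ)) :=
        sub_mem hck (Submodule.smul_mem _ _ hci)
      have hj' : restr i j ∈ Submodule.span ℚ ({c i, c (rep i j)} : Set (Fin 4 → ℚ)) := by
        obtain h | h := restr_rep i j
        · rwa [h] at hr
        · rwa [h, neg_mem_iff] at hr
      have : c j = restr i j + (c j ⬝ᵥ dualVec i) • c i := by simp [restr]
      rw [Set.mem_ofPred_eq, this]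
      exact add_mem hj' (Submodule.smul_mem _ _ hci)
  have := Set.ncard_le_ncard hsub (Set.toFinite _)
  rwa [Set.ncard_coe_finset, Finset.card_insert_of_notMem hi] at this

theorem toPlane_cofactor_dvd (i : Fin 8) :
    toPlane i (cofactor i) ∣ ∏ k, lin (restr i k) ^ (repFiber i k).card := by
  have h : ∏ k, lin (restr i k) ^ (repFiber i k).card =
      ∏ j ∈ Finset.univ.erase i, lin (restr i (rep i j)) := by
    rw [← Finset.prod_fiberwise' _ (rep i) fun k => lin (restr i k)]
    exact Finset.prod_congr rfl fun k _ => by rw [Finset.prod_const]; rfl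
  rw [h, cofactor, map_prod]
  refine Finset.prod_dvd_prod_of_dvd _ _ fun j _ => ?_
  rw [toPlane_lin]
  obtain h | h := restr_rep i j
  · rw [h]
  · rw [h, lin_neg, dvd_neg]

theorem dvd_toPlane_cofactor (i k : Fin 8) :
    lin (restr i k) ^ (repFiber i k).card ∣ toPlane i (cofactor i) := by
  have h : ∏ j ∈ repFiber i k, toPlane i (lin (c j)) ∣ toPlane i (cofactor i) := by
    rw [cofactor, map_prod]
    exact Finset.prod_dvd_prod_of_subset _ _ _ (Finset.filter_subset _ _)
  refine dvd_trans ?_ h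
  rw [← Finset.prod_const]
  refine Finset.prod_dvd_prod_of_dvd _ _ fun j hj => ?_
  obtain rfl : rep i j = k := (Finset.mem_filter.mp hj).2
  rw [toPlane_lin]
  obtain h | h := restr_rep i j
  · rw [h]
  · rw [h, lin_neg, neg_dvd]

theorem toPlane_dvd_of_mem {i k : Fin 8} {g : R}
    (hg : g ∈ Ideal.span {lin (c i), lin (c k)} ^ mLine i k + Jf) :
    lin (restr i k) ^ (repFiber i k).card ∣ toPlane i g := by
  obtain ⟨u, hu, v, hv, rfl⟩ := Submodule.mem_sup.mp hg
  obtain ⟨h, rfl⟩ := mem_Jf_iff.mp hv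
  rw [map_add, toPlane_sum_cofactor]
  refine dvd_add ?_ (dvd_mul_of_dvd_right (dvd_toPlane_cofactor i k) _)
  refine (pow_dvd_pow _ (card_repFiber_lt_mLine i k).le).trans ?_
  have hu' := Ideal.mem_map_of_mem (toPlane i) hu
  rw [Ideal.map_pow, Ideal.map_span, Set.image_pair, toPlane_self, toPlane_lin,
    Ideal.span_insert_zero, Ideal.span_singleton_pow] at hu'
  exact Ideal.mem_span_singleton.mp hu'

theorem toPlane_cofactor_dvd_of_mem {g : R}
    (hg : ∀ i j : Fin 8, i ≠ j → g ∈ Ideal.span {lin (c i), lin (c j)} ^ mLine i j + Jf)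
    (i : Fin 8) : toPlane i (cofactor i) ∣ toPlane i g := by
  refine (toPlane_cofactor_dvd i).trans (Fintype.prod_dvd_of_isRelPrime ?_ fun k => ?_)
  · intro k l hkl
    obtain hk | ⟨j, hj⟩ := (repFiber i k).eq_empty_or_nonempty
    · simp [Function.onFun, hk, isRelPrime_one_left]
    obtain hl | ⟨j', hj'⟩ := (repFiber i l).eq_empty_or_nonempty
    · simp [Function.onFun, hl, isRelPrime_one_right]
    simp only [repFiber, Finset.mem_filter, Finset.mem_erase] at hj hj'
    obtain ⟨⟨hj, -⟩, rfl⟩ := hj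
    obtain ⟨⟨hj', -⟩, rfl⟩ := hj'
    exact (isRelPrime_lin (restr_rep_minor i j j' hj hj' hkl)).pow
  · by_cases hik : i = k
    · subst hik
      have : repFiber i i = ∅ := Finset.filter_eq_empty_iff.mpr fun j hj =>
        rep_ne i j (Finset.ne_of_mem_erase hj)
      simp [this]
    · exact toPlane_dvd_of_mem (hg i k hik)

theorem exists_eq_sum_cofactor {g : R}
    (hg : ∀ i, toPlane i (cofactor i) ∣ toPlane i g) :
    ∃ q : Fin 8 → R, g = ∑ k, q k * cofactor k := by
  choose q hq using hg
  have hdvd : f ∣ g - ∑ k, q k * cofactor k := by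
    refine Fintype.prod_dvd_of_isRelPrime (fun i j hij => isRelPrime_lin (c_minor i j hij))
      fun i => dvd_of_toPlane_eq_zero ?_
    have h := congr(toPlane i $(hq i))
    rw [toPlane_toPlane, map_mul, toPlane_toPlane] at h
    rw [map_sub, toPlane_sum_cofactor, h]
    ring
  obtain ⟨u, hu⟩ := hdvd
  refine ⟨q + Pi.single 0 (u * lin (c 0)), ?_⟩
  have h0 : ∑ k, (Pi.single 0 (u * lin (c 0)) : Fin 8 → R) k * cofactor k = u * f := by
    rw [Finset.sum_eq_single 0, Pi.single_eq_same, mul_assoc, lin_mul_cofactor]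
    · intro k _ hk
      simp [hk]
    · simp
  simp only [Pi.add_apply, add_mul, Finset.sum_add_distrib, h0]
  linear_combination hu

attribute [local instance] gradedAlgebra in
theorem homogeneousComponent_mul_of_right {p q : R} {n k N : ℕ} (hq : q.IsHomogeneous n)
    (hN : k + n = N) : homogeneousComponent N (p * q) = homogeneousComponent k p * q := by
  subst hN
  rw [← decomposition.decompose'_apply, ← decomposition.decompose'_apply]
  exact DirectSum.coe_decompose_mul_add_of_right_mem (homogeneousSubmodule (Fin 4) ℚ) hq

theorem exists_eq_sum_lin_cofactor {g : R} (h8 : g.IsHomogeneous 8)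
    (hg : ∃ q : Fin 8 → R, g = ∑ k, q k * cofactor k) :
    ∃ b : Fin 8 → Fin 4 → ℚ, g = ∑ k, lin (b k) * cofactor k := by
  obtain ⟨q, hq⟩ := hg
  choose b hb using fun k => exists_eq_lin (homogeneousComponent_isHomogeneous 1 (q k))
  refine ⟨b, ?_⟩
  rw [← homogeneousComponent_eq_self h8, hq, map_sum]
  refine Finset.sum_congr rfl fun k _ => ?_
  rw [← hb]
  exact homogeneousComponent_mul_of_right (cofactor_isHomogeneous k) rfl

/-! ### Conditions at the points -/

/-- Directions lying in exactly one of the eight planes. -/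
def planeVec : Fin 8 → Fin 4 → ℚ :=
  ![![0,1,1,1], ![1,0,1,1], ![1,1,0,-1], ![1,1,2,0],
    ![1,-1,1,1], ![1,1,-1,1],
    ![-3,1,1,1], ![1,2,1,1]]

theorem c_dotProduct_planeVec : ∀ i j, c j ⬝ᵥ planeVec i = 0 ↔ j = i := by decide +kernel

/-- Restriction to the line through `v` with direction `w`. -/
def toLine (v w : Fin 4 → ℚ) : R →ₐ[ℚ] Polynomial ℚ :=
  aeval fun j => Polynomial.C (v j) + Polynomial.C (w j) * Polynomial.X

theorem toLine_lin (v w a : Fin 4 → ℚ) :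
    toLine v w (lin a) = Polynomial.C (a ⬝ᵥ v) + Polynomial.C (a ⬝ᵥ w) * Polynomial.X := by
  simp only [toLine, lin, map_sum, map_mul, aeval_X, algHom_C, dotProduct, mul_add, Finset.sum_mul,
    Finset.sum_add_distrib, mul_assoc]
  rfl

theorem eval_zero_toLine (v w : Fin 4 → ℚ) (p : R) : (toLine v w p).eval 0 = eval v p := by
  have h : (Polynomial.aeval (0 : ℚ)).comp (toLine v w) = aeval v := by
    ext j
    simp [toLine]
  simpa [Polynomial.aeval_def, aeval_def, eval₂_id, Polynomial.eval₂_id] using congr($h p)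

theorem X_pow_dvd_toLine {v w : Fin 4 → ℚ} {p : R} {n : ℕ} (hp : p ∈ IP v ^ n) :
    Polynomial.X ^ n ∣ toLine v w p := by
  have h : (IP v).map (toLine v w) ≤ Ideal.span {Polynomial.X} := by
    rw [IP, Ideal.map_span, Ideal.span_le]
    rintro _ ⟨_, ⟨a, ha, rfl⟩, rfl⟩
    rw [SetLike.mem_coe, Ideal.mem_span_singleton, toLine_lin, show a ⬝ᵥ v = 0 from ha, map_zero,
      zero_add]
    exact dvd_mul_left _ _
  rw [← Ideal.mem_span_singleton, ← Ideal.span_singleton_pow]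
  refine Ideal.pow_right_mono h n ?_
  rw [← Ideal.map_pow]
  exact Ideal.mem_map_of_mem _ hp

theorem toLine_cofactor {v : Fin 4 → ℚ} {i : Fin 8} (hv : c i ⬝ᵥ v = 0) :
    ∃ U : Polynomial ℚ, U.eval 0 ≠ 0 ∧
      toLine v (planeVec i) (cofactor i) * Polynomial.X = Polynomial.X ^ m v * U := by
  classical
  set T : Finset (Fin 8) := {j ∈ Finset.univ.erase i | c j ⬝ᵥ v = 0} with hT
  have hm : m v = T.card + 1 := by
    have h : {j : Fin 8 | c j ⬝ᵥ v = 0} = ((insert i T : Finset (Fin 8)) : Set (Fin 8)) := by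
      ext j
      by_cases hj : j = i <;> simp [hT, hj, hv]
    rw [m, h, Set.ncard_coe_finset, Finset.card_insert_of_notMem (by simp [hT])]
  have hw : ∀ j ∈ Finset.univ.erase i, c j ⬝ᵥ planeVec i ≠ 0 := fun j hj =>
    (c_dotProduct_planeVec i j).not.mpr (Finset.ne_of_mem_erase hj)
  refine ⟨(∏ j ∈ T, Polynomial.C (c j ⬝ᵥ planeVec i)) *
    ∏ j ∈ Finset.univ.erase i with ¬ c j ⬝ᵥ v = 0, toLine v (planeVec i) (lin (c j)), ?_, ?_⟩
  · rw [Polynomial.eval_mul, Polynomial.eval_prod, Polynomial.eval_prod]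
    refine mul_ne_zero (Finset.prod_ne_zero_iff.mpr fun j hj => ?_)
      (Finset.prod_ne_zero_iff.mpr fun j hj => ?_)
    · rw [Polynomial.eval_C]
      exact hw j (Finset.mem_filter.mp hj).1
    · rw [eval_zero_toLine, eval_lin]
      exact (Finset.mem_filter.mp hj).2
  · have h1 : ∏ j ∈ T, toLine v (planeVec i) (lin (c j)) =
        (∏ j ∈ T, Polynomial.C (c j ⬝ᵥ planeVec i)) * Polynomial.X ^ T.card := by
      rw [← Finset.prod_const, ← Finset.prod_mul_distrib]
      refine Finset.prod_congr rfl fun j hj => ?_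
      rw [toLine_lin, (Finset.mem_filter.mp hj).2, map_zero, zero_add]
    rw [cofactor, map_prod, ← Finset.prod_filter_mul_prod_filter_not _ fun j => c j ⬝ᵥ v = 0, ← hT,
      h1, hm]
    ring

theorem eval_eq_zero_of_mem_IP_pow {v : Fin 4 → ℚ} {r : Fin 8 → R}
    (hr : ∑ k, r k * cofactor k ∈ IP v ^ m v) {i : Fin 8} (hv : c i ⬝ᵥ v = 0) :
    eval v (r i) = 0 := by
  obtain ⟨U, hU, hF⟩ := toLine_cofactor hv
  have hsum : toLine v (planeVec i) (∑ k, r k * cofactor k) =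
      toLine v (planeVec i) (r i) * toLine v (planeVec i) (cofactor i) := by
    rw [map_sum, Finset.sum_eq_single i, map_mul]
    · intro k _ hk
      rw [map_mul, cofactor, map_prod, Finset.prod_eq_zero
        (Finset.mem_erase.mpr ⟨hk.symm, Finset.mem_univ i⟩), mul_zero]
      rw [toLine_lin, hv, (c_dotProduct_planeVec i i).mpr rfl]
      simp
    · simp
  obtain ⟨s, hs⟩ := X_pow_dvd_toLine (w := planeVec i) hr
  rw [hsum] at hs
  have hX : (Polynomial.X : Polynomial ℚ) ^ m v ≠ 0 := pow_ne_zero _ Polynomial.X_ne_zero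
  have key : toLine v (planeVec i) (r i) * U = s * Polynomial.X := by
    apply mul_left_cancel₀ hX
    linear_combination Polynomial.X * hs - toLine v (planeVec i) (r i) * hF
  have h0 := congr(Polynomial.eval 0 $key)
  rw [Polynomial.eval_mul, Polynomial.eval_mul, Polynomial.eval_X, mul_zero,
    eval_zero_toLine] at h0
  exact (mul_eq_zero.mp h0).resolve_right hU

/-- Linear relations between the forms vanishing at `v` pass to the values at `v` of the
coefficients of an element of `IP v ^ m v + Jf`. -/
theorem sum_mul_dotProduct_eq_zero {v : Fin 4 → ℚ} {b : Fin 8 → Fin 4 → ℚ}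
    (hb : ∑ k, lin (b k) * cofactor k ∈ IP v ^ m v + Jf) (d : Fin 8 → ℚ)
    (hd : ∀ i, d i = 0 ∨ c i ⬝ᵥ v = 0) (hrel : ∑ i, d i • c i = 0) :
    ∑ i, d i * (b i ⬝ᵥ v) = 0 := by
  obtain ⟨u, hu, g, hg, hsum⟩ := Submodule.mem_sup.mp hb
  obtain ⟨h, rfl⟩ := mem_Jf_iff.mp hg
  have hr : ∑ k, (lin (b k) - fieldOn h k) * cofactor k ∈ IP v ^ m v := by
    simp only [sub_mul, Finset.sum_sub_distrib]
    rwa [← hsum, add_sub_cancel_right]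
  have hterm : ∀ i, d i * (b i ⬝ᵥ v) = d i * eval v (fieldOn h i) := by
    intro i
    obtain h0 | hv := hd i
    · simp [h0]
    · have := eval_eq_zero_of_mem_IP_pow hr hv
      rw [map_sub, eval_lin, sub_eq_zero] at this
      rw [this]
  rw [Finset.sum_congr rfl fun i _ => hterm i]
  have hj : ∀ j, ∑ i, d i * c i j = 0 := fun j => by simpa using congr_fun hrel j
  simp only [fieldOn, map_sum, map_mul, eval_C, Finset.mul_sum]
  rw [Finset.sum_comm]
  refine Finset.sum_eq_zero fun j _ => ?_
  simp only [← mul_assoc]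
  rw [← Finset.sum_mul, hj, zero_mul]

/-! ### Conclusion -/

/-- A first-order deformation of the eight forms that is induced by a linear vector field, up to
rescaling the forms, gives an element of the Jacobian ideal. -/
theorem sum_lin_mul_cofactor_mem_Jf {b : Fin 8 → Fin 4 → ℚ} (A : Fin 4 → Fin 4 → ℚ) (s : Fin 8 → ℚ)
    (hb : ∀ k, b k = ∑ j, c k j • A j + s k • c k) :
    ∑ k, lin (b k) * cofactor k ∈ Jf := by
  have h : ∑ k, lin (b k) * cofactor k =
      ∑ k, fieldOn (fun j => lin (A j)) k * cofactor k + ∑ k, C (s k) * f := by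
    rw [← Finset.sum_add_distrib]
    refine Finset.sum_congr rfl fun k _ => ?_
    rw [← lin_mul_cofactor k, hb, lin_add, lin_sum, lin_smul, fieldOn]
    simp only [lin_smul]
    ring
  rw [h]
  exact add_mem (mem_Jf_iff.mpr ⟨_, rfl⟩) (sum_mem fun k _ => Ideal.mul_mem_left _ _ f_mem_Jf)

theorem sum_lin_mul_cofactor_mem_Jf_of_points {b : Fin 8 → Fin 4 → ℚ}
    (hb : ∀ v, v ≠ 0 → 3 ≤ m v → ∑ k, lin (b k) * cofactor k ∈ IP v ^ m v + Jf) :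
    ∑ k, lin (b k) * cofactor k ∈ Jf := by
  have cond : ∀ (v : Fin 4 → ℚ) (d : Fin 8 → ℚ), v ≠ 0 →
      3 ≤ (Finset.univ.filter fun i => c i ⬝ᵥ v = 0).card →
      (∀ i, d i = 0 ∨ c i ⬝ᵥ v = 0) → ∑ i, d i • c i = 0 → ∑ i, d i * (b i ⬝ᵥ v) = 0 := by
    intro v d hv hcard hd hrel
    refine sum_mul_dotProduct_eq_zero (hb v hv ?_) d hd hrel
    rw [m, show {i | c i ⬝ᵥ v = 0} = ((Finset.univ.filter fun i => c i ⬝ᵥ v = 0 : Finset (Fin 8)) :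
      Set (Fin 8)) by simp, Set.ncard_coe_finset]
    exact hcard
  have h0 := cond ![0, 0, 0, 1] ![-1, -1, 0, 0, 1, 0, 0, 0]
    (by decide +kernel) (by decide +kernel) (by decide +kernel) (by decide +kernel)
  have h1 := cond ![0, 0, 0, 1] ![-1, 0, -1, 0, 0, 1, 0, 0]
    (by decide +kernel) (by decide +kernel) (by decide +kernel) (by decide +kernel)
  have h2 := cond ![0, 0, 1, -1] ![-1, -1, 0, 0, 1, 0, 0, 0]
    (by decide +kernel) (by decide +kernel) (by decide +kernel) (by decide +kernel)
  have h3 := cond ![0, 1, 0, -1] ![-1, 0, -1, 0, 0, 1, 0, 0]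
    (by decide +kernel) (by decide +kernel) (by decide +kernel) (by decide +kernel)
  have h4 := cond ![0, 0, 1, -1] ![-1, -2, 0, 0, 0, 0, 1, 1]
    (by decide +kernel) (by decide +kernel) (by decide +kernel) (by decide +kernel)
  have h5 := cond ![1, -1, -1, 0] ![0, 0, 0, 1, -1, 1, 0, 1]
    (by decide +kernel) (by decide +kernel) (by decide +kernel) (by decide +kernel)
  have h6 := cond ![1, -1, 0, 0] ![0, 0, -1, -1, -1, 0, 1, 0]
    (by decide +kernel) (by decide +kernel) (by decide +kernel) (by decide +kernel)
  have h7 := cond ![1, 0, -1, 0] ![0, -1, 0, -1, 0, -1, 1, 0]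
    (by decide +kernel) (by decide +kernel) (by decide +kernel) (by decide +kernel)
  have h8 := cond ![1, 0, 0, 0] ![0, -1, 1, 1, 0, 0, 0, 1]
    (by decide +kernel) (by decide +kernel) (by decide +kernel) (by decide +kernel)
  simp [Fin.sum_univ_succ, dotProduct] at h0 h1 h2 h3 h4 h5 h6 h7 h8
  let s4 := b 4 0 - b 0 0 - b 1 0
  let s5 := b 5 0 - b 0 0 - b 2 0
  let s6 := b 6 0 - b 0 0 - b 1 0 - b 2 0 - b 3 0
  let a1 := b 4 1 - b 0 1 - b 1 1 - s4
  let a2 := b 5 2 - b 0 2 - b 2 2 - s5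
  let a3 := b 6 3 - b 0 3 - b 1 3 - b 2 3 - b 3 3 - s6
  let s7 := b 7 1 - b 1 1 + b 2 1 + b 3 1 - a1
  refine sum_lin_mul_cofactor_mem_Jf
    ![b 0, b 1 + Pi.single 1 a1, b 2 + Pi.single 2 a2, b 3 + Pi.single 3 a3]
    ![0, -a1, -a2, -a3, s4, s5, s6, s7] fun k => ?_
  ext j
  fin_cases k <;> fin_cases j <;>
    simp [c, Fin.sum_univ_succ, s4, s5, s6, s7, a1, a2, a3] <;> linarith

/-- The degree-8 homogeneous components of `I_eq` and of `Jf` coincide;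
equivalently `dim_ℚ (I_eq/Jf)^(8) = 0`: arrangement no. 23 admits no
nontrivial equisingular deformations, and the associated double octic
Calabi–Yau threefold is rigid. -/
theorem arrangement23_rigid :
    Submodule.restrictScalars ℚ Ieq ⊓ homogeneousSubmodule (Fin 4) ℚ 8 =
    Submodule.restrictScalars ℚ Jf ⊓ homogeneousSubmodule (Fin 4) ℚ 8 := by
  refine le_antisymm ?_ ?_
  · rintro g ⟨hg, h8⟩
    refine ⟨?_, h8⟩
    have hg' : g ∈ Ieq := hg
    simp only [Ieq, Submodule.mem_inf, Submodule.mem_iInf] at hg'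
    obtain ⟨hlines, hpoints⟩ := hg'
    obtain ⟨b, rfl⟩ := exists_eq_sum_lin_cofactor h8 (exists_eq_sum_cofactor
      (toPlane_cofactor_dvd_of_mem fun i j hij =>
        hlines i j (linearIndependent_pair_of_minor (c_minor i j hij))))
    exact sum_lin_mul_cofactor_mem_Jf_of_points hpoints
  · rintro g ⟨hg, h8⟩
    refine ⟨?_, h8⟩
    have hg' : g ∈ Jf := hg
    simp only [Submodule.coe_restrictScalars, SetLike.mem_coe, Ieq, Submodule.mem_inf,
      Submodule.mem_iInf]
    exact ⟨fun _ _ _ => Submodule.mem_sup_right hg', fun _ _ _ => Submodule.mem_sup_right hg'⟩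

end Octic23
end
end

section
/- Let f = xyz(x−t)(y−t)(z−t)(x+y+z−t)(x−y+z−t) ∈ ℚ[x,y,z,t] (arrangement no. 43) and let Jf and I_eq be its Jacobian ideal and equisingular ideal. Then the degree-8 homogeneous component of I_eq equals the degree-8 homogeneous component of Jf; equivalently, dim_ℚ (I_eq/Jf)^(8) = 0, i.e., the octic arrangement no. 43 admits no nontrivial equisingular deformations and the associated double octic Calabi–Yau threefold is rigid. -/
/-!
Rigidity of the double octic of arrangement no. 43:
for `f = xyz(x−t)(y−t)(z−t)(x+y+z−t)(x−y+z−t)` the degree-8 homogeneous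
component of the equisingular ideal `I_eq` equals that of the Jacobian ideal
`Jf`, i.e. `dim_ℚ (I_eq/Jf)^(8) = 0`.
-/

noncomputable section

open Matrix MvPolynomial

namespace Octic43

/-- `R = ℚ[x,y,z,t]` -/
abbrev R : Type := MvPolynomial (Fin 4) ℚ

/-- The linear polynomial with coefficient vector `a`. -/
def lin (a : Fin 4 → ℚ) : R := ∑ j, C (a j) * X j

/-- Coefficient vectors of the eight planes `x, y, z, x−t, y−t, z−t, x+y+z−t, x−y+z−t`. -/
def c : Fin 8 → Fin 4 → ℚ :=
  ![![1,0,0,0], ![0,1,0,0], ![0,0,1,0], ![1,0,0,-1],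
    ![0,1,0,-1], ![0,0,1,-1], ![1,1,1,-1], ![1,-1,1,-1]]

/-- The octic `f = xyz(x−t)(y−t)(z−t)(x+y+z−t)(x−y+z−t)`. -/
def f : R := ∏ i, lin (c i)

/-- The Jacobian ideal of `f`. -/
def Jf : Ideal R :=
  Ideal.span {pderiv 0 f, pderiv 1 f, pderiv 2 f, pderiv 3 f}

/-- `m(P)`: the number of the eight planes through the point `v`. -/
def m (v : Fin 4 → ℚ) : ℕ := {i : Fin 8 | c i ⬝ᵥ v = 0}.ncard

/-- `m(ℓᵢ,ℓⱼ)`: the number of the eight factors lying in the pencil spanned by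
`ℓᵢ` and `ℓⱼ` (the multiplicity of `f` along the line `ℓᵢ = ℓⱼ = 0`). -/
def mLine (i j : Fin 8) : ℕ :=
  {k : Fin 8 | c k ∈ Submodule.span ℚ ({c i, c j} : Set (Fin 4 → ℚ))}.ncard

/-- `I_P`: the ideal of the point `v`, generated by all linear forms
vanishing at `v`. -/
def IP (v : Fin 4 → ℚ) : Ideal R :=
  Ideal.span (lin '' {a : Fin 4 → ℚ | a ⬝ᵥ v = 0})

/-- The equisingular ideal
`I_eq = ⋂ ((ℓ,ℓ′)^{m(ℓ,ℓ′)} + Jf) ∩ ⋂ (I_P^{m(P)} + Jf)`, the first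
intersection over all pairs of linearly independent factors, the second over
all points of `ℙ³(ℚ)` lying on at least three of the eight planes. -/
def Ieq : Ideal R :=
  (⨅ (i : Fin 8) (j : Fin 8) (_ : LinearIndependent ℚ ![c i, c j]),
      (Ideal.span {lin (c i), lin (c j)} ^ mLine i j + Jf)) ⊓
  (⨅ (v : Fin 4 → ℚ) (_ : v ≠ 0) (_ : 3 ≤ m v), (IP v ^ m v + Jf))

lemma lin_add (a b : Fin 4 → ℚ) : lin (a + b) = lin a + lin b := by
  simp [lin, add_mul, Finset.sum_add_distrib]

lemma lin_smul (s : ℚ) (a : Fin 4 → ℚ) : lin (s • a) = C s * lin a := by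
  simp [lin, Finset.mul_sum, mul_assoc]

lemma lin_sub (a b : Fin 4 → ℚ) : lin (a - b) = lin a - lin b := by
  simp [lin, sub_mul, Finset.sum_sub_distrib]

lemma eval_lin (v a : Fin 4 → ℚ) : eval v (lin a) = a ⬝ᵥ v := by
  simp [lin, dotProduct]

lemma isHomogeneous_lin (a : Fin 4 → ℚ) : (lin a).IsHomogeneous 1 :=
  IsHomogeneous.sum _ _ _ fun j _ => by
    simpa using (isHomogeneous_C (Fin 4) (a j)).mul (isHomogeneous_X ℚ j)

lemma exists_smul_of_lin_dvd {a b : Fin 4 → ℚ} (ha : a ≠ 0) (h : lin a ∣ lin b) :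
    ∃ s : ℚ, b = s • a := by
  have haa : a ⬝ᵥ a ≠ 0 := fun h0 => ha (dotProduct_self_eq_zero.mp h0)
  set v : Fin 4 → ℚ := b - (a ⬝ᵥ b / a ⬝ᵥ a) • a with hv
  have hav : a ⬝ᵥ v = 0 := by
    rw [hv, dotProduct_sub, dotProduct_smul, smul_eq_mul, div_mul_cancel₀ _ haa, sub_self]
  have hbv : b ⬝ᵥ v = 0 := by
    obtain ⟨q, hq⟩ := h
    simpa [eval_lin, hav] using congrArg (eval v) hq
  have hvv : v ⬝ᵥ v = 0 := by
    conv_lhs => rw [hv]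
    rw [sub_dotProduct, smul_dotProduct, ← hv, hav, hbv]
    simp
  exact ⟨_, sub_eq_zero.mp (dotProduct_self_eq_zero.mp hvv)⟩

/-- Restriction to the hyperplane `lin a = 0`, realised as the substitution induced by the
orthogonal projection along `a`. -/
def proj (a : Fin 4 → ℚ) : R →ₐ[ℚ] R :=
  aeval fun k => X k - C (a k / a ⬝ᵥ a) * lin a

lemma proj_lin (a b : Fin 4 → ℚ) : proj a (lin b) = lin (b - (a ⬝ᵥ b / a ⬝ᵥ a) • a) := by
  have h : proj a (lin b) = lin b - C (∑ k, b k * (a k / a ⬝ᵥ a)) * lin a := by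
    simp only [proj, lin, map_sum, map_mul, aeval_X, algHom_C, algebraMap_eq, mul_sub,
      Finset.sum_sub_distrib, Finset.sum_mul, mul_assoc]
  rw [h, lin_sub, lin_smul]
  congr 3
  simp only [dotProduct, Finset.sum_div]
  exact Finset.sum_congr rfl fun k _ => by ring

lemma proj_lin_self {a : Fin 4 → ℚ} (ha : a ≠ 0) : proj a (lin a) = 0 := by
  have haa : a ⬝ᵥ a ≠ 0 := fun h0 => ha (dotProduct_self_eq_zero.mp h0)
  rw [proj_lin, div_self haa, one_smul, sub_self]
  simp [lin]

lemma lin_dvd_sub_proj (a : Fin 4 → ℚ) (p : R) : lin a ∣ p - proj a p := by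
  have h : (Ideal.Quotient.mkₐ ℚ (Ideal.span {lin a})).comp (proj a) =
      Ideal.Quotient.mkₐ ℚ (Ideal.span {lin a}) := by
    refine algHom_ext fun k => ?_
    simp only [AlgHom.comp_apply, proj, aeval_X, Ideal.Quotient.mkₐ_eq_mk]
    rw [Ideal.Quotient.eq, Ideal.mem_span_singleton]
    exact ⟨-C (a k / a ⬝ᵥ a), by ring⟩
  rw [← Ideal.mem_span_singleton, ← Ideal.Quotient.eq]
  exact (DFunLike.congr_fun h p).symm

lemma lin_dvd_iff {a : Fin 4 → ℚ} (ha : a ≠ 0) (p : R) : lin a ∣ p ↔ proj a p = 0 := by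
  constructor
  · rintro ⟨q, rfl⟩
    rw [map_mul, proj_lin_self ha, zero_mul]
  · intro h
    simpa [h] using lin_dvd_sub_proj a p

lemma prime_lin {a : Fin 4 → ℚ} (ha : a ≠ 0) : Prime (lin a) := by
  refine ⟨fun h => ?_, fun h => ?_, fun p q h => ?_⟩
  · have := eval_lin a a
    rw [h, map_zero] at this
    exact ha (dotProduct_self_eq_zero.mp this.symm)
  · have := h.map (proj a)
    rw [proj_lin_self ha] at this
    exact not_isUnit_zero this
  · rw [lin_dvd_iff ha, map_mul, mul_eq_zero] at h
    rwa [lin_dvd_iff ha, lin_dvd_iff ha]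

/-- A product divides `g` as soon as the subproducts over the classes of associated factors do. -/
lemma prod_dvd_of_forall_prime_class {ι : Type*} (p : ι → R) (g : R) (s : Finset ι)
    (hp : ∀ j ∈ s, Prime (p j))
    (h : ∀ j ∈ s, ∀ t ⊆ s, (∀ k ∈ t, p j ∣ p k) → ∏ k ∈ t, p k ∣ g) :
    ∏ k ∈ s, p k ∣ g := by
  classical
  induction s using Finset.strongInduction with
  | H s ih =>
    rcases s.eq_empty_or_nonempty with rfl | ⟨j, hj⟩
    · simp
    rw [← Finset.prod_filter_mul_prod_filter_not s (fun k => p j ∣ p k)]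
    refine IsRelPrime.mul_dvd ?_ ?_ ?_
    · refine IsRelPrime.prod_left fun k hk => IsRelPrime.prod_right fun l hl => ?_
      rw [Finset.mem_filter] at hk hl
      rw [(hp k hk.1).irreducible.isRelPrime_iff_not_dvd]
      exact fun hkl => hl.2 (hk.2.trans hkl)
    · exact h j hj _ (Finset.filter_subset _ _) fun k hk => (Finset.mem_filter.mp hk).2
    · have hss : s.filter (fun k => ¬ p j ∣ p k) ⊂ s :=
        Finset.filter_ssubset.mpr ⟨j, hj, by simp⟩
      exact ih _ hss (fun k hk => hp k (hss.1 hk))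
        fun k hk t ht => h k (hss.1 hk) t (ht.trans hss.1)

lemma gram_c : ∀ i j : Fin 8, i ≠ j → (c i ⬝ᵥ c i) * (c j ⬝ᵥ c j) ≠ (c i ⬝ᵥ c j) ^ 2 := by
  decide +kernel

lemma c_ne_smul {i j : Fin 8} (hij : i ≠ j) (s : ℚ) : c j ≠ s • c i := by
  intro h
  apply gram_c i j hij
  rw [h]
  simp only [dotProduct_smul, smul_dotProduct, smul_eq_mul]
  ring

lemma c_ne_zero (i : Fin 8) : c i ≠ 0 := by
  obtain ⟨j, hj⟩ := exists_ne i
  intro h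
  exact c_ne_smul hj 0 (by rw [h, zero_smul])

lemma linearIndependent_c {i j : Fin 8} (hij : i ≠ j) : LinearIndependent ℚ ![c i, c j] := by
  rw [LinearIndependent.pair_iff' (c_ne_zero i)]
  exact fun s h => c_ne_smul hij s h.symm

/-- The product of all the factors of `f` but the `i`-th. -/
def cofactor (i : Fin 8) : R := ∏ j ∈ Finset.univ.erase i, lin (c j)

lemma lin_mul_cofactor (i : Fin 8) : lin (c i) * cofactor i = f :=
  Finset.mul_prod_erase _ (fun j => lin (c j)) (Finset.mem_univ i)

lemma isHomogeneous_cofactor (i : Fin 8) : (cofactor i).IsHomogeneous 7 := by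
  simpa [cofactor] using IsHomogeneous.prod (Finset.univ.erase i) (fun j => lin (c j))
    (fun _ => 1) fun j _ => isHomogeneous_lin (c j)

lemma map_cofactor_eq_zero {S : Type*} [CommRing S] (φ : R →+* S) {i j : Fin 8} (hij : j ≠ i)
    (h : φ (lin (c j)) = 0) : φ (cofactor i) = 0 := by
  rw [cofactor, map_prod]
  exact Finset.prod_eq_zero (by simpa using hij) h

lemma pderiv_lin (k : Fin 4) (a : Fin 4 → ℚ) : pderiv k (lin a) = C (a k) := by
  simp [lin, pderiv_X, Pi.single_apply]

lemma pderiv_prod {ι : Type*} [DecidableEq ι] (k : Fin 4) (s : Finset ι) (p : ι → R) :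
    pderiv k (∏ i ∈ s, p i) = ∑ i ∈ s, pderiv k (p i) * ∏ j ∈ s.erase i, p j := by
  induction s using Finset.induction_on with
  | empty => simp
  | insert a s ha ih =>
    rw [Finset.prod_insert ha, Finset.sum_insert ha, Finset.erase_insert ha, pderiv_mul, ih,
      Finset.mul_sum]
    congr 1
    refine Finset.sum_congr rfl fun i hi => ?_
    have hai : a ≠ i := fun h => ha (h ▸ hi)
    rw [Finset.erase_insert_of_ne hai, Finset.prod_insert (by simp [ha])]
    ring

lemma pderiv_f (k : Fin 4) : pderiv k f = ∑ i, C (c i k) * cofactor i := by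
  simp only [f, pderiv_prod, pderiv_lin, cofactor]

lemma mem_Jf_iff {p : R} :
    p ∈ Jf ↔ ∃ h : Fin 4 → R, p = ∑ i, (∑ k, h k * C (c i k)) * cofactor i := by
  have hJ : Jf = Ideal.span (Set.range fun k => pderiv k f) := by
    rw [Jf]
    congr 1
    ext q
    simp [Fin.exists_fin_succ, eq_comm]
  rw [hJ, Ideal.mem_span_range_iff_exists_fun]
  refine exists_congr fun h => ?_
  simp only [pderiv_f, Finset.mul_sum, Finset.sum_mul, ← mul_assoc]
  rw [Finset.sum_comm, eq_comm]

/-- If `φ` kills `lin (c i)`, then it kills all the cofactors but the `i`-th. -/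
lemma map_sum_mul_cofactor {S : Type*} [CommRing S] (φ : R →+* S) (i : Fin 8)
    (hφ : φ (lin (c i)) = 0) (b : Fin 8 → R) :
    φ (∑ j, b j * cofactor j) = φ (b i) * φ (cofactor i) := by
  rw [map_sum, Finset.sum_eq_single i]
  · rw [map_mul]
  · intro j _ hj
    rw [map_mul, map_cofactor_eq_zero φ hj.symm hφ, mul_zero]
  · simp

/-- On each of the planes, an element of `I_eq` is divisible by the product of the others. -/
lemma proj_cofactor_dvd {g : R} (hg : g ∈ Ieq) (i : Fin 8) :
    proj (c i) (cofactor i) ∣ proj (c i) g := by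
  set d : Fin 8 → Fin 4 → ℚ := fun j => c j - (c i ⬝ᵥ c j / c i ⬝ᵥ c i) • c i with hd
  have hpd : ∀ j, proj (c i) (lin (c j)) = lin (d j) := fun j => proj_lin _ _
  have hd0 : ∀ j ≠ i, d j ≠ 0 := fun j hj h => c_ne_smul hj.symm _ (sub_eq_zero.mp h)
  have hprod : proj (c i) (cofactor i) = ∏ j ∈ Finset.univ.erase i, lin (d j) := by
    simp only [cofactor, map_prod, hpd]
  rw [hprod]
  refine prod_dvd_of_forall_prime_class _ _ _
    (fun j hj => prime_lin (hd0 j (Finset.ne_of_mem_erase hj))) fun j hj t ht htj => ?_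
  have hji := Finset.ne_of_mem_erase hj
  have hgij : g ∈ Ideal.span {lin (c i), lin (c j)} ^ mLine i j + Jf := by
    have h1 := hg.1
    simp only [Submodule.mem_iInf, SetLike.mem_coe] at h1
    exact h1 i j (linearIndependent_c hji.symm)
  obtain ⟨r, hr, q, hq, rfl⟩ := Submodule.mem_sup.mp hgij
  rw [map_add]
  refine dvd_add ?_ ?_
  · have hr' : lin (d j) ^ mLine i j ∣ proj (c i) r := by
      have := Ideal.mem_map_of_mem (proj (c i)) hr
      rw [Ideal.map_pow, Ideal.map_span, Set.image_pair, proj_lin_self (c_ne_zero i), hpd,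
        Ideal.span_insert_zero, Ideal.span_singleton_pow, Ideal.mem_span_singleton] at this
      exact this
    have hcard : t.card ≤ mLine i j := by
      rw [mLine, ← Set.ncard_coe_finset]
      refine Set.ncard_le_ncard (fun k hk => ?_) (Set.toFinite _)
      obtain ⟨s, hs⟩ := exists_smul_of_lin_dvd (hd0 j hji) (htj k hk)
      have hi : c i ∈ Submodule.span ℚ {c i, c j} := Submodule.subset_span (by simp)
      have hj : c j ∈ Submodule.span ℚ {c i, c j} := Submodule.subset_span (by simp)
      have hdj : d j ∈ Submodule.span ℚ {c i, c j} :=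
        Submodule.sub_mem _ hj (Submodule.smul_mem _ _ hi)
      have hck : c k = s • d j + (c i ⬝ᵥ c k / c i ⬝ᵥ c i) • c i := by
        rw [← hs, hd]; simp
      rw [Set.mem_ofPred_eq, hck]
      exact Submodule.add_mem _ (Submodule.smul_mem _ _ hdj) (Submodule.smul_mem _ _ hi)
    refine dvd_trans ?_ hr'
    calc ∏ k ∈ t, lin (d k) ∣ ∏ _k ∈ t, lin (d j) := Finset.prod_dvd_prod_of_dvd _ _ fun k hk =>
          ((prime_lin (hd0 j hji)).associated_of_dvd
            (prime_lin (hd0 k (Finset.ne_of_mem_erase (ht hk)))) (htj k hk)).symm.dvd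
      _ = lin (d j) ^ t.card := by rw [Finset.prod_const]
      _ ∣ lin (d j) ^ mLine i j := pow_dvd_pow _ hcard
  · obtain ⟨h, rfl⟩ := mem_Jf_iff.mp hq
    have := map_sum_mul_cofactor (proj (c i) : R →+* R) i (proj_lin_self (c_ne_zero i))
      fun j => ∑ k, h k * C (c j k)
    simp only [RingHom.coe_coe] at this
    rw [this, hprod]
    exact dvd_mul_of_dvd_right (Finset.prod_dvd_prod_of_subset _ _ _ ht) _

/-- Elements of `I_eq` are combinations of the cofactors: they deform the planes. -/
lemma exists_eq_sum_cofactor {g : R} (hg : g ∈ Ieq) :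
    ∃ n : Fin 8 → R, g = ∑ i, n i * cofactor i := by
  have hloc : ∀ i, ∃ q, lin (c i) ∣ g - q * cofactor i := fun i => by
    obtain ⟨q, hq⟩ := proj_cofactor_dvd hg i
    refine ⟨q, ?_⟩
    have hidem : proj (c i) (proj (c i) g) = proj (c i) g :=
      (sub_eq_zero.mp (by
        rw [← map_sub]
        exact (lin_dvd_iff (c_ne_zero i) _).mp (lin_dvd_sub_proj _ _))).symm
    have hidem' : proj (c i) (proj (c i) (cofactor i)) = proj (c i) (cofactor i) :=
      (sub_eq_zero.mp (by
        rw [← map_sub]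
        exact (lin_dvd_iff (c_ne_zero i) _).mp (lin_dvd_sub_proj _ _))).symm
    rw [lin_dvd_iff (c_ne_zero i), map_sub, map_mul, ← hidem, hq, map_mul, hidem']
    ring
  choose q hq using hloc
  have hf : f ∣ g - ∑ i, q i * cofactor i := by
    refine Finset.prod_dvd_of_isRelPrime (fun i _ j _ hij => ?_) fun i _ => ?_
    · rw [Function.onFun, (prime_lin (c_ne_zero i)).irreducible.isRelPrime_iff_not_dvd]
      intro h
      obtain ⟨s, hs⟩ := exists_smul_of_lin_dvd (c_ne_zero i) h
      exact c_ne_smul hij s hs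
    · rw [← Finset.add_sum_erase _ _ (Finset.mem_univ i), ← sub_sub]
      refine dvd_sub (hq i) (Finset.dvd_sum fun j hj => dvd_mul_of_dvd_right ?_ _)
      exact Finset.dvd_prod_of_mem (fun j => lin (c j))
        (by simpa using (Finset.ne_of_mem_erase hj).symm)
  obtain ⟨a, ha⟩ := hf
  refine ⟨fun i => q i + if i = 0 then a * lin (c 0) else 0, ?_⟩
  simp only [add_mul, Finset.sum_add_distrib, ite_mul, zero_mul, Finset.sum_ite_eq',
    Finset.mem_univ, if_true]
  rw [mul_assoc, lin_mul_cofactor]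
  linear_combination ha

lemma exists_lin_of_isHomogeneous {p : R} (hp : p.IsHomogeneous 1) : ∃ b, p = lin b := by
  rw [← mem_homogeneousSubmodule, homogeneousSubmodule_one_eq_span_X,
    Submodule.mem_span_range_iff_exists_fun] at hp
  obtain ⟨b, hb⟩ := hp
  exact ⟨b, by simp [← hb, lin, smul_eq_C_mul]⟩

lemma homogeneousComponent_mul_of_isHomogeneous {p q : R} {m n : ℕ} (hq : q.IsHomogeneous n) :
    homogeneousComponent (m + n) (p * q) = homogeneousComponent m p * q := by
  have hcomp : ∀ i, homogeneousComponent (m + n) (homogeneousComponent i p * q) =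
      if m = i then homogeneousComponent i p * q else 0 := fun i => by
    rw [homogeneousComponent_of_mem
      (((homogeneousComponent_isHomogeneous i p).mul hq : IsHomogeneous _ (i + n)))]
    simp
  conv_lhs => rw [← sum_homogeneousComponent p, Finset.sum_mul, map_sum]
  simp only [hcomp, Finset.sum_ite_eq, Finset.mem_range]
  split_ifs with h
  · rfl
  · rw [homogeneousComponent_eq_zero _ _ (by lia), zero_mul]

lemma exists_eq_sum_lin_mul_cofactor {g : R} (hg : g ∈ Ieq) (hh : g.IsHomogeneous 8) :
    ∃ b : Fin 8 → Fin 4 → ℚ, g = ∑ i, lin (b i) * cofactor i := by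
  obtain ⟨n, hn⟩ := exists_eq_sum_cofactor hg
  choose b hb using fun i =>
    exists_lin_of_isHomogeneous (homogeneousComponent_isHomogeneous 1 (n i))
  refine ⟨b, ?_⟩
  rw [← homogeneousComponent_eq_self hh, hn, map_sum]
  refine Finset.sum_congr rfl fun i _ => ?_
  rw [← hb, homogeneousComponent_mul_of_isHomogeneous (m := 1) (isHomogeneous_cofactor i)]

/-- Restriction to the line through `v` with direction `w`. -/
def restrictLine (v w : Fin 4 → ℚ) : R →ₐ[ℚ] Polynomial ℚ :=
  aeval fun k => Polynomial.C (v k) + Polynomial.C (w k) * Polynomial.X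

lemma restrictLine_lin (v w a : Fin 4 → ℚ) :
    restrictLine v w (lin a) = Polynomial.C (a ⬝ᵥ v) + Polynomial.C (a ⬝ᵥ w) * Polynomial.X := by
  simp only [restrictLine, lin, map_sum, map_mul, aeval_X, algHom_C, Polynomial.algebraMap_eq,
    dotProduct, mul_add, Finset.sum_add_distrib, Finset.sum_mul, mul_assoc]

lemma eval_zero_restrictLine (v w : Fin 4 → ℚ) (p : R) :
    (restrictLine v w p).eval 0 = eval v p := by
  have h : (Polynomial.aeval (0 : ℚ)).comp (restrictLine v w) = aeval v :=
    algHom_ext fun k => by simp [restrictLine]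
  have := DFunLike.congr_fun h p
  simpa [Polynomial.coe_aeval_eq_eval, aeval_eq_eval] using this

/-- A direction lying on the `i`-th plane only. -/
def dir : Fin 8 → Fin 4 → ℚ :=
  ![![0,-5,-5,-4], ![-5,0,-5,-4], ![-5,-5,0,-4], ![-5,-4,-3,-5],
    ![-5,-4,-5,-4], ![-5,-4,-3,-3], ![-5,-3,4,-4], ![-5,-4,-2,-3]]

lemma c_dotProduct_dir : ∀ i j : Fin 8, c j ⬝ᵥ dir i = 0 ↔ j = i := by
  decide +kernel

lemma not_X_pow_dvd_restrictLine_cofactor (v : Fin 4 → ℚ) {i : Fin 8} (hi : c i ⬝ᵥ v = 0) :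
    ¬ Polynomial.X ^ m v ∣ restrictLine v (dir i) (cofactor i) := by
  intro hdvd
  set s : Finset (Fin 8) := (Finset.univ.erase i).filter fun j => c j ⬝ᵥ v = 0 with hs
  have hm : m v = s.card + 1 := by
    rw [m, Set.ncard_eq_toFinset_card', Set.toFinset_ofPred, hs, Finset.filter_erase,
      Finset.card_erase_add_one (by simpa using hi)]
  have hsplit : restrictLine v (dir i) (cofactor i) =
      Polynomial.X ^ s.card * (Polynomial.C (∏ j ∈ s, c j ⬝ᵥ dir i) *
        ∏ j ∈ (Finset.univ.erase i).filter (fun j => ¬ c j ⬝ᵥ v = 0),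
          restrictLine v (dir i) (lin (c j))) := by
    rw [cofactor, map_prod, ← Finset.prod_filter_mul_prod_filter_not _ (fun j => c j ⬝ᵥ v = 0),
      ← hs, ← mul_assoc, map_prod, ← Finset.prod_const, ← Finset.prod_mul_distrib]
    congr 1
    refine Finset.prod_congr rfl fun j hj => ?_
    rw [restrictLine_lin, (Finset.mem_filter.mp hj).2]
    rw [map_zero, zero_add, mul_comm]
  rw [hsplit, hm, pow_succ,
    mul_dvd_mul_iff_left (pow_ne_zero _ Polynomial.X_ne_zero), Polynomial.X_dvd_iff,
    Polynomial.coeff_zero_eq_eval_zero, Polynomial.eval_mul, Polynomial.eval_C,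
    Polynomial.eval_prod, mul_eq_zero, Finset.prod_eq_zero_iff, Finset.prod_eq_zero_iff] at hdvd
  rcases hdvd with ⟨j, hj, h0⟩ | ⟨j, hj, h0⟩
  · rw [c_dotProduct_dir] at h0
    exact Finset.ne_of_mem_erase (Finset.mem_filter.mp hj).1 h0
  · rw [eval_zero_restrictLine, eval_lin] at h0
    exact (Finset.mem_filter.mp hj).2 h0

/-- An equisingular deformation moves the planes through a multiple point `v` as, to first order,
the translation by some vector `η` does. -/
lemma exists_forall_dotProduct_eq {b : Fin 8 → Fin 4 → ℚ}
    (hg : ∑ i, lin (b i) * cofactor i ∈ Ieq) {v : Fin 4 → ℚ} (hv : v ≠ 0) (hm : 3 ≤ m v) :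
    ∃ η : Fin 4 → ℚ, ∀ i, c i ⬝ᵥ v = 0 → b i ⬝ᵥ v = η ⬝ᵥ c i := by
  have hgv : ∑ i, lin (b i) * cofactor i ∈ IP v ^ m v + Jf := by
    have h2 := hg.2
    simp only [Submodule.mem_iInf, SetLike.mem_coe] at h2
    exact h2 v hv hm
  obtain ⟨r, hr, q, hq, hrq⟩ := Submodule.mem_sup.mp hgv
  obtain ⟨h, rfl⟩ := mem_Jf_iff.mp hq
  refine ⟨fun k => eval v (h k), fun i hi => ?_⟩
  have hφ : (restrictLine v (dir i) : R →+* Polynomial ℚ) (lin (c i)) = 0 := by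
    rw [RingHom.coe_coe, restrictLine_lin, hi, (c_dotProduct_dir i i).mpr rfl]
    simp
  have hr' : Polynomial.X ^ m v ∣ restrictLine v (dir i) r := by
    have := Ideal.mem_map_of_mem (restrictLine v (dir i)) hr
    rw [Ideal.map_pow] at this
    rw [← Ideal.mem_span_singleton, ← Ideal.span_singleton_pow]
    refine Ideal.pow_right_mono ?_ _ this
    rw [IP, Ideal.map_span, Ideal.span_le]
    rintro _ ⟨_, ⟨a, ha, rfl⟩, rfl⟩
    rw [SetLike.mem_coe, Ideal.mem_span_singleton, restrictLine_lin, ha, map_zero, zero_add]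
    exact dvd_mul_left _ _
  have key : restrictLine v (dir i) r =
      restrictLine v (dir i) (lin (b i) - ∑ k, h k * C (c i k)) *
        restrictLine v (dir i) (cofactor i) := by
    have h1 := map_sum_mul_cofactor _ i hφ fun j => lin (b j) - ∑ k, h k * C (c j k)
    simp only [sub_mul, Finset.sum_sub_distrib, ← hrq, add_sub_cancel_right] at h1
    exact h1
  rw [key] at hr'
  by_contra hne
  refine not_X_pow_dvd_restrictLine_cofactor v hi
    (IsCoprime.dvd_of_dvd_mul_left (IsCoprime.pow_left ?_) hr')
  rw [Polynomial.prime_X.irreducible.coprime_iff_not_dvd, Polynomial.X_dvd_iff,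
    Polynomial.coeff_zero_eq_eval_zero, eval_zero_restrictLine]
  intro h0
  apply hne
  simpa [eval_lin, sub_eq_zero, dotProduct] using h0

/-- A first-order deformation of the planes by an infinitesimal linear transformation and
rescalings of the equations is trivial. -/
lemma sum_lin_mul_cofactor_mem_Jf (b : Fin 8 → Fin 4 → ℚ) (A : Matrix (Fin 4) (Fin 4) ℚ)
    (s : Fin 8 → ℚ) (h : ∀ i, b i = A *ᵥ c i + s i • c i) :
    ∑ i, lin (b i) * cofactor i ∈ Jf := by
  have hf : f ∈ Jf := by
    have hom : f.IsHomogeneous 8 := by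
      rw [← lin_mul_cofactor 0]
      exact (isHomogeneous_lin (c 0)).mul (isHomogeneous_cofactor 0)
    have h8 : (C (1 / 8 : ℚ) : R) * (8 : ℕ) = 1 := by
      rw [← C_eq_coe_nat, ← C_mul]
      norm_num
    have hE := hom.sum_X_mul_pderiv
    have : f = C (1 / 8 : ℚ) * ∑ k, X k * pderiv k f := by
      rw [hE, nsmul_eq_mul, ← mul_assoc, h8, one_mul]
    rw [this]
    refine Ideal.mul_mem_left _ _ (Ideal.sum_mem _ fun k _ => Ideal.mul_mem_left _ _ ?_)
    exact Ideal.subset_span (by fin_cases k <;> simp)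
  have hsplit : ∑ i, lin (b i) * cofactor i =
      ∑ i, lin (A *ᵥ c i) * cofactor i + C (∑ i, s i) * f := by
    rw [map_sum, Finset.sum_mul, ← Finset.sum_add_distrib]
    refine Finset.sum_congr rfl fun i _ => ?_
    rw [h i, lin_add, lin_smul, ← lin_mul_cofactor i]
    ring
  rw [hsplit]
  refine Ideal.add_mem _ (mem_Jf_iff.mpr ⟨fun k => lin fun j => A j k, ?_⟩)
    (Ideal.mul_mem_left _ _ hf)
  refine Finset.sum_congr rfl fun i _ => ?_
  congr 1
  simp only [lin, mulVec, dotProduct, map_sum, map_mul, Finset.sum_mul]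
  rw [Finset.sum_comm]
  exact Finset.sum_congr rfl fun k _ => Finset.sum_congr rfl fun j _ => by ring

lemma three_le_m_of_card {v : Fin 4 → ℚ}
    (h : 3 ≤ (Finset.univ.filter fun i => c i ⬝ᵥ v = 0).card) : 3 ≤ m v := by
  rwa [m, Set.ncard_eq_toFinset_card', Set.toFinset_ofPred]

/-- A linear dependency among the planes through a multiple point `v` persists, at `v`, under
equisingular deformations. -/
lemma sum_mul_dotProduct_eq_zero {b : Fin 8 → Fin 4 → ℚ}
    (H : ∀ v : Fin 4 → ℚ, v ≠ 0 → 3 ≤ m v →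
      ∃ η : Fin 4 → ℚ, ∀ i, c i ⬝ᵥ v = 0 → b i ⬝ᵥ v = η ⬝ᵥ c i)
    (v : Fin 4 → ℚ) (l : Fin 8 → ℚ) (hv : v ≠ 0)
    (hm : 3 ≤ (Finset.univ.filter fun i => c i ⬝ᵥ v = 0).card)
    (hl : ∀ i, l i = 0 ∨ c i ⬝ᵥ v = 0) (hlc : ∑ i, l i • c i = 0) :
    ∑ i, l i * b i ⬝ᵥ v = 0 := by
  obtain ⟨η, hη⟩ := H v hv (three_le_m_of_card hm)
  calc ∑ i, l i * b i ⬝ᵥ v = ∑ i, l i * η ⬝ᵥ c i := Finset.sum_congr rfl fun i _ => by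
        rcases hl i with h | h
        · rw [h, zero_mul, zero_mul]
        · rw [hη i h]
    _ = η ⬝ᵥ ∑ i, l i • c i := by simp [dotProduct_sum]
    _ = 0 := by rw [hlc, dotProduct_zero]

set_option maxHeartbeats 2000000 in
/-- The only deformations of the planes compatible with the multiple points are the trivial ones. -/
lemma exists_trivialization {b : Fin 8 → Fin 4 → ℚ}
    (H : ∀ v : Fin 4 → ℚ, v ≠ 0 → 3 ≤ m v →
      ∃ η : Fin 4 → ℚ, ∀ i, c i ⬝ᵥ v = 0 → b i ⬝ᵥ v = η ⬝ᵥ c i) :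
    ∃ (A : Matrix (Fin 4) (Fin 4) ℚ) (s : Fin 8 → ℚ), ∀ i, b i = A *ᵥ c i + s i • c i := by
  have h1 := sum_mul_dotProduct_eq_zero H ![1, 0, 0, 0] ![0, 1, -1, 0, -1, 1, 0, 0]
    (by decide +kernel) (by decide +kernel) (by decide +kernel) (by decide +kernel)
  have h2 := sum_mul_dotProduct_eq_zero H ![0, 1, 0, 0] ![1, 0, -1, -1, 0, 1, 0, 0]
    (by decide +kernel) (by decide +kernel) (by decide +kernel) (by decide +kernel)
  have h3 := sum_mul_dotProduct_eq_zero H ![0, 0, 1, 0] ![1, -1, 0, -1, 1, 0, 0, 0]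
    (by decide +kernel) (by decide +kernel) (by decide +kernel) (by decide +kernel)
  have h4 := sum_mul_dotProduct_eq_zero H ![0, 0, 1, 1] ![-1, -1, 0, 0, 0, -1, 1, 0]
    (by decide +kernel) (by decide +kernel) (by decide +kernel) (by decide +kernel)
  have h5 := sum_mul_dotProduct_eq_zero H ![0, 0, 1, 1] ![-1, 1, 0, 0, 0, -1, 0, 1]
    (by decide +kernel) (by decide +kernel) (by decide +kernel) (by decide +kernel)
  have h6 := sum_mul_dotProduct_eq_zero H ![1, 0, 0, 1] ![0, -1, -1, -1, 0, 0, 1, 0]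
    (by decide +kernel) (by decide +kernel) (by decide +kernel) (by decide +kernel)
  have h7 := sum_mul_dotProduct_eq_zero H ![1, 0, 0, 1] ![0, 1, -1, -1, 0, 0, 0, 1]
    (by decide +kernel) (by decide +kernel) (by decide +kernel) (by decide +kernel)
  have h8 := sum_mul_dotProduct_eq_zero H ![1, 1, 1, 1] ![0, 0, 0, -1, 1, -1, 0, 1]
    (by decide +kernel) (by decide +kernel) (by decide +kernel) (by decide +kernel)
  have h9 := sum_mul_dotProduct_eq_zero H ![0, 1, 0, 1] ![-1, 0, -1, 0, -1, 0, 1, 0]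
    (by decide +kernel) (by decide +kernel) (by decide +kernel) (by decide +kernel)
  simp only [dotProduct, Fin.sum_univ_eight, Fin.sum_univ_four, Matrix.cons_val]
    at h1 h2 h3 h4 h5 h6 h7 h8 h9
  clear H
  obtain ⟨s1, hs1⟩ : ∃ x, x =
      -b 0 0 + b 1 1 - b 5 0 + b 6 0 / 2 - b 6 1 / 2 + b 7 0 / 2 + b 7 1 / 2 := ⟨_, rfl⟩
  obtain ⟨s2, hs2⟩ : ∃ x, x =
      -b 0 0 + b 2 2 + b 3 2 - b 5 0 + b 6 0 / 2 - b 6 2 / 2 + b 7 0 / 2 - b 7 2 / 2 := ⟨_, rfl⟩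
  obtain ⟨s3, hs3⟩ : ∃ x, x =
      -b 0 0 - b 2 3 - b 3 3 - b 5 0 + b 6 0 / 2 + b 6 3 / 2 + b 7 0 / 2 + b 7 3 / 2 := ⟨_, rfl⟩
  obtain ⟨s4, hs4⟩ : ∃ x, x =
      -b 0 0 - b 2 3 + b 3 2 - b 4 2 - b 4 3 - b 5 0 + b 5 2 + b 5 3 + b 6 0 / 2 + b 6 3 / 2
        + b 7 0 / 2 - b 7 2 - b 7 3 / 2 := ⟨_, rfl⟩
  obtain ⟨s5, hs5⟩ : ∃ x, x =
      -b 0 0 - b 2 3 + b 3 1 + 2 * b 3 2 - b 4 1 - 2 * b 4 2 - b 4 3 - b 5 0 + b 5 1 + 2 * b 5 2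
        + b 5 3 + b 6 0 / 2 + b 6 3 / 2 + b 7 0 / 2 - b 7 1 - 2 * b 7 2 - b 7 3 / 2 := ⟨_, rfl⟩
  obtain ⟨s6, hs6⟩ : ∃ x, x =
      -b 0 0 + b 2 3 - b 3 1 - b 3 2 + b 4 1 + b 4 2 + b 4 3 - b 5 0 - b 5 1 - b 5 2 - b 5 3
        + b 6 0 / 2 - b 6 3 / 2 + b 7 0 / 2 + b 7 1 + b 7 2 + b 7 3 / 2 := ⟨_, rfl⟩
  obtain ⟨s7, hs7⟩ : ∃ x, x =
      -b 0 0 - b 2 3 + b 3 1 + b 3 2 - b 4 1 - b 4 2 - b 4 3 - b 5 0 + b 5 1 + b 5 2 + b 5 3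
        + b 6 0 / 2 + b 6 3 / 2 + b 7 0 / 2 - b 7 1 - b 7 2 - b 7 3 / 2 := ⟨_, rfl⟩
  refine ⟨Matrix.of fun j => ![b 0 j, b 1 j - s1 * c 1 j, b 2 j - s2 * c 2 j,
    b 0 j - b 3 j + s3 * c 3 j], ![0, s1, s2, s3, s4, s5, s6, s7], fun i => ?_⟩
  ext j
  simp only [Pi.add_apply, Pi.smul_apply, mulVec, dotProduct, Fin.sum_univ_four, of_apply,
    smul_eq_mul]
  fin_cases i <;> fin_cases j <;> simp [c] <;> linarith

/-- The degree-8 homogeneous components of `I_eq` and of `Jf` coincide;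
equivalently `dim_ℚ (I_eq/Jf)^(8) = 0`: arrangement no. 43 admits no
nontrivial equisingular deformations, and the associated double octic
Calabi–Yau threefold is rigid. -/
theorem arrangement43_rigid :
    Submodule.restrictScalars ℚ Ieq ⊓ homogeneousSubmodule (Fin 4) ℚ 8 =
    Submodule.restrictScalars ℚ Jf ⊓ homogeneousSubmodule (Fin 4) ℚ 8 := by
  refine le_antisymm ?_ (inf_le_inf_right _ ?_)
  · rintro g ⟨hg, hh⟩
    refine ⟨?_, hh⟩
    obtain ⟨b, rfl⟩ := exists_eq_sum_lin_mul_cofactor hg ((mem_homogeneousSubmodule 8 g).mp hh)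
    obtain ⟨A, s, h⟩ := exists_trivialization fun v hv hm => exists_forall_dotProduct_eq hg hv hm
    exact sum_lin_mul_cofactor_mem_Jf b A s h
  · have hle : Jf ≤ Ieq := le_inf
      (le_iInf fun i => le_iInf fun j => le_iInf fun _ => le_sup_right)
      (le_iInf fun v => le_iInf fun _ => le_iInf fun _ => le_sup_right)
    exact fun _ hp => hle hp

end Octic43
end
end

section
/- Let f = xyz(x−t)(y−t)(z−t)(x+y+z−2t)(x+y) ∈ ℚ[x,y,z,t] (arrangement no. 61) and let Jf and I_eq be its Jacobian ideal and equisingular ideal. Then the degree-8 homogeneous component of I_eq equals the degree-8 homogeneous component of Jf; equivalently, dim_ℚ (I_eq/Jf)^(8) = 0, i.e., the octic arrangement no. 61 admits no nontrivial equisingular deformations and the associated double octic Calabi–Yau threefold is rigid. -/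
/-!
Rigidity of the double octic of arrangement no. 61:
for `f = xyz(x−t)(y−t)(z−t)(x+y+z−2t)(x+y)` the degree-8 homogeneous
component of the equisingular ideal `I_eq` equals that of the Jacobian ideal
`Jf`, i.e. `dim_ℚ (I_eq/Jf)^(8) = 0`.
-/

noncomputable section

open Matrix MvPolynomial

namespace Octic61

/-- `R = ℚ[x,y,z,t]` -/
abbrev R : Type := MvPolynomial (Fin 4) ℚ

/-- The linear polynomial with coefficient vector `a`. -/
def lin (a : Fin 4 → ℚ) : R := ∑ j, C (a j) * X j

/-- Coefficient vectors of the eight planes `x, y, z, x−t, y−t, z−t, x+y+z−2t, x+y`. -/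
def c : Fin 8 → Fin 4 → ℚ :=
  ![![1,0,0,0], ![0,1,0,0], ![0,0,1,0], ![1,0,0,-1],
    ![0,1,0,-1], ![0,0,1,-1], ![1,1,1,-2], ![1,1,0,0]]

/-- The octic `f = xyz(x−t)(y−t)(z−t)(x+y+z−2t)(x+y)`. -/
def f : R := ∏ i, lin (c i)

/-- The Jacobian ideal of `f`. -/
def Jf : Ideal R :=
  Ideal.span {pderiv 0 f, pderiv 1 f, pderiv 2 f, pderiv 3 f}

/-- `m(P)`: the number of the eight planes through the point `v`. -/
def m (v : Fin 4 → ℚ) : ℕ := {i : Fin 8 | c i ⬝ᵥ v = 0}.ncard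

/-- `m(ℓᵢ,ℓⱼ)`: the number of the eight factors lying in the pencil spanned by
`ℓᵢ` and `ℓⱼ` (the multiplicity of `f` along the line `ℓᵢ = ℓⱼ = 0`). -/
def mLine (i j : Fin 8) : ℕ :=
  {k : Fin 8 | c k ∈ Submodule.span ℚ ({c i, c j} : Set (Fin 4 → ℚ))}.ncard

/-- `I_P`: the ideal of the point `v`, generated by all linear forms
vanishing at `v`. -/
def IP (v : Fin 4 → ℚ) : Ideal R :=
  Ideal.span (lin '' {a : Fin 4 → ℚ | a ⬝ᵥ v = 0})

/-- The equisingular ideal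
`I_eq = ⋂ ((ℓ,ℓ′)^{m(ℓ,ℓ′)} + Jf) ∩ ⋂ (I_P^{m(P)} + Jf)`, the first
intersection over all pairs of linearly independent factors, the second over
all points of `ℙ³(ℚ)` lying on at least three of the eight planes. -/
def Ieq : Ideal R :=
  (⨅ (i : Fin 8) (j : Fin 8) (_ : LinearIndependent ℚ ![c i, c j]),
      (Ideal.span {lin (c i), lin (c j)} ^ mLine i j + Jf)) ⊓
  (⨅ (v : Fin 4 → ℚ) (_ : v ≠ 0) (_ : 3 ≤ m v), (IP v ^ m v + Jf))

/-! ### Linear forms and the cofactors `f / ℓᵢ` -/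

lemma map_lin {A : Type*} [CommRing A] [Algebra ℚ A] (φ : R →ₐ[ℚ] A) (a : Fin 4 → ℚ) :
    φ (lin a) = ∑ j, algebraMap ℚ A (a j) * φ (X j) := by
  simp only [lin, map_sum, map_mul, ← algebraMap_eq, AlgHom.commutes]

lemma eval_lin (v a : Fin 4 → ℚ) : eval v (lin a) = a ⬝ᵥ v := by
  simp [lin, dotProduct]

lemma isHomogeneous_lin (a : Fin 4 → ℚ) : (lin a).IsHomogeneous 1 :=
  IsHomogeneous.sum _ _ _ fun j _ => isHomogeneous_C_mul_X (a j) j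

lemma exists_eq_lin {p : R} (hp : p.IsHomogeneous 1) : ∃ a, p = lin a := by
  have h : p ∈ homogeneousSubmodule (Fin 4) ℚ 1 := hp
  rw [homogeneousSubmodule_one_eq_span_X, Submodule.mem_span_range_iff_exists_fun] at h
  obtain ⟨a, rfl⟩ := h
  exact ⟨a, by simp [lin, smul_eq_C_mul]⟩

/-- The product of all planes but the `i`-th. -/
def cofactor (i : Fin 8) : R := ∏ j ∈ Finset.univ.erase i, lin (c j)

lemma lin_mul_cofactor (i : Fin 8) : lin (c i) * cofactor i = f :=
  Finset.mul_prod_erase _ _ (Finset.mem_univ i)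

lemma lin_dvd_cofactor {i j : Fin 8} (h : j ≠ i) : lin (c j) ∣ cofactor i :=
  Finset.dvd_prod_of_mem (fun k => lin (c k)) (by simpa using h)

lemma isHomogeneous_cofactor (i : Fin 8) : (cofactor i).IsHomogeneous 7 := by
  simpa [cofactor] using IsHomogeneous.prod (Finset.univ.erase i) (fun j => lin (c j)) (fun _ => 1)
    fun j _ => isHomogeneous_lin (c j)

lemma pderiv_lin (k : Fin 4) (a : Fin 4 → ℚ) : pderiv k (lin a) = C (a k) := by
  simp [lin, pderiv_X, Pi.single_apply]

lemma pderiv_f (k : Fin 4) : pderiv k f = ∑ i, C (c i k) * cofactor i := by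
  have key (s : Finset (Fin 8)) : pderiv k (∏ i ∈ s, lin (c i)) =
      ∑ i ∈ s, C (c i k) * ∏ j ∈ s.erase i, lin (c j) := by
    induction s using Finset.induction_on with
    | empty => simp
    | insert a s ha ih =>
      rw [Finset.prod_insert ha, Derivation.leibniz, ih, Finset.sum_insert ha,
        Finset.erase_insert ha, pderiv_lin, smul_eq_mul, smul_eq_mul, Finset.mul_sum, add_comm,
        mul_comm (C (c a k))]
      congr 1
      refine Finset.sum_congr rfl fun i hi => ?_
      have hia : a ≠ i := fun h => ha (h ▸ hi)
      rw [Finset.erase_insert_of_ne hia, Finset.prod_insert (by simp [ha])]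
      ring
  exact key Finset.univ

lemma Jf_eq_span_range : Jf = Ideal.span (Set.range fun k => pderiv k f) := by
  rw [Jf]
  congr 1
  ext p
  simp [Fin.exists_fin_succ, eq_comm]

lemma pderiv_f_mem_Jf (k : Fin 4) : pderiv k f ∈ Jf := by
  rw [Jf_eq_span_range]
  exact Ideal.subset_span ⟨k, rfl⟩

lemma sum_C_mul_eq (H : Fin 4 → R) :
    ∑ k, H k * pderiv k f = ∑ i, (∑ k, C (c i k) * H k) * cofactor i := by
  simp only [pderiv_f, Finset.mul_sum, Finset.sum_mul]
  rw [Finset.sum_comm]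
  exact Finset.sum_congr rfl fun i _ => Finset.sum_congr rfl fun k _ => by ring

lemma mem_Jf_iff {p : R} :
    p ∈ Jf ↔ ∃ H : Fin 4 → R, p = ∑ i, (∑ k, C (c i k) * H k) * cofactor i := by
  simp only [Jf_eq_span_range, Ideal.mem_span_range_iff_exists_fun, ← sum_C_mul_eq, eq_comm]

lemma f_mem_Jf : f ∈ Jf := by
  have h : (8 : R) * f ∈ Jf := mem_Jf_iff.2 ⟨X, by
    have (i : Fin 8) : (∑ k, C (c i k) * X k) * cofactor i = f := lin_mul_cofactor i
    simp [this]⟩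
  have h2 := Jf.mul_mem_left (C (1 / 8)) h
  rwa [← mul_assoc, show C (1 / 8) * (8 : R) = 1 by
    rw [← map_ofNat C 8, ← C_mul]; norm_num, one_mul] at h2

/-! ### Primality of the ideals of planes and lines -/

lemma isPrime_of_retraction {I : Ideal R} (φ : R →ₐ[ℚ] R) (hI : ∀ p ∈ I, φ p = 0)
    (hX : ∀ k, X k - φ (X k) ∈ I) : I.IsPrime := by
  have key : (Ideal.Quotient.mkₐ ℚ I).comp φ = Ideal.Quotient.mkₐ ℚ I := by
    ext k
    exact (Ideal.Quotient.eq.2 (hX k)).symm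
  have : I = RingHom.ker φ := by
    ext p
    refine ⟨hI p, fun hp => ?_⟩
    have h := DFunLike.congr_fun key p
    rw [AlgHom.comp_apply, (RingHom.mem_ker).1 hp, map_zero] at h
    exact Ideal.Quotient.eq_zero_iff_mem.1 h.symm
  rw [this]
  exact RingHom.ker_isPrime _

lemma isPrime_span_pair {a b α β : Fin 4 → ℚ} (h₁ : a ⬝ᵥ α = 1) (h₂ : a ⬝ᵥ β = 0)
    (h₃ : b ⬝ᵥ α = 0) (h₄ : b ⬝ᵥ β = 1) : (Ideal.span {lin a, lin b}).IsPrime := by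
  let φ : R →ₐ[ℚ] R := aeval fun k => X k - C (α k) * lin a - C (β k) * lin b
  have hφ (d : Fin 4 → ℚ) :
      φ (lin d) = lin d - C (d ⬝ᵥ α) * lin a - C (d ⬝ᵥ β) * lin b := by
    rw [map_lin]
    simp only [φ, aeval_X, dotProduct, map_sum, C_mul, Finset.sum_mul, mul_sub,
      Finset.sum_sub_distrib, algebraMap_eq, mul_assoc]
    rfl
  refine isPrime_of_retraction φ (fun p hp => ?_) fun k => ?_
  · obtain ⟨u, v, rfl⟩ := Ideal.mem_span_pair.1 hp
    rw [map_add, map_mul, map_mul, hφ, hφ, h₁, h₂, h₃, h₄]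
    simp
  · exact Ideal.mem_span_pair.2 ⟨C (α k), C (β k), by simp only [φ, aeval_X]; ring⟩

lemma prime_lin {a α : Fin 4 → ℚ} (h : a ⬝ᵥ α = 1) : Prime (lin a) := by
  have ha : lin a ≠ 0 := fun h0 => by
    have := eval_lin α a
    rw [h0, h, map_zero] at this
    exact zero_ne_one this
  let φ : R →ₐ[ℚ] R := aeval fun k => X k - C (α k) * lin a
  have hφ : φ (lin a) = 0 := by
    rw [map_lin]
    simp only [φ, aeval_X, mul_sub, Finset.sum_sub_distrib, algebraMap_eq, ← mul_assoc]
    rw [← Finset.sum_mul, show ∑ i, C (a i) * C (α i) = (1 : R) by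
      simp only [← C_mul, ← map_sum]; exact (congrArg C h).trans C_1, one_mul]
    exact sub_self _
  rw [← Ideal.span_singleton_prime ha]
  refine isPrime_of_retraction φ (fun p hp => ?_) fun k => ?_
  · obtain ⟨u, rfl⟩ := Ideal.mem_span_singleton'.1 hp
    rw [map_mul, hφ, mul_zero]
  · exact Ideal.mem_span_singleton'.2 ⟨C (α k), by simp only [φ, aeval_X]; ring⟩

/-! ### Incidences of the eight planes -/

lemma exists_minor_ne_zero {i j : Fin 8} (h : i ≠ j) :
    ∃ p q : Fin 4, c i p * c j q - c i q * c j p ≠ 0 := by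
  revert i j
  decide +kernel

lemma exists_dual {i j : Fin 8} (h : i ≠ j) : ∃ α β : Fin 4 → ℚ,
    c i ⬝ᵥ α = 1 ∧ c i ⬝ᵥ β = 0 ∧ c j ⬝ᵥ α = 0 ∧ c j ⬝ᵥ β = 1 := by
  obtain ⟨p, q, hD⟩ := exists_minor_ne_zero h
  set D := c i p * c j q - c i q * c j p with hDdef
  refine ⟨D⁻¹ • (Pi.single p (c j q) - Pi.single q (c j p)),
    D⁻¹ • (Pi.single q (c i p) - Pi.single p (c i q)), ?_, ?_, ?_, ?_⟩ <;>
  simp only [dotProduct_smul, dotProduct_sub, dotProduct_single, smul_eq_mul]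
  · rw [← hDdef, inv_mul_cancel₀ hD]
  · ring
  · ring
  · rw [show c j q * c i p - c j p * c i q = D by rw [hDdef]; ring, inv_mul_cancel₀ hD]

lemma isPrime_span_planes {i j : Fin 8} (h : i ≠ j) :
    (Ideal.span {lin (c i), lin (c j)}).IsPrime := by
  obtain ⟨α, β, h₁, h₂, h₃, h₄⟩ := exists_dual h
  exact isPrime_span_pair h₁ h₂ h₃ h₄

lemma linearIndependent_planes {i j : Fin 8} (h : i ≠ j) :
    LinearIndependent ℚ ![c i, c j] := by
  obtain ⟨α, β, h₁, h₂, h₃, h₄⟩ := exists_dual h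
  refine LinearIndependent.pair_iff.2 fun s t hst => ⟨?_, ?_⟩
  · simpa [add_dotProduct, h₁, h₃] using congrArg (· ⬝ᵥ α) hst
  · simpa [add_dotProduct, h₂, h₄] using congrArg (· ⬝ᵥ β) hst

lemma prime_plane (i : Fin 8) : Prime (lin (c i)) := by
  obtain ⟨j, hj⟩ := exists_ne i
  obtain ⟨α, β, h, -⟩ := exists_dual hj.symm
  exact prime_lin h

lemma not_lin_dvd_lin {i j : Fin 8} (h : i ≠ j) : ¬ lin (c i) ∣ lin (c j) := by
  rintro ⟨u, hu⟩
  obtain ⟨α, β, -, h₂, -, h₄⟩ := exists_dual h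
  have := congrArg (eval β) hu
  rw [map_mul, eval_lin, eval_lin, h₂, h₄, zero_mul] at this
  exact one_ne_zero this

/-- Sample points separating the non-collinear triples of planes. -/
def samplePoint : Fin 11 → Fin 4 → ℚ :=
  ![![0, 0, 1, 0], ![1, -1, 0, 0], ![0, 1, 0, 0], ![1, 0, 0, 0], ![0, 1, 1, 1], ![1, 0, 1, 1],
    ![1, 1, 0, 1], ![0, 0, 0, 1], ![0, 0, 2, 1], ![1, -1, 1, 1], ![1, -1, 0, -1]]

lemma exists_separating_point : ∀ i j d : Fin 8, i ≠ j → i ≠ d → j ≠ d →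
    ({i, j, d} : Finset (Fin 8)) ≠ {0, 1, 7} →
    ∃ n, c i ⬝ᵥ samplePoint n = 0 ∧ c j ⬝ᵥ samplePoint n = 0 ∧ c d ⬝ᵥ samplePoint n ≠ 0 := by
  decide +kernel

lemma lin_notMem_span {i j d : Fin 8} (hij : i ≠ j) (hid : i ≠ d) (hjd : j ≠ d)
    (h : ({i, j, d} : Finset (Fin 8)) ≠ {0, 1, 7}) :
    lin (c d) ∉ Ideal.span {lin (c i), lin (c j)} := by
  intro hmem
  obtain ⟨n, h₁, h₂, h₃⟩ := exists_separating_point i j d hij hid hjd h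
  obtain ⟨u, v, huv⟩ := Ideal.mem_span_pair.1 hmem
  have := congrArg (eval (samplePoint n)) huv
  simp only [map_add, map_mul, eval_lin, h₁, h₂, mul_zero, add_zero] at this
  exact h₃ this.symm

/-! ### Membership along lines: the normal form `F = ∑ gᵢ f / ℓᵢ` -/

lemma Ieq_le_line {i j : Fin 8} (h : i ≠ j) :
    Ieq ≤ Ideal.span {lin (c i), lin (c j)} ^ mLine i j + Jf :=
  inf_le_left.trans <| iInf_le_of_le i <| iInf_le_of_le j <|
    iInf_le_of_le (linearIndependent_planes h) le_rfl

lemma Ieq_le_point {v : Fin 4 → ℚ} (hv : v ≠ 0) (h : 3 ≤ m v) : Ieq ≤ IP v ^ m v + Jf :=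
  inf_le_right.trans <| iInf_le_of_le v <| iInf_le_of_le hv <| iInf_le_of_le h le_rfl

lemma Jf_le_of_cofactor_mem {I : Ideal R} (h : ∀ i, cofactor i ∈ I) : Jf ≤ I := by
  intro p hp
  obtain ⟨H, rfl⟩ := mem_Jf_iff.1 hp
  exact I.sum_mem fun i _ => I.mul_mem_left _ (h i)

lemma mLine_ne_zero (i j : Fin 8) : mLine i j ≠ 0 :=
  Set.ncard_ne_zero_of_mem (a := i) (Submodule.subset_span (by simp))

lemma Ieq_le_span_pair {i j : Fin 8} (h : i ≠ j) :
    Ieq ≤ Ideal.span {lin (c i), lin (c j)} := by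
  refine (Ieq_le_line h).trans (sup_le (Ideal.pow_le_self (mLine_ne_zero i j)) ?_)
  refine Jf_le_of_cofactor_mem fun k => ?_
  by_cases hk : i = k
  · exact Ideal.mem_of_dvd _ (lin_dvd_cofactor (hk ▸ h.symm)) (Ideal.subset_span (by simp))
  · exact Ideal.mem_of_dvd _ (lin_dvd_cofactor hk) (Ideal.subset_span (by simp))

lemma lin_seven : lin (c 7) = lin (c 0) + lin (c 1) := by
  simp [lin, c, Fin.sum_univ_four]

lemma three_le_mLine : 3 ≤ mLine 0 1 := by
  have h : (({0, 1, 7} : Finset (Fin 8)) : Set (Fin 8)) ⊆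
      {k | c k ∈ Submodule.span ℚ ({c 0, c 1} : Set (Fin 4 → ℚ))} := by
    intro k hk
    simp only [Finset.coe_insert, Finset.coe_singleton, Set.mem_insert_iff,
      Set.mem_singleton_iff] at hk
    rw [Set.mem_ofPred_eq, Submodule.mem_span_pair]
    rcases hk with rfl | rfl | rfl
    · exact ⟨1, 0, by simp⟩
    · exact ⟨0, 1, by simp⟩
    · exact ⟨1, 1, by simp [c]⟩
  have := Set.ncard_le_ncard h
  rwa [Set.ncard_coe_finset] at this

lemma Ieq_le_triple : Ieq ≤ Ideal.span {lin (c 0), lin (c 1)} ^ 2 := by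
  refine (Ieq_le_line (by decide)).trans (sup_le (Ideal.pow_le_pow_right
    (le_trans (by decide) three_le_mLine)) (Jf_le_of_cofactor_mem fun k => ?_))
  have h0 : lin (c 0) ∈ Ideal.span {lin (c 0), lin (c 1)} := Ideal.subset_span (by simp)
  have h1 : lin (c 1) ∈ Ideal.span {lin (c 0), lin (c 1)} := Ideal.subset_span (by simp)
  have h7 : lin (c 7) ∈ Ideal.span {lin (c 0), lin (c 1)} := lin_seven ▸ add_mem h0 h1
  have key {i j : Fin 8} (hij : i ≠ j) (hi : i ≠ k) (hj : j ≠ k)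
      (hi' : lin (c i) ∈ Ideal.span {lin (c 0), lin (c 1)})
      (hj' : lin (c j) ∈ Ideal.span {lin (c 0), lin (c 1)}) :
      cofactor k ∈ Ideal.span {lin (c 0), lin (c 1)} ^ 2 := by
    have hdvd : ∏ l ∈ {i, j}, lin (c l) ∣ cofactor k :=
      Finset.prod_dvd_prod_of_subset _ _ _ fun l hl => by
        rcases Finset.mem_insert.1 hl with rfl | hl
        · simpa using hi
        · simpa [Finset.mem_singleton.1 hl] using hj
    rw [Finset.prod_pair hij] at hdvd
    rw [sq]
    exact Ideal.mem_of_dvd _ hdvd (Ideal.mul_mem_mul hi' hj')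
  by_cases hk0 : k = 0
  · exact key (i := 1) (j := 7) (by decide) (by simp [hk0]) (by simp [hk0]) h1 h7
  by_cases hk1 : k = 1
  · exact key (i := 0) (j := 7) (by decide) (by simp [hk1]) (by simp [hk1]) h0 h7
  · exact key (i := 0) (j := 1) (by decide) (Ne.symm hk0) (Ne.symm hk1) h0 h1

/-- The planes other than the `i`-th through the triple line, if the `i`-th contains it. -/
def tripleMates (i : Fin 8) : Finset (Fin 8) :=
  if i ∈ ({0, 1, 7} : Finset (Fin 8)) then ({0, 1, 7} : Finset (Fin 8)).erase i else ∅

lemma mem_span_tripleMates {F : R} (hF : F ∈ Ieq) (i : Fin 8) :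
    F ∈ Ideal.span {lin (c i), ∏ j ∈ tripleMates i, lin (c j)} := by
  have hsq := Ieq_le_triple hF
  have hle {a b : R} {J : Ideal R} (h₁ : a * a ∈ J) (h₂ : a * b ∈ J) (h₃ : b * b ∈ J) :
      Ideal.span {a, b} ^ 2 ≤ J := by
    rw [sq, Ideal.span_pair_mul_span_pair, Ideal.span_le]
    rintro x (rfl | rfl | rfl | rfl)
    exacts [h₁, h₂, mul_comm a b ▸ h₂, h₃]
  by_cases hi : i ∈ ({0, 1, 7} : Finset (Fin 8))
  · simp only [Finset.mem_insert, Finset.mem_singleton] at hi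
    rcases hi with rfl | rfl | rfl
    · rw [show tripleMates 0 = {1, 7} by decide, Finset.prod_pair (by decide), lin_seven]
      refine hle ?_ ?_ ?_ hsq <;> rw [Ideal.mem_span_pair]
      exacts [⟨lin (c 0), 0, by ring⟩, ⟨lin (c 1), 0, by ring⟩, ⟨-lin (c 1), 1, by ring⟩]
    · rw [show tripleMates 1 = {0, 7} by decide, Finset.prod_pair (by decide), lin_seven]
      refine hle ?_ ?_ ?_ hsq <;> rw [Ideal.mem_span_pair]
      exacts [⟨-lin (c 0), 1, by ring⟩, ⟨lin (c 0), 0, by ring⟩, ⟨lin (c 1), 0, by ring⟩]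
    · rw [show tripleMates 7 = {0, 1} by decide, Finset.prod_pair (by decide), lin_seven]
      refine hle ?_ ?_ ?_ hsq <;> rw [Ideal.mem_span_pair]
      exacts [⟨lin (c 0), -1, by ring⟩, ⟨0, 1, by ring⟩, ⟨lin (c 1), -1, by ring⟩]
  · rw [tripleMates, if_neg hi, Finset.prod_empty, Ideal.span_pair_comm]
    exact Ideal.mem_span_pair.2 ⟨F, 0, by ring⟩

lemma mem_span_mul {A : Type*} [CommRing A] {a p b F : A} (hp : F ∈ Ideal.span {a, p})
    (hb : F ∈ Ideal.span {a, b}) (hprime : (Ideal.span {a, b}).IsPrime)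
    (hpb : p ∉ Ideal.span {a, b}) : F ∈ Ideal.span {a, b * p} := by
  obtain ⟨u, v, rfl⟩ := Ideal.mem_span_pair.1 hp
  have ha : a ∈ Ideal.span {a, b} := Ideal.subset_span (by simp)
  have hv : v * p ∈ Ideal.span {a, b} :=
    (Ideal.add_mem_iff_right _ (Ideal.mul_mem_left _ u ha)).1 hb
  obtain ⟨s, t, rfl⟩ := Ideal.mem_span_pair.1 ((hprime.mem_or_mem hv).resolve_right hpb)
  exact Ideal.mem_span_pair.2 ⟨u + s * p, t, by ring⟩

lemma notMem_tripleMates : ∀ i j d : Fin 8, i ≠ j → j ∉ tripleMates i → i ≠ d →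
    j ≠ d → ({i, j, d} : Finset (Fin 8)) ≠ {0, 1, 7} := by
  decide +kernel

lemma mem_span_cofactor {F : R} (hF : F ∈ Ieq) (i : Fin 8) :
    F ∈ Ideal.span {lin (c i), cofactor i} := by
  have key (s : Finset (Fin 8)) (hs : i ∉ s) (hd : Disjoint s (tripleMates i)) :
      F ∈ Ideal.span {lin (c i), ∏ j ∈ s ∪ tripleMates i, lin (c j)} := by
    induction s using Finset.induction_on with
    | empty => simpa using mem_span_tripleMates hF i
    | insert j s hj ih =>
      rw [Finset.disjoint_insert_left] at hd
      have hij : i ≠ j := fun h => hs (by simp [h])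
      have hjs : j ∉ s ∪ tripleMates i := by simp [hj, hd.1]
      have hprime := isPrime_span_planes hij
      rw [Finset.insert_union, Finset.prod_insert hjs]
      refine mem_span_mul (ih (fun h => hs (by simp [h])) hd.2) (Ieq_le_span_pair hij hF)
        hprime fun hmem => ?_
      obtain ⟨d, hds, hdmem⟩ := (Ideal.IsPrime.prod_mem_iff (hp := hprime)).1 hmem
      have hid : i ≠ d := by
        rintro rfl
        rcases Finset.mem_union.1 hds with h | h
        · exact hs (by simp [h])
        · exact (by decide : ∀ i, i ∉ tripleMates i) i h
      have hjd : j ≠ d := fun h => hjs (h ▸ hds)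
      exact lin_notMem_span hij hid hjd (notMem_tripleMates i j d hij hd.1 hid hjd) hdmem
  have h := key ((Finset.univ.erase i) \ tripleMates i) (by simp) Finset.sdiff_disjoint
  rwa [Finset.sdiff_union_of_subset] at h
  exact (by decide : ∀ i, tripleMates i ⊆ Finset.univ.erase i) i

lemma f_dvd_of_forall_dvd {G : R} (h : ∀ i, lin (c i) ∣ G) : f ∣ G := by
  refine Finset.prod_dvd_of_isRelPrime (fun i _ j _ hij => ?_) fun i _ => h i
  exact (prime_plane i).irreducible.isRelPrime_iff_not_dvd.2 (not_lin_dvd_lin hij)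

lemma exists_eq_sum_mul_cofactor {F : R} (hF : F ∈ Ieq) :
    ∃ q : Fin 8 → R, F = ∑ i, q i * cofactor i := by
  choose u v huv using fun i => Ideal.mem_span_pair.1 (mem_span_cofactor hF i)
  have hdvd : f ∣ F - ∑ i, v i * cofactor i := f_dvd_of_forall_dvd fun i => by
    rw [← Finset.add_sum_erase _ _ (Finset.mem_univ i), ← sub_sub]
    refine dvd_sub ⟨u i, by linear_combination -huv i⟩ (Finset.dvd_sum fun j hj => ?_)
    exact (lin_dvd_cofactor (Finset.ne_of_mem_erase hj).symm).mul_left _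
  obtain ⟨r, hr⟩ := hdvd
  refine ⟨v + Pi.single 0 (r * lin (c 0)), ?_⟩
  have h : ∑ i, (Pi.single 0 (r * lin (c 0)) : Fin 8 → R) i * cofactor i = r * f := by
    rw [Finset.sum_eq_single 0 (fun i _ hi => by simp [hi]) (by simp), Pi.single_eq_same,
      mul_assoc, lin_mul_cofactor]
  simp only [Pi.add_apply, add_mul, Finset.sum_add_distrib, h]
  linear_combination hr

lemma homogeneousComponent_mul_of_isHomogeneous {p q : R} {n k : ℕ} (hq : q.IsHomogeneous n) :
    homogeneousComponent (k + n) (p * q) = homogeneousComponent k p * q := by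
  conv_lhs => rw [← sum_homogeneousComponent p, Finset.sum_mul, map_sum]
  have h (i : ℕ) : homogeneousComponent (k + n) (homogeneousComponent i p * q) =
      if i = k then homogeneousComponent k p * q else 0 := by
    rw [homogeneousComponent_of_mem
      ((homogeneousComponent_isHomogeneous i p).mul hq : _ ∈ homogeneousSubmodule _ _ _)]
    by_cases hik : i = k
    · simp [hik]
    · rw [if_neg (by omega), if_neg hik]
  simp only [h, Finset.sum_ite_eq', Finset.mem_range]
  split_ifs with hk
  · rfl
  · rw [homogeneousComponent_eq_zero _ _ (by omega), zero_mul]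

lemma exists_eq_sum_lin_mul_cofactor {F : R} (hF : F ∈ Ieq) (h8 : F.IsHomogeneous 8) :
    ∃ g : Fin 8 → Fin 4 → ℚ, F = ∑ i, lin (g i) * cofactor i := by
  obtain ⟨q, hq⟩ := exists_eq_sum_mul_cofactor hF
  choose g hg using fun i => exists_eq_lin (homogeneousComponent_isHomogeneous 1 (q i))
  refine ⟨g, ?_⟩
  have h (i : Fin 8) : homogeneousComponent 8 (q i * cofactor i) = lin (g i) * cofactor i := by
    rw [← hg, ← homogeneousComponent_mul_of_isHomogeneous (isHomogeneous_cofactor i)]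
  calc F = homogeneousComponent 8 F := (homogeneousComponent_eq_self h8).symm
    _ = ∑ i, homogeneousComponent 8 (q i * cofactor i) := by rw [← map_sum, ← hq]
    _ = ∑ i, lin (g i) * cofactor i := Finset.sum_congr rfl fun i _ => h i

/-! ### Membership at points: linear conditions on the `gᵢ` -/

/-- Restriction of polynomials to the parametrised line `s ↦ v + s w`. -/
def restrictLine (v w : Fin 4 → ℚ) : R →ₐ[ℚ] Polynomial ℚ :=
  aeval fun j => Polynomial.C (v j) + Polynomial.X * Polynomial.C (w j)

lemma restrictLine_lin (v w a : Fin 4 → ℚ) : restrictLine v w (lin a) =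
    Polynomial.C (a ⬝ᵥ v) + Polynomial.X * Polynomial.C (a ⬝ᵥ w) := by
  rw [map_lin]
  simp only [restrictLine, aeval_X, dotProduct, map_sum, map_mul, mul_add, Finset.sum_add_distrib,
    Finset.mul_sum, Polynomial.algebraMap_eq]
  congr 1
  exact Finset.sum_congr rfl fun i _ => by ring

lemma eval_zero_restrictLine (v w : Fin 4 → ℚ) (p : R) :
    (restrictLine v w p).eval 0 = eval v p := by
  have : (Polynomial.aeval (0 : ℚ)).comp (restrictLine v w) = aeval v := by
    ext j
    simp [restrictLine]
  simpa [Polynomial.aeval_def, aeval_def, eval₂_id] using DFunLike.congr_fun this p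

lemma X_pow_dvd_restrictLine {v : Fin 4 → ℚ} (w : Fin 4 → ℚ) {n : ℕ} {p : R}
    (hp : p ∈ IP v ^ n) : Polynomial.X ^ n ∣ restrictLine v w p := by
  have hle : IP v ≤ (Ideal.span {Polynomial.X}).comap (restrictLine v w) := by
    rw [IP, Ideal.span_le]
    rintro _ ⟨a, ha, rfl⟩
    have ha : a ⬝ᵥ v = 0 := ha
    rw [SetLike.mem_coe, Ideal.mem_comap, Ideal.mem_span_singleton, restrictLine_lin, ha]
    simp
  have h := Ideal.pow_right_mono hle n hp
  have h2 := Ideal.le_comap_pow (restrictLine v w) n h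
  rwa [Ideal.mem_comap, Ideal.span_singleton_pow, Ideal.mem_span_singleton] at h2

lemma m_eq_card (v : Fin 4 → ℚ) : m v = (Finset.univ.filter fun i => c i ⬝ᵥ v = 0).card := by
  rw [m, ← Set.ncard_coe_finset]
  simp

lemma restrictLine_cofactor {v w : Fin 4 → ℚ} {i : Fin 8} (hv : c i ⬝ᵥ v = 0)
    (hw : ∀ j, j ≠ i → c j ⬝ᵥ v = 0 → c j ⬝ᵥ w ≠ 0) :
    ∃ U : Polynomial ℚ, U.eval 0 ≠ 0 ∧
      restrictLine v w (cofactor i) = Polynomial.X ^ (m v - 1) * U := by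
  refine ⟨∏ j ∈ Finset.univ.erase i, if c j ⬝ᵥ v = 0 then Polynomial.C (c j ⬝ᵥ w) else
    Polynomial.C (c j ⬝ᵥ v) + Polynomial.X * Polynomial.C (c j ⬝ᵥ w), ?_, ?_⟩
  · rw [Polynomial.eval_prod]
    refine Finset.prod_ne_zero_iff.2 fun j hj => ?_
    split_ifs with h
    · simpa using hw j (Finset.ne_of_mem_erase hj) h
    · simpa using h
  · have hcard : (Finset.univ.erase i |>.filter fun j => c j ⬝ᵥ v = 0).card = m v - 1 := by
      rw [Finset.filter_erase, Finset.card_erase_of_mem (by simpa using hv), m_eq_card]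
    rw [cofactor, map_prod, ← hcard, ← Finset.prod_const, Finset.prod_filter,
      ← Finset.prod_mul_distrib]
    refine Finset.prod_congr rfl fun j _ => ?_
    rw [restrictLine_lin]
    split_ifs with h <;> simp [h]

lemma restrictLine_sum_cofactor {v w : Fin 4 → ℚ} {i : Fin 8} (hv : c i ⬝ᵥ v = 0)
    (hw : c i ⬝ᵥ w = 0) (q : Fin 8 → R) :
    restrictLine v w (∑ j, q j * cofactor j) =
      restrictLine v w (q i) * restrictLine v w (cofactor i) := by
  rw [map_sum, Finset.sum_eq_single i, map_mul]
  · intro j _ hj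
    obtain ⟨u, hu⟩ := lin_dvd_cofactor hj.symm
    rw [hu, map_mul, map_mul, restrictLine_lin, hv, hw]
    simp
  · simp

lemma exists_tangent_of_mem {v : Fin 4 → ℚ} (hm : 1 ≤ m v) {g : Fin 8 → Fin 4 → ℚ}
    (hF : ∑ i, lin (g i) * cofactor i ∈ IP v ^ m v + Jf) :
    ∃ h : Fin 4 → ℚ, ∀ i w, c i ⬝ᵥ v = 0 → c i ⬝ᵥ w = 0 →
      (∀ j, j ≠ i → c j ⬝ᵥ v = 0 → c j ⬝ᵥ w ≠ 0) → g i ⬝ᵥ v = c i ⬝ᵥ h := by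
  obtain ⟨A, hA, B, hB, hAB⟩ := Submodule.mem_sup.1 hF
  obtain ⟨H, rfl⟩ := mem_Jf_iff.1 hB
  refine ⟨fun k => eval v (H k), fun i w hv hw hw' => ?_⟩
  obtain ⟨U, hU, hcof⟩ := restrictLine_cofactor hv hw'
  have hA' := X_pow_dvd_restrictLine w hA
  rw [eq_sub_of_add_eq hAB, map_sub, restrictLine_sum_cofactor hv hw,
    restrictLine_sum_cofactor hv hw, ← sub_mul, ← map_sub, hcof, mul_left_comm,
    ← Nat.sub_add_cancel hm, Nat.add_sub_cancel, pow_succ,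
    mul_dvd_mul_iff_left (pow_ne_zero _ Polynomial.X_ne_zero), Polynomial.X_dvd_iff,
    Polynomial.coeff_zero_eq_eval_zero, Polynomial.eval_mul, eval_zero_restrictLine] at hA'
  have := (mul_eq_zero.1 hA').resolve_right hU
  rw [map_sub, eval_lin, sub_eq_zero] at this
  simpa [dotProduct] using this

lemma exists_tangent {g : Fin 8 → Fin 4 → ℚ} (hF : ∑ i, lin (g i) * cofactor i ∈ Ieq)
    (v : Fin 4 → ℚ) (hv : v ≠ 0) (hm : 3 ≤ (Finset.univ.filter fun i => c i ⬝ᵥ v = 0).card) :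
    ∃ h : Fin 4 → ℚ, ∀ i w, c i ⬝ᵥ v = 0 → c i ⬝ᵥ w = 0 →
      (∀ j, j ≠ i → c j ⬝ᵥ v = 0 → c j ⬝ᵥ w ≠ 0) → g i ⬝ᵥ v = c i ⬝ᵥ h := by
  rw [← m_eq_card] at hm
  exact exists_tangent_of_mem (by omega) (Ieq_le_point hv hm hF)

lemma relations_of_mem_Ieq {g : Fin 8 → Fin 4 → ℚ}
    (hF : ∑ i, lin (g i) * cofactor i ∈ Ieq) :
    -3 * g 0 2 - g 0 3 - 3 * g 1 2 - g 1 3 + 3 * g 7 2 + g 7 3 = 0 ∧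
    g 0 2 - g 0 3 + g 1 2 - g 1 3 - g 7 2 + g 7 3 = 0 ∧
    -g 0 2 + g 1 2 + g 3 2 - g 4 2 = 0 ∧
    g 1 0 - g 2 0 - g 4 0 + g 5 0 = 0 ∧
    g 0 1 - g 2 1 - g 3 1 + g 5 1 = 0 ∧
    g 2 0 - g 2 1 - 2 * g 5 0 + 2 * g 5 1 + g 6 0 - g 6 1 - g 7 0 + g 7 1 = 0 ∧
    -g 2 0 - g 2 1 - g 2 3 - g 3 0 - g 3 1 - g 3 3 - g 4 0 - g 4 1 - g 4 3 + g 6 0 + g 6 1 +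
      g 6 3 = 0 ∧
    -g 1 0 - g 1 2 - g 1 3 - g 3 0 - g 3 2 - g 3 3 - g 5 0 - g 5 2 - g 5 3 + g 6 0 + g 6 2 +
      g 6 3 = 0 ∧
    -g 0 1 - g 0 2 - g 0 3 - g 4 1 - g 4 2 - g 4 3 - g 5 1 - g 5 2 - g 5 3 + g 6 1 + g 6 2 +
      g 6 3 = 0 := by
  refine ⟨?_, ?_, ?_, ?_, ?_, ?_, ?_, ?_, ?_⟩
  · obtain ⟨h, hh⟩ := exists_tangent hF ![0, 0, 3, 1] (by decide +kernel) (by decide +kernel)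
    have h0 := hh 0 ![0, 1, 0, 0] (by decide +kernel) (by decide +kernel) (by decide +kernel)
    have h1 := hh 1 ![1, 0, 0, 0] (by decide +kernel) (by decide +kernel) (by decide +kernel)
    have h7 := hh 7 ![1, -1, 0, 0] (by decide +kernel) (by decide +kernel) (by decide +kernel)
    simp [dotProduct, Fin.sum_univ_four, c] at h0 h1 h7
    linarith
  · obtain ⟨h, hh⟩ := exists_tangent hF ![0, 0, -1, 1] (by decide +kernel) (by decide +kernel)
    have h0 := hh 0 ![0, 1, 0, 0] (by decide +kernel) (by decide +kernel) (by decide +kernel)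
    have h1 := hh 1 ![1, 0, 0, 0] (by decide +kernel) (by decide +kernel) (by decide +kernel)
    have h7 := hh 7 ![1, -1, 0, 0] (by decide +kernel) (by decide +kernel) (by decide +kernel)
    simp [dotProduct, Fin.sum_univ_four, c] at h0 h1 h7
    linarith
  · obtain ⟨h, hh⟩ := exists_tangent hF ![0, 0, 1, 0] (by decide +kernel) (by decide +kernel)
    have h0 := hh 0 ![0, 1, 0, -1] (by decide +kernel) (by decide +kernel) (by decide +kernel)
    have h1 := hh 1 ![1, 0, 0, -1] (by decide +kernel) (by decide +kernel) (by decide +kernel)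
    have h3 := hh 3 ![1, 2, 0, 1] (by decide +kernel) (by decide +kernel) (by decide +kernel)
    have h4 := hh 4 ![2, 1, 0, 1] (by decide +kernel) (by decide +kernel) (by decide +kernel)
    simp [dotProduct, Fin.sum_univ_four, c] at h0 h1 h3 h4
    linarith
  · obtain ⟨h, hh⟩ := exists_tangent hF ![1, 0, 0, 0] (by decide +kernel) (by decide +kernel)
    have h1 := hh 1 ![0, 0, 1, -1] (by decide +kernel) (by decide +kernel) (by decide +kernel)
    have h2 := hh 2 ![0, 1, 0, -1] (by decide +kernel) (by decide +kernel) (by decide +kernel)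
    have h4 := hh 4 ![0, 1, -1, 1] (by decide +kernel) (by decide +kernel) (by decide +kernel)
    have h5 := hh 5 ![0, 1, -1, -1] (by decide +kernel) (by decide +kernel) (by decide +kernel)
    simp [dotProduct, Fin.sum_univ_four, c] at h1 h2 h4 h5
    linarith
  · obtain ⟨h, hh⟩ := exists_tangent hF ![0, 1, 0, 0] (by decide +kernel) (by decide +kernel)
    have h0 := hh 0 ![0, 0, 1, -1] (by decide +kernel) (by decide +kernel) (by decide +kernel)
    have h2 := hh 2 ![1, 0, 0, -1] (by decide +kernel) (by decide +kernel) (by decide +kernel)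
    have h3 := hh 3 ![1, 0, -1, 1] (by decide +kernel) (by decide +kernel) (by decide +kernel)
    have h5 := hh 5 ![1, 0, -1, -1] (by decide +kernel) (by decide +kernel) (by decide +kernel)
    simp [dotProduct, Fin.sum_univ_four, c] at h0 h2 h3 h5
    linarith
  · obtain ⟨h, hh⟩ := exists_tangent hF ![1, -1, 0, 0] (by decide +kernel) (by decide +kernel)
    have h2 := hh 2 ![0, 1, 0, 1] (by decide +kernel) (by decide +kernel) (by decide +kernel)
    have h5 := hh 5 ![0, 1, -1, -1] (by decide +kernel) (by decide +kernel) (by decide +kernel)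
    have h6 := hh 6 ![0, 1, -1, 0] (by decide +kernel) (by decide +kernel) (by decide +kernel)
    have h7 := hh 7 ![0, 0, 1, 0] (by decide +kernel) (by decide +kernel) (by decide +kernel)
    simp [dotProduct, Fin.sum_univ_four, c] at h2 h5 h6 h7
    linarith
  · obtain ⟨h, hh⟩ := exists_tangent hF ![1, 1, 0, 1] (by decide +kernel) (by decide +kernel)
    have h2 := hh 2 ![0, 0, 0, 1] (by decide +kernel) (by decide +kernel) (by decide +kernel)
    have h3 := hh 3 ![0, 1, 1, 0] (by decide +kernel) (by decide +kernel) (by decide +kernel)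
    have h4 := hh 4 ![1, 0, 1, 0] (by decide +kernel) (by decide +kernel) (by decide +kernel)
    have h6 := hh 6 ![0, 0, 2, 1] (by decide +kernel) (by decide +kernel) (by decide +kernel)
    simp [dotProduct, Fin.sum_univ_four, c] at h2 h3 h4 h6
    linarith
  · obtain ⟨h, hh⟩ := exists_tangent hF ![1, 0, 1, 1] (by decide +kernel) (by decide +kernel)
    have h1 := hh 1 ![0, 0, 0, 1] (by decide +kernel) (by decide +kernel) (by decide +kernel)
    have h3 := hh 3 ![0, 1, 1, 0] (by decide +kernel) (by decide +kernel) (by decide +kernel)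
    have h5 := hh 5 ![1, 1, 0, 0] (by decide +kernel) (by decide +kernel) (by decide +kernel)
    have h6 := hh 6 ![0, 2, 0, 1] (by decide +kernel) (by decide +kernel) (by decide +kernel)
    simp [dotProduct, Fin.sum_univ_four, c] at h1 h3 h5 h6
    linarith
  · obtain ⟨h, hh⟩ := exists_tangent hF ![0, 1, 1, 1] (by decide +kernel) (by decide +kernel)
    have h0 := hh 0 ![0, 0, 0, 1] (by decide +kernel) (by decide +kernel) (by decide +kernel)
    have h4 := hh 4 ![1, 0, 1, 0] (by decide +kernel) (by decide +kernel) (by decide +kernel)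
    have h5 := hh 5 ![1, 1, 0, 0] (by decide +kernel) (by decide +kernel) (by decide +kernel)
    have h6 := hh 6 ![2, 0, 0, 1] (by decide +kernel) (by decide +kernel) (by decide +kernel)
    simp [dotProduct, Fin.sum_univ_four, c] at h0 h4 h5 h6
    linarith

lemma exists_derivation {g : Fin 8 → Fin 4 → ℚ} (hF : ∑ i, lin (g i) * cofactor i ∈ Ieq) :
    ∃ (M : Fin 4 → Fin 4 → ℚ) (μ : Fin 8 → ℚ),
      ∀ i j, g i j = ∑ k, c i k * M k j + μ i * c i j := by
  obtain ⟨r₁, r₂, r₃, r₄, r₅, r₆, r₇, r₈, r₉⟩ := relations_of_mem_Ieq hF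
  refine ⟨![![-g 1 0 + g 7 0, g 0 1, g 0 2, g 0 3],
      ![g 1 0, g 0 1 + g 0 3 - 2 * g 1 0 - g 1 3 - g 3 0 - g 3 1 - g 3 3 + g 4 0 + g 4 1 + g 4 3 +
        g 7 0, g 1 2, g 1 3],
      ![g 2 0, g 2 1, g 0 2 + g 0 3 - 2 * g 1 0 - g 2 3 - g 3 0 - g 3 2 - g 3 3 + g 4 0 + g 5 2 +
        g 5 3 + g 7 0, g 2 3],
      ![g 1 0 - g 4 0, g 0 1 - g 3 1, g 0 2 - g 3 2, g 0 3 - 2 * g 1 0 - g 3 0 - g 3 3 + g 4 0 +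
        g 7 0]],
    ![g 0 0 + g 1 0 - g 7 0,
      -g 0 1 - g 0 3 + 2 * g 1 0 + g 1 1 + g 1 3 + g 3 0 + g 3 1 + g 3 3 - g 4 0 - g 4 1 - g 4 3 -
        g 7 0,
      -g 0 2 - g 0 3 + 2 * g 1 0 + g 2 2 + g 2 3 + g 3 0 + g 3 2 + g 3 3 - g 4 0 - g 5 2 - g 5 3 -
        g 7 0,
      2 * g 1 0 + g 3 0 - g 4 0 - g 7 0,
      -g 0 3 + 2 * g 1 0 + g 1 3 + g 3 0 + g 3 3 - g 4 0 - g 4 3 - g 7 0,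
      -g 0 3 + 2 * g 1 0 + g 2 3 + g 3 0 + g 3 3 - g 4 0 - g 5 3 - g 7 0,
      2 * g 1 0 - g 2 0 - 2 * g 4 0 + g 6 0 - g 7 0,
      0], ?_⟩
  intro i j
  fin_cases i <;> fin_cases j <;> simp [Fin.sum_univ_four, c] <;> linarith

lemma sum_lin_mul_cofactor_mem_Jf {g : Fin 8 → Fin 4 → ℚ} {M : Fin 4 → Fin 4 → ℚ}
    {μ : Fin 8 → ℚ} (h : ∀ i j, g i j = ∑ k, c i k * M k j + μ i * c i j) :
    ∑ i, lin (g i) * cofactor i ∈ Jf := by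
  have hlin (i : Fin 8) :
      lin (g i) = ∑ k, C (c i k) * lin (M k) + C (μ i) * lin (c i) := by
    simp only [lin, h, C_add, map_sum, C_mul, add_mul, Finset.sum_add_distrib, Finset.sum_mul,
      Finset.mul_sum, mul_assoc]
    rw [Finset.sum_comm]
  simp only [hlin, add_mul, Finset.sum_add_distrib]
  refine add_mem (mem_Jf_iff.2 ⟨fun k => lin (M k), rfl⟩) (sum_mem fun i _ => ?_)
  rw [mul_assoc, lin_mul_cofactor]
  exact Jf.mul_mem_left _ f_mem_Jf

lemma Jf_le_Ieq : Jf ≤ Ieq :=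
  le_inf (le_iInf fun _ => le_iInf fun _ => le_iInf fun _ => le_sup_right)
    (le_iInf fun _ => le_iInf fun _ => le_iInf fun _ => le_sup_right)

/-- The degree-8 homogeneous components of `I_eq` and of `Jf` coincide;
equivalently `dim_ℚ (I_eq/Jf)^(8) = 0`: arrangement no. 61 admits no
nontrivial equisingular deformations, and the associated double octic
Calabi–Yau threefold is rigid. -/
theorem arrangement61_rigid :
    Submodule.restrictScalars ℚ Ieq ⊓ homogeneousSubmodule (Fin 4) ℚ 8 =
    Submodule.restrictScalars ℚ Jf ⊓ homogeneousSubmodule (Fin 4) ℚ 8 := by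
  refine le_antisymm (fun F hF => ⟨?_, hF.2⟩) (inf_le_inf_right _ Jf_le_Ieq)
  obtain ⟨g, rfl⟩ := exists_eq_sum_lin_mul_cofactor hF.1 hF.2
  obtain ⟨M, μ, h⟩ := exists_derivation hF.1
  exact sum_lin_mul_cofactor_mem_Jf h

end Octic61
end
end
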